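/- arXiv:1302.1952 — 3 statements merged into one kernel-verified Lean document; each statement's English description precedes it below -/
import Mathlib

section
/- Let m, n be positive integers with m > n and (m,n) ≠ (2,1), and let ψ₁, …, ψ_n : (0,∞) → (0,∞) be functions tending to zero at infinity (no monotonicity assumed). If the series ∑_{r=1}^∞ ψ₁(r)⋯ψ_n(r) r^{m−n−1} diverges, then the set W₀(m,n,ψ) has mn-dimensional Lebesgue measure 1, i.e. full measure in [−1/2,1/2]^{mn}. -/
open MeasureTheory Filter

/-- Supremum norm of an integer vector, as a real number. -/
noncomputable def supZ {k : ℕ} (q : Fin k → ℤ) : ℝ := ‖(fun i => (q i : ℝ))‖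

/-- The set `W₀(m,n,ψ)` of `ψ`-approximable `m × n` matrices (rows indexed by
`Fin m`, columns by `Fin n`) with all entries in `[-1/2, 1/2]`. -/
def W0 (m n : ℕ) (ψ : Fin n → ℝ → ℝ) : Set (Fin m → Fin n → ℝ) :=
  {X | (∀ j i, X j i ∈ Set.Icc (-(1:ℝ)/2) (1/2)) ∧
    {q : Fin m → ℤ | q ≠ 0 ∧ ∀ i, |∑ j, (q j : ℝ) * X j i| < ψ i (supZ q)}.Infinite}

open scoped ENNReal NNReal


lemma abs_bc {E P : Type*} [TopologicalSpace E] [MeasurableSpace E] [BorelSpace E]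
    (μ : Measure E) [IsFiniteMeasure μ] [μ.OuterRegular] (ν : Measure E)
    (I : ℕ → Finset P) (A : ℕ → P → Set E) (hA : ∀ r p, MeasurableSet (A r p))
    (w : ℕ → ℝ) (hw : ∀ r, 0 ≤ w r)
    (hdiv : Tendsto (fun R => ∑ r ∈ Finset.range R, w r) atTop atTop) (C : ℝ) (hC : 0 ≤ C)
    (h2 : ∀ᶠ R in atTop, ∑ r ∈ Finset.range R, ∑ p ∈ I r, ∑ s ∈ Finset.range R, ∑ q ∈ I s,
      μ (A r p ∩ A s q) ≤ ENNReal.ofReal (C * (∑ r ∈ Finset.range R, w r) ^ 2))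
    (h1 : ∀ U, IsOpen U → ∀ c : ℝ, 0 ≤ c → ENNReal.ofReal c < ν U →
      ∀ᶠ r in atTop, ENNReal.ofReal (c * w r) ≤ ∑ p ∈ I r, μ (A r p ∩ U)) :
    ν {x | {rp : ℕ × P | rp.2 ∈ I rp.1 ∧ x ∈ A rp.1 rp.2}.Finite} = 0 := by
  classical
  set g : ℕ → E → ℝ≥0∞ := fun R x => ∑ r ∈ Finset.range R, ∑ p ∈ I r, (A r p).indicator 1 x with hg
  have hgm : ∀ R, Measurable (g R) := by
    intro R
    refine Finset.measurable_fun_sum _ fun r _ => Finset.measurable_fun_sum _ fun p _ => ?_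
    exact measurable_one.indicator (hA r p)
  set Z : ℕ → Set E := fun j => {x | ∀ R, g R x ≤ j} with hZ
  have hZm : ∀ j, MeasurableSet (Z j) := by
    intro j
    have : Z j = ⋂ R, {x | g R x ≤ j} := by ext; simp [hZ]
    rw [this]
    exact MeasurableSet.iInter fun R => measurableSet_le (hgm R) measurable_const
  have hsub : {x | {rp : ℕ × P | rp.2 ∈ I rp.1 ∧ x ∈ A rp.1 rp.2}.Finite} ⊆ ⋃ j, Z j := by
    intro x hx
    simp only [Set.mem_setOf_eq] at hx
    refine Set.mem_iUnion.2 ⟨hx.toFinset.card, fun R => ?_⟩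
    have : g R x = (((Finset.range R).sigma (fun r => I r)).filter
        (fun z => x ∈ A z.1 z.2)).card := by
      simp only [hg]
      rw [Finset.sum_sigma', Finset.card_filter]
      push_cast
      refine Finset.sum_congr rfl fun z _ => ?_
      simp [Set.indicator_apply]
    rw [this]
    norm_cast
    refine Finset.card_le_card_of_injOn (fun z => (z.1, z.2)) ?_ ?_
    · intro z hz
      simp at hz ⊢
      exact ⟨hz.1.2, hz.2⟩
    · rintro ⟨a, b⟩ _ ⟨c, d⟩ _ h
      simp at h
      simp [h.1, h.2]
  refine measure_mono_null hsub (measure_iUnion_null fun j => ?_)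
  by_contra hne
  have hpos : 0 < ν (Z j) := pos_iff_ne_zero.2 hne
  obtain ⟨c', hc'0, hc'⟩ := ENNReal.lt_iff_exists_real_btwn.1 hpos
  obtain ⟨hc'1, hc'2⟩ := hc'
  have hcpos : 0 < c' := by simpa using hc'1
  set δ : ℝ := c' / (4 * (C + 1)) with hδ
  have hδpos : 0 < δ := by positivity
  obtain ⟨U, hUZ, hUo, hU⟩ : ∃ U, Z j ⊆ U ∧ IsOpen U ∧ μ (U \ Z j) ≤ ENNReal.ofReal (δ ^ 2) := by
    obtain ⟨U, h1, h2, -, h4⟩ := (hZm j).exists_isOpen_diff_lt (μ := μ) (measure_ne_top _ _)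
      (ε := ENNReal.ofReal (δ ^ 2)) (by simp; positivity)
    exact ⟨U, h1, h2, h4.le⟩
  obtain ⟨r0, hr0⟩ := eventually_atTop.1 (h1 U hUo c' hcpos.le (hc'2.trans_le (measure_mono hUZ)))
  set Nn : ℕ → ℝ := fun R => ∑ r ∈ Finset.range R, w r with hNn
  have hlow : ∀ R, r0 ≤ R → ENNReal.ofReal (c' * (Nn R - Nn r0)) ≤ ∫⁻ x in U, g R x ∂μ := by
    intro R hR
    have e1 : ∫⁻ x in U, g R x ∂μ = ∑ r ∈ Finset.range R, ∑ p ∈ I r, μ (A r p ∩ U) := by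
      simp only [hg]
      rw [lintegral_finsetSum]
      · refine Finset.sum_congr rfl fun r _ => ?_
        rw [lintegral_finsetSum]
        · refine Finset.sum_congr rfl fun p _ => ?_
          rw [lintegral_indicator_one (hA r p), Measure.restrict_apply (hA r p)]
        · exact fun p _ => measurable_one.indicator (hA r p)
      · exact fun r _ => Finset.measurable_fun_sum _ fun p _ => measurable_one.indicator (hA r p)
    rw [e1]
    have e2 : c' * (Nn R - Nn r0) = ∑ r ∈ Finset.Ico r0 R, c' * w r := by
      rw [← Finset.mul_sum, Finset.sum_Ico_eq_sub _ hR]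
    rw [e2, ENNReal.ofReal_sum_of_nonneg (fun r _ => mul_nonneg hcpos.le (hw r))]
    calc _ ≤ ∑ r ∈ Finset.Ico r0 R, ∑ p ∈ I r, μ (A r p ∩ U) :=
          Finset.sum_le_sum fun r hr => hr0 r (Finset.mem_Ico.1 hr).1
      _ ≤ _ := by
          refine Finset.sum_le_sum_of_subset ?_
          intro r hr
          simp at hr ⊢
          exact hr.2
  have hsq : ∀ R, ∫⁻ x, (g R x) ^ 2 ∂μ = ∑ r ∈ Finset.range R, ∑ p ∈ I r,
      ∑ s ∈ Finset.range R, ∑ q ∈ I s, μ (A r p ∩ A s q) := by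
    intro R
    have : ∀ x, (g R x) ^ 2 = ∑ r ∈ Finset.range R, ∑ p ∈ I r,
      ∑ s ∈ Finset.range R, ∑ q ∈ I s, (A r p ∩ A s q).indicator 1 x := by
      intro x
      simp only [hg]
      rw [sq, Finset.sum_mul]
      refine Finset.sum_congr rfl fun r _ => ?_
      rw [Finset.sum_mul]
      refine Finset.sum_congr rfl fun p _ => ?_
      rw [Finset.mul_sum]
      refine Finset.sum_congr rfl fun s _ => ?_
      rw [Finset.mul_sum]
      refine Finset.sum_congr rfl fun q _ => ?_
      rw [Set.inter_indicator_one]; rfl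
    simp only [this]
    have hm : ∀ r p s q, Measurable ((A r p ∩ A s q).indicator (1 : E → ℝ≥0∞)) :=
      fun r p s q => measurable_one.indicator ((hA r p).inter (hA s q))
    have hm1 : ∀ r p s, Measurable (fun x => ∑ q ∈ I s, (A r p ∩ A s q).indicator (1 : E → ℝ≥0∞) x) :=
      fun r p s => Finset.measurable_fun_sum _ fun q _ => hm r p s q
    have hm2 : ∀ r p, Measurable (fun x => ∑ s ∈ Finset.range R, ∑ q ∈ I s, (A r p ∩ A s q).indicator (1 : E → ℝ≥0∞) x) :=
      fun r p => Finset.measurable_fun_sum _ fun q _ => hm1 r p q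
    have hm3 : ∀ r, Measurable (fun x => ∑ p ∈ I r, ∑ s ∈ Finset.range R, ∑ q ∈ I s, (A r p ∩ A s q).indicator (1 : E → ℝ≥0∞) x) :=
      fun r => Finset.measurable_fun_sum _ fun q _ => hm2 r q
    rw [lintegral_finsetSum _ fun r _ => hm3 r]
    refine Finset.sum_congr rfl fun r _ => ?_
    rw [lintegral_finsetSum _ fun p _ => hm2 r p]
    refine Finset.sum_congr rfl fun p _ => ?_
    rw [lintegral_finsetSum _ fun s _ => hm1 r p s]
    refine Finset.sum_congr rfl fun s _ => ?_
    rw [lintegral_finsetSum _ fun q _ => hm r p s q]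
    refine Finset.sum_congr rfl fun q _ => ?_
    rw [lintegral_indicator_one ((hA r p).inter (hA s q))]
  set m0 : ℝ := (μ Set.univ).toReal with hm0
  have hup : ∀ᶠ R in atTop, ∫⁻ x in U, g R x ∂μ ≤
      ENNReal.ofReal (j * m0 + δ * (C + 1) * Nn R) := by
    filter_upwards [h2, hdiv.eventually_ge_atTop 1] with R h2R hN
    have hN0 : 0 < Nn R := by linarith [show 1 ≤ Nn R from hN]
    have split : ∫⁻ x in U, g R x ∂μ = ∫⁻ x in Z j, g R x ∂μ + ∫⁻ x in U \ Z j, g R x ∂μ := by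
      rw [← lintegral_inter_add_diff (μ := μ) _ U (hZm j), Set.inter_eq_self_of_subset_right hUZ]
    rw [split]
    have b1 : ∫⁻ x in Z j, g R x ∂μ ≤ ENNReal.ofReal (j * m0) := by
      calc _ ≤ ∫⁻ x in Z j, (j : ℝ≥0∞) ∂μ := setLIntegral_mono measurable_const (fun x hx => hx R)
        _ = j * μ (Z j) := by simp
        _ ≤ j * μ Set.univ := by gcongr; exact Set.subset_univ _
        _ = _ := by
          rw [ENNReal.ofReal_mul (by positivity), hm0, ENNReal.ofReal_toReal (measure_ne_top _ _)]
          simp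
    have key : ∀ x, g R x ≤ ENNReal.ofReal (Nn R / δ) + ENNReal.ofReal (δ / Nn R) * (g R x) ^ 2 := by
      intro x
      rcases le_total (g R x) (ENNReal.ofReal (Nn R / δ)) with h | h
      · exact h.trans le_self_add
      · refine le_trans ?_ le_add_self
        calc g R x = (ENNReal.ofReal (δ / Nn R) * ENNReal.ofReal (Nn R / δ)) * g R x := by
              rw [← ENNReal.ofReal_mul (by positivity)]
              have : δ / Nn R * (Nn R / δ) = 1 := by field_simp
              simp [this]
          _ ≤ (ENNReal.ofReal (δ / Nn R) * g R x) * g R x := by gcongr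
          _ = _ := by ring
    have b2 : ∫⁻ x in U \ Z j, g R x ∂μ ≤ ENNReal.ofReal (δ * (C + 1) * Nn R) := by
      calc _ ≤ ∫⁻ x in U \ Z j, (ENNReal.ofReal (Nn R / δ) + ENNReal.ofReal (δ / Nn R) * (g R x) ^ 2) ∂μ :=
            lintegral_mono key
        _ = ENNReal.ofReal (Nn R / δ) * μ (U \ Z j) + ENNReal.ofReal (δ / Nn R) * ∫⁻ x in U \ Z j, (g R x) ^ 2 ∂μ := by
            rw [lintegral_add_left measurable_const, lintegral_const_mul _ ((hgm R).pow_const 2)]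
            simp
        _ ≤ ENNReal.ofReal (Nn R / δ) * ENNReal.ofReal (δ ^ 2) + ENNReal.ofReal (δ / Nn R) * ENNReal.ofReal (C * (Nn R) ^ 2) := by
            gcongr
            exact (setLIntegral_le_lintegral _ _).trans ((hsq R).le.trans h2R)
        _ = _ := by
            rw [← ENNReal.ofReal_mul (by positivity), ← ENNReal.ofReal_mul (by positivity),
              ← ENNReal.ofReal_add (by positivity) (by positivity)]
            congr 1
            field_simp
            ring
    rw [ENNReal.ofReal_add (by positivity) (by positivity)]
    exact add_le_add b1 b2
  have hfin : ∀ᶠ R in atTop, c' * (Nn R - Nn r0) ≤ j * m0 + c' / 4 * Nn R := by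
    filter_upwards [hup, eventually_ge_atTop r0, hdiv.eventually_ge_atTop 1] with R h3 h4 hN
    have hN0 : 0 < Nn R := by linarith [show 1 ≤ Nn R from hN]
    have := (hlow R h4).trans h3
    rw [ENNReal.ofReal_le_ofReal_iff (by positivity)] at this
    have e : δ * (C + 1) = c' / 4 := by rw [hδ]; field_simp
    rwa [e] at this
  obtain ⟨R, hR1, hR2⟩ := (hfin.and (hdiv.eventually_gt_atTop (2 * (j * m0 + c' * Nn r0) / c'))).exists
  have hR2' : 2 * (j * m0 + c' * Nn r0) / c' < Nn R := hR2
  rw [div_lt_iff₀ hcpos] at hR2'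
  have : 0 ≤ Nn R := Finset.sum_nonneg fun r _ => hw r
  nlinarith [mul_nonneg hcpos.le this]

/-- integer box -/
noncomputable def ibox (N : ℕ) (T : ℕ) : Finset (Fin N → ℤ) := Fintype.piFinset fun _ => Finset.Icc (-(T:ℤ)) T

lemma mem_ibox {N T : ℕ} {u : Fin N → ℤ} : u ∈ ibox N T ↔ ∀ j, |u j| ≤ T := by
  simp [ibox, Fintype.mem_piFinset, abs_le]

lemma card_ibox (N T : ℕ) : (ibox N T).card = (2 * T + 1) ^ N := by
  simp [ibox, Fintype.card_piFinset]
  congr 1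
  omega

lemma mem_ibox_norm {N T : ℕ} {u : Fin N → ℤ} : u ∈ ibox N T ↔ ‖u‖ ≤ T := by
  rw [mem_ibox, pi_norm_le_iff_of_nonneg (by positivity)]
  refine forall_congr' fun j => ?_
  rw [Int.norm_eq_abs]
  exact_mod_cast Iff.rfl

lemma shell_sum (N p : ℕ) (hp : p < N) : ∃ C : ℝ, 0 < C ∧ ∀ T : ℕ,
    ∑ u ∈ (ibox N T).filter (fun u => u ≠ 0), (‖u‖ ^ p)⁻¹ ≤ C * (T:ℝ) ^ (N - p) := by
  classical
  obtain ⟨e, rfl⟩ : ∃ e, N = p + e + 1 := ⟨N - p - 1, by omega⟩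
  set N := p + e + 1 with hN
  refine ⟨2 * N * 3 ^ (N - 1), by positivity, fun T => ?_⟩
  set C : ℝ := 2 * N * 3 ^ (N - 1) with hC
  have he : N - p = e + 1 := by omega
  rw [he]
  induction T with
  | zero =>
    have : (ibox N 0).filter (fun u => u ≠ 0) = ∅ := by
      ext u
      simp only [Finset.mem_filter, mem_ibox]
      simp
      intro h
      ext j
      exact h j
    rw [this]; simp
  | succ T ih =>
    have hsub : ibox N T ⊆ ibox N (T+1) := by
      intro u; rw [mem_ibox, mem_ibox]; intro h j; exact (h j).trans (by push_cast; linarith)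
    have hsplit : (ibox N (T+1)).filter (fun u => u ≠ 0) ⊆
        (ibox N T).filter (fun u => u ≠ 0) ∪ (ibox N (T+1) \ ibox N T) := by
      intro u
      simp only [Finset.mem_filter, Finset.mem_union, Finset.mem_sdiff]
      tauto
    have h1 : ∑ u ∈ (ibox N (T+1) \ ibox N T), (‖u‖ ^ p)⁻¹ ≤ C * ((T:ℝ)+1) ^ e := by
      have hb : ∀ u ∈ (ibox N (T+1) \ ibox N T), (‖u‖ ^ p)⁻¹ ≤ (((T:ℝ)+1) ^ p)⁻¹ := by
        intro u hu
        have : (T:ℝ) + 1 ≤ ‖u‖ := by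
          rw [Finset.mem_sdiff, mem_ibox (T := T)] at hu
          have := hu.2
          push Not at this
          obtain ⟨j, hj⟩ := this
          have h3 := norm_le_pi_norm u j
          rw [Int.norm_eq_abs] at h3
          have : (T:ℤ) + 1 ≤ |u j| := hj
          have : (T:ℝ) + 1 ≤ |(u j : ℝ)| := by exact_mod_cast this
          linarith
        gcongr
      have hc : ((ibox N (T+1) \ ibox N T).card : ℝ) ≤ C * ((T:ℝ)+1) ^ (N-1) := by
        rw [Finset.cast_card_sdiff hsub, card_ibox, card_ibox]
        push_cast
        have h0 : (0:ℝ) ≤ T := by positivity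
        have := abs_pow_sub_pow_le (2 * ((T:ℝ)+1)+1) (2*(T:ℝ)+1) N
        have e2 : 2 * ((T:ℝ)+1)+1 - (2*(T:ℝ)+1) = 2 := by ring
        rw [e2, abs_of_nonneg (by norm_num : (0:ℝ) ≤ 2), abs_of_nonneg (by positivity : 0 ≤ 2 * ((T:ℝ)+1)+1),
          abs_of_nonneg (by positivity : 0 ≤ 2*(T:ℝ)+1), max_eq_left (by linarith)] at this
        calc _ ≤ _ := (le_abs_self _).trans this
          _ ≤ 2 * N * (3 * ((T:ℝ)+1)) ^ (N-1) := by
            gcongr; linarith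
          _ = _ := by rw [mul_pow, hC]; ring
      calc _ ≤ ∑ u ∈ (ibox N (T+1) \ ibox N T), (((T:ℝ)+1) ^ p)⁻¹ := Finset.sum_le_sum hb
        _ = ((ibox N (T+1) \ ibox N T).card : ℝ) * (((T:ℝ)+1) ^ p)⁻¹ := by simp
        _ ≤ C * ((T:ℝ)+1) ^ (N-1) * (((T:ℝ)+1) ^ p)⁻¹ := by gcongr
        _ = _ := by
          have : N - 1 = e + p := by omega
          rw [this, pow_add]
          field_simp
    calc _ ≤ ∑ u ∈ (ibox N T).filter (fun u => u ≠ 0) ∪ (ibox N (T+1) \ ibox N T), (‖u‖ ^ p)⁻¹ :=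
          Finset.sum_le_sum_of_subset_of_nonneg hsplit fun _ _ _ => by positivity
      _ ≤ ∑ u ∈ (ibox N T).filter (fun u => u ≠ 0), (‖u‖ ^ p)⁻¹ + ∑ u ∈ (ibox N (T+1) \ ibox N T), (‖u‖ ^ p)⁻¹ := by
          rw [← Finset.sum_union_inter]
          exact le_add_of_nonneg_right (Finset.sum_nonneg fun _ _ => by positivity)
      _ ≤ C * (T:ℝ) ^ (e+1) + C * ((T:ℝ)+1) ^ e := add_le_add ih h1
      _ ≤ C * (((T + 1 : ℕ)):ℝ) ^ (e+1) := by
        push_cast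
        rw [← mul_add]
        have : (T:ℝ)^(e+1) ≤ T * ((T:ℝ)+1)^e := by
          rw [pow_succ, mul_comm]; gcongr; linarith
        gcongr
        rw [pow_succ ((T:ℝ)+1)]
        linarith

lemma pair_sum (N p : ℕ) (hp : p < N) : ∃ C : ℝ, 0 < C ∧ ∀ r s : ℕ, 0 < r → 0 < s → ∀ T : ℝ, 0 ≤ T →
    ∑ z ∈ (ibox N r ×ˢ ibox N s).filter
      (fun z => (s:ℤ) • z.1 - (r:ℤ) • z.2 ≠ 0 ∧ ‖(s:ℤ) • z.1 - (r:ℤ) • z.2‖ ≤ T),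
      (‖(s:ℤ) • z.1 - (r:ℤ) • z.2‖ ^ p)⁻¹ ≤ C * T ^ (N - p) := by
  classical
  obtain ⟨C, hC, hS⟩ := shell_sum N p hp
  refine ⟨3 ^ N * C, by positivity, fun r s hr hs T hT => ?_⟩
  obtain ⟨d, r', s', hd, hco, rfl, rfl⟩ := Nat.exists_coprime' (Nat.gcd_pos_of_pos_left s hr)
  have hr' : 0 < r' := Nat.pos_of_mul_pos_right hr
  have hs' : 0 < s' := Nat.pos_of_mul_pos_right hs
  have hdR : (0:ℝ) < d := by exact_mod_cast hd
  set φ : (Fin N → ℤ) × (Fin N → ℤ) → (Fin N → ℤ) := fun z => (s':ℤ) • z.1 - (r':ℤ) • z.2 with hφ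
  have hv : ∀ z : (Fin N → ℤ) × (Fin N → ℤ),
      (((s' * d : ℕ)):ℤ) • z.1 - (((r' * d : ℕ)):ℤ) • z.2 = (d:ℤ) • φ z := by
    intro z; ext j; simp [hφ]; ring
  have hnorm : ∀ u : Fin N → ℤ, ‖(d:ℤ) • u‖ = d * ‖u‖ := by
    intro u
    have : (fun j => ((((d:ℤ) • u) j : ℤ) : ℝ)) = (d:ℝ) • (fun j => ((u j : ℤ):ℝ)) := by
      ext j; simp
    have h1 : ∀ u : Fin N → ℤ, ‖u‖ = ‖(fun j => ((u j : ℤ):ℝ))‖ := by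
      intro u
      simp [Pi.norm_def]
      rfl
    rw [h1, this, norm_smul, h1 u]
    simp
  simp only [hv, hnorm]
  set F := (ibox N (r'*d) ×ˢ ibox N (s'*d)).filter (fun z => (d:ℤ) • φ z ≠ 0 ∧ d * ‖φ z‖ ≤ T) with hF
  set G := (ibox N ⌊T/d⌋₊).filter (fun u => u ≠ 0) with hG
  have hmaps : ∀ z ∈ F, φ z ∈ G := by
    intro z hz
    simp only [hF, Finset.mem_filter] at hz
    simp only [hG, Finset.mem_filter, mem_ibox]
    refine ⟨fun j => ?_, fun h => hz.2.1 (by rw [h]; simp)⟩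
    have h1 : ‖φ z‖ ≤ T / d := by rw [le_div_iff₀ hdR]; linarith [hz.2.2]
    have h2 := (norm_le_pi_norm (φ z) j).trans h1
    rw [Int.norm_eq_abs] at h2
    have : ((φ z j).natAbs : ℝ) ≤ T / d := by
      rw [Nat.cast_natAbs]; push_cast; exact h2
    have := Nat.le_floor this
    rw [Int.abs_eq_natAbs]
    exact_mod_cast this
  have hfib : ∀ u ∈ G, ((F.filter (fun z => φ z = u)).card : ℝ) ≤ (3 * d) ^ N := by
    intro u _
    have : (F.filter (fun z => φ z = u)).card ≤ (ibox N d).card := by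
      refine Finset.card_le_card_of_injOn (fun z j => z.1 j / (r':ℤ)) ?_ ?_
      · intro z hz
        simp only [hF, Finset.coe_filter, Finset.mem_filter, Finset.mem_product, Set.mem_ofPred_eq] at hz
        have h1 := mem_ibox.1 hz.1.1.1
        refine Finset.mem_coe.2 (mem_ibox.2 fun j => ?_)
        have h2 := abs_le.1 (h1 j)
        push_cast at h2
        rw [abs_le]
        constructor
        · rw [Int.le_ediv_iff_mul_le (by exact_mod_cast hr')]; linarith
        · exact Int.ediv_le_of_le_mul (by exact_mod_cast hr') (by linarith)
      · intro z hz z' hz' h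
        simp only [Finset.coe_filter, Set.mem_ofPred_eq] at hz hz'
        have e : φ z = φ z' := hz.2.trans hz'.2.symm
        have e1 : ∀ j, z.1 j = z'.1 j := by
          intro j
          have ej := congrFun e j
          simp only [hφ, Pi.sub_apply, Pi.smul_apply, smul_eq_mul] at ej
          have hdvd : (r':ℤ) ∣ (s':ℤ) * (z.1 j - z'.1 j) := ⟨z.2 j - z'.2 j, by linarith⟩
          have hdvd2 : (r':ℤ) ∣ (z.1 j - z'.1 j) :=
            IsCoprime.dvd_of_dvd_mul_left (Nat.isCoprime_iff_coprime.2 hco) hdvd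
          have hf := congrFun h j
          simp only at hf
          have hm : z.1 j % (r':ℤ) = z'.1 j % (r':ℤ) := Int.emod_eq_emod_iff_emod_sub_eq_zero.2 (Int.emod_eq_zero_of_dvd hdvd2)
          rw [← Int.mul_ediv_add_emod (z.1 j) r', ← Int.mul_ediv_add_emod (z'.1 j) r', hf, hm]
        have e2 : ∀ j, z.2 j = z'.2 j := by
          intro j
          have ej := congrFun e j
          simp only [hφ, Pi.sub_apply, Pi.smul_apply, smul_eq_mul, e1 j] at ej
          have : (r':ℤ) ≠ 0 := by positivity
          have : (r':ℤ) * z.2 j = r' * z'.2 j := by linarith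
          exact mul_left_cancel₀ ‹(r':ℤ) ≠ 0› this
        exact Prod.ext (funext e1) (funext e2)
    rw [card_ibox] at this
    calc _ ≤ (((2 * d + 1) ^ N : ℕ) : ℝ) := by exact_mod_cast this
      _ ≤ _ := by
        push_cast
        gcongr
        have : (1:ℝ) ≤ d := by exact_mod_cast hd
        linarith
  rw [← Finset.sum_fiberwise_of_maps_to hmaps]
  calc ∑ u ∈ G, ∑ z ∈ F with φ z = u, ((d * ‖φ z‖) ^ p)⁻¹
      = ∑ u ∈ G, ((F.filter (fun z => φ z = u)).card : ℝ) * ((d:ℝ)^p)⁻¹ * (‖u‖ ^ p)⁻¹ := by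
        refine Finset.sum_congr rfl fun u _ => ?_
        rw [Finset.sum_congr rfl (g := fun _ => ((d:ℝ)^p)⁻¹ * (‖u‖ ^ p)⁻¹)]
        · simp; ring
        · intro z hz
          rw [(Finset.mem_filter.1 hz).2, mul_pow, mul_inv]
    _ ≤ ∑ u ∈ G, (3 * (d:ℝ)) ^ N * ((d:ℝ)^p)⁻¹ * (‖u‖ ^ p)⁻¹ := by
        refine Finset.sum_le_sum fun u hu => ?_
        gcongr
        exact hfib u hu
    _ = (3 * (d:ℝ)) ^ N * ((d:ℝ)^p)⁻¹ * ∑ u ∈ G, (‖u‖ ^ p)⁻¹ := by rw [Finset.mul_sum]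
    _ ≤ (3 * (d:ℝ)) ^ N * ((d:ℝ)^p)⁻¹ * (C * (⌊T/d⌋₊:ℝ) ^ (N-p)) := by
        gcongr; exact hS _
    _ ≤ (3 * (d:ℝ)) ^ N * ((d:ℝ)^p)⁻¹ * (C * (T/d) ^ (N-p)) := by
        gcongr; exact Nat.floor_le (by positivity)
    _ = _ := by
        obtain ⟨e, rfl⟩ : ∃ e, N = e + p := ⟨N - p, by omega⟩
        have : e + p - p = e := by omega
        rw [this, mul_pow, div_pow, pow_add (d:ℝ)]
        field_simp

/-- no prime divides both `r` and all the entries of `p` -/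
def Prim {N : ℕ} (r : ℕ) (p : Fin N → ℤ) : Prop :=
  ∀ l : ℕ, l.Prime → l ∣ r → ¬ ∀ j, (l:ℤ) ∣ p j

lemma prim_aux {N : ℕ} {r s : ℕ} (hr : 0 < r) (hs : 0 < s) {p q : Fin N → ℤ}
    (hp : Prim r p) (h : (s:ℤ) • p - (r:ℤ) • q = 0) : r ∣ s := by
  obtain ⟨d, r', s', hd, hco, rfl, rfl⟩ := Nat.exists_coprime' (Nat.gcd_pos_of_pos_left s hr)
  have hr1 : r' = 1 := by
    by_contra hne
    obtain ⟨l, hl, hlr⟩ := Nat.exists_prime_and_dvd hne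
    refine hp l hl (hlr.mul_right d) fun j => ?_
    have hj := congrFun h j
    simp only [Pi.sub_apply, Pi.smul_apply, smul_eq_mul, Pi.zero_apply] at hj
    push_cast at hj
    have hd0 : (d:ℤ) ≠ 0 := by positivity
    have hj' : (s':ℤ) * p j = r' * q j := by
      apply mul_left_cancel₀ hd0; linarith
    have hdvd : (r':ℤ) ∣ p j :=
      IsCoprime.dvd_of_dvd_mul_left (Nat.isCoprime_iff_coprime.2 hco) ⟨q j, hj'⟩
    exact (Int.natCast_dvd_natCast.2 hlr).trans hdvd
  subst hr1
  simp

lemma prim_eq {N : ℕ} {r s : ℕ} (hr : 0 < r) (hs : 0 < s) {p q : Fin N → ℤ}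
    (hp : Prim r p) (hq : Prim s q) (h : (s:ℤ) • p - (r:ℤ) • q = 0) : r = s ∧ p = q := by
  have h1 := prim_aux hr hs hp h
  have h2 := prim_aux hs hr hq (by rw [← neg_eq_zero, neg_sub]; exact h)
  have e := Nat.dvd_antisymm h1 h2
  refine ⟨e, ?_⟩
  subst e
  rw [← smul_sub, smul_eq_zero] at h
  rcases h with h | h
  · simp at h; omega
  · exact sub_eq_zero.1 h

lemma sum_inv_sq (r : ℕ) (hr : 2 ≤ r) :
    ∑ l ∈ Finset.Icc 2 r, ((l:ℝ)^2)⁻¹ ≤ 3/4 - 1/(r:ℝ) := by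
  induction r, hr using Nat.le_induction with
  | base => norm_num
  | succ r hr ih =>
    rw [Finset.sum_Icc_succ_top (by omega)]
    have h0 : (0:ℝ) < r := by positivity
    have : (((r+1:ℕ):ℝ)^2)⁻¹ ≤ 1/(r:ℝ) - 1/((r+1:ℕ):ℝ) := by
      push_cast
      rw [div_sub_div _ _ (by positivity) (by positivity), inv_eq_one_div, div_le_div_iff₀ (by positivity) (by positivity)]
      nlinarith
    linarith

lemma sum_inv_sq_primes (r : ℕ) : ∑ l ∈ r.primeFactors, ((l:ℝ)^2)⁻¹ ≤ 3/4 := by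
  rcases Nat.lt_or_ge r 2 with h | h
  · interval_cases r <;> simp <;> norm_num
  · refine le_trans (Finset.sum_le_sum_of_subset_of_nonneg (t := Finset.Icc 2 r) ?_ fun _ _ _ => by positivity) ((sum_inv_sq r h).trans (by simp))
    intro l hl
    have := Nat.mem_primeFactors.1 hl
    exact Finset.mem_Icc.2 ⟨this.1.two_le, Nat.le_of_dvd (by omega) this.2.1⟩

lemma card_primeFactors_le (r : ℕ) (hr : 0 < r) : (r.primeFactors.card : ℝ) ≤ Real.log r / Real.log 2 := by
  have h : 2 ^ r.primeFactors.card ≤ r := by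
    calc 2 ^ r.primeFactors.card ≤ ∏ l ∈ r.primeFactors, l :=
          Finset.pow_card_le_prod _ _ _ fun l hl => (Nat.prime_of_mem_primeFactors hl).two_le
      _ ≤ r := Nat.le_of_dvd hr (Nat.prod_primeFactors_dvd r)
  rw [le_div_iff₀ (Real.log_pos (by norm_num)), ← Real.log_pow]
  apply Real.log_le_log (by positivity)
  exact_mod_cast h

noncomputable def bbox {N : ℕ} (x : Fin N → ℝ) (ρ : ℝ) (r : ℕ) : Finset (Fin N → ℤ) :=
  Fintype.piFinset fun j => Finset.Icc ⌈r * (x j - ρ)⌉ ⌊r * (x j + ρ)⌋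

lemma card_mult (a b : ℝ) (hab : a ≤ b) (l : ℕ) (hl : 0 < l) :
    (((Finset.Icc ⌈a⌉ ⌊b⌋).filter (fun t => (l:ℤ) ∣ t)).card : ℝ) ≤ (b - a) / l + 1 := by
  have hlR : (0:ℝ) < l := by exact_mod_cast hl
  have h1 : ((Finset.Icc ⌈a⌉ ⌊b⌋).filter (fun t => (l:ℤ) ∣ t)).card ≤ (Finset.Icc ⌈a / l⌉ ⌊b / l⌋).card := by
    refine Finset.card_le_card_of_injOn (fun t => t / (l:ℤ)) ?_ ?_
    · intro t ht
      rw [Finset.mem_coe, Finset.mem_filter, Finset.mem_Icc, Int.ceil_le, Int.le_floor] at ht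
      obtain ⟨⟨h1, h2⟩, u, rfl⟩ := ht
      have : (l:ℤ) * u / l = u := Int.mul_ediv_cancel_left _ (by positivity)
      simp only [this, Finset.mem_coe, Finset.mem_Icc, Int.ceil_le, Int.le_floor]
      push_cast at h1 h2
      rw [div_le_iff₀ hlR, le_div_iff₀ hlR]
      constructor <;> linarith
    · intro t ht t' ht' h
      rw [Finset.mem_coe, Finset.mem_filter] at ht ht'
      exact (Int.ediv_left_inj ht.2 ht'.2).1 h
  have h2 : (((Finset.Icc ⌈a⌉ ⌊b⌋).filter (fun t => (l:ℤ) ∣ t)).card : ℝ) ≤ ((Finset.Icc ⌈a / l⌉ ⌊b / l⌋).card : ℝ) := by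
    exact_mod_cast h1
  refine h2.trans ?_
  rw [Int.card_Icc]
  have h3 : (((⌊b / l⌋ + 1 - ⌈a / l⌉).toNat : ℤ) : ℝ) = ((max (⌊b / l⌋ + 1 - ⌈a / l⌉) 0 : ℤ) : ℝ) := by
    rw [Int.ofNat_toNat]
  rw [Int.cast_natCast] at h3
  rw [h3]
  push_cast
  rw [sub_div]
  have : a / l ≤ b / l := by gcongr
  apply max_le
  · linarith [Int.floor_le (b / l), Int.le_ceil (a / l)]
  · linarith

lemma card_int (a b : ℝ) : b - a - 1 ≤ ((Finset.Icc ⌈a⌉ ⌊b⌋).card : ℝ) := by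
  rw [Int.card_Icc]
  have h1 : (⌊b⌋ + 1 - ⌈a⌉ : ℤ) ≤ ((⌊b⌋ + 1 - ⌈a⌉).toNat : ℤ) := Int.self_le_toNat _
  have h2 : ((⌊b⌋ + 1 - ⌈a⌉ : ℤ):ℝ) ≤ ((⌊b⌋ + 1 - ⌈a⌉).toNat : ℝ) := by exact_mod_cast h1
  push_cast at h2
  linarith [Int.lt_floor_add_one b, Int.ceil_lt_add_one a]

lemma prim_count_ball (N : ℕ) (hN : 2 ≤ N) (x : Fin N → ℝ) (ρ : ℝ) (hρ : 0 < ρ) :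
    open Classical in
    ∀ᶠ r : ℕ in atTop, 1/8 * (2 * ρ * r) ^ N ≤ (((bbox x ρ r).filter (Prim r)).card : ℝ) := by
  classical
  obtain ⟨M, rfl⟩ : ∃ M, N = M + 2 := ⟨N - 2, by omega⟩
  have hmain : ∀ r : ℕ, 0 < r → 1 ≤ 2 * ρ * r → (2*ρ*r - 1) ^ (M+2) -
      (2*ρ*r+1)^M * (3/4 * (2*ρ*r)^2 + (2 * (2*ρ*r) + 1) * (Real.log r / Real.log 2)) ≤
      (((bbox x ρ r).filter (Prim r)).card : ℝ) := by
    intro r hr hL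
    set L : ℝ := 2 * ρ * r with hLdef
    have hlen : ∀ j, (r * (x j + ρ) - r * (x j - ρ)) = L := fun j => by rw [hLdef]; ring
    have hle : ∀ j, r * (x j - ρ) ≤ r * (x j + ρ) := fun j => by linarith [hlen j]
    have hall : (L - 1) ^ (M+2) ≤ ((bbox x ρ r).card : ℝ) := by
      rw [bbox, Fintype.card_piFinset]
      push_cast
      calc (L-1)^(M+2) = ∏ j : Fin (M+2), (L - 1) := by simp
        _ ≤ _ := by
          refine Finset.prod_le_prod (fun _ _ => by linarith) fun j _ => ?_
          have := card_int (r * (x j - ρ)) (r * (x j + ρ))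
          rwa [hlen j] at this
    have hbad : (((bbox x ρ r).filter (fun p => ¬ Prim r p)).card : ℝ) ≤
        ∑ l ∈ r.primeFactors, (L / l + 1) ^ (M+2) := by
      have hs : (bbox x ρ r).filter (fun p => ¬ Prim r p) ⊆ r.primeFactors.biUnion
          (fun l => Fintype.piFinset fun j => (Finset.Icc ⌈r * (x j - ρ)⌉ ⌊r * (x j + ρ)⌋).filter (fun t => (l:ℤ) ∣ t)) := by
        intro p hp
        rw [Finset.mem_filter] at hp
        obtain ⟨hp1, hp2⟩ := hp
        rw [Prim] at hp2
        push Not at hp2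
        obtain ⟨l, hl, hlr, h⟩ := hp2
        rw [Finset.mem_biUnion]
        refine ⟨l, Nat.mem_primeFactors.2 ⟨hl, hlr, hr.ne'⟩, ?_⟩
        rw [Fintype.mem_piFinset]
        rw [bbox, Fintype.mem_piFinset] at hp1
        exact fun j => Finset.mem_filter.2 ⟨hp1 j, h j⟩
      have := (Finset.card_le_card hs).trans Finset.card_biUnion_le
      calc _ ≤ ((∑ l ∈ r.primeFactors, (Fintype.piFinset fun j => (Finset.Icc ⌈r * (x j - ρ)⌉ ⌊r * (x j + ρ)⌋).filter (fun t => (l:ℤ) ∣ t)).card : ℕ) : ℝ) := by exact_mod_cast this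
        _ ≤ _ := by
          push_cast
          refine Finset.sum_le_sum fun l hl => ?_
          rw [Fintype.card_piFinset]
          push_cast
          calc _ ≤ ∏ j : Fin (M+2), (L / l + 1) := by
                refine Finset.prod_le_prod (fun _ _ => by positivity) fun j _ => ?_
                have := card_mult _ _ (hle j) l (Nat.prime_of_mem_primeFactors hl).pos
                rwa [hlen j] at this
            _ = _ := by simp
    have hbad2 : ∑ l ∈ r.primeFactors, (L / l + 1) ^ (M+2) ≤
        (L+1)^M * (3/4 * L^2 + (2 * L + 1) * (Real.log r / Real.log 2)) := by
      have hL0 : 0 ≤ L := by linarith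
      calc _ ≤ ∑ l ∈ r.primeFactors, (L+1)^M * (L^2 * ((l:ℝ)^2)⁻¹ + (2 * L + 1)) := by
            refine Finset.sum_le_sum fun l hl => ?_
            have hl1 : (1:ℝ) ≤ l := by exact_mod_cast (Nat.prime_of_mem_primeFactors hl).one_le
            have h1 : L / l ≤ L := div_le_self hL0 hl1
            have h0 : 0 ≤ L / l := by positivity
            rw [pow_add]
            have : (L/l+1)^2 ≤ L^2 * ((l:ℝ)^2)⁻¹ + (2 * L + 1) := by
              have : (L/l+1)^2 = L^2 * ((l:ℝ)^2)⁻¹ + 2 * (L/l) + 1 := by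
                field_simp
                ring
              rw [this]; linarith
            gcongr
        _ = (L+1)^M * (L^2 * ∑ l ∈ r.primeFactors, ((l:ℝ)^2)⁻¹ + (2 * L + 1) * r.primeFactors.card) := by
            rw [← Finset.mul_sum, Finset.sum_add_distrib, ← Finset.mul_sum]
            simp; left; ring
        _ ≤ (L+1)^M * (L^2 * (3/4) + (2 * L + 1) * (Real.log r / Real.log 2)) := by
            gcongr
            · exact sum_inv_sq_primes r
            · exact card_primeFactors_le r hr
        _ = _ := by ring
    have hsplit := Finset.card_filter_add_card_filter_not (s := bbox x ρ r) (Prim r)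
    have hsplit' : (((bbox x ρ r).filter (Prim r)).card : ℝ) + (((bbox x ρ r).filter (fun p => ¬ Prim r p)).card : ℝ) = ((bbox x ρ r).card : ℝ) := by
      exact_mod_cast hsplit
    linarith
  have ht : Tendsto (fun r : ℕ => (2 * ρ * (r:ℝ))⁻¹) atTop (nhds 0) :=
    tendsto_inv_atTop_zero.comp ((tendsto_natCast_atTop_atTop).const_mul_atTop (by positivity))
  have htl : Tendsto (fun r : ℕ => (2 * ρ * (r:ℝ))⁻¹ * (Real.log r / Real.log 2)) atTop (nhds 0) := by
    have h1 : Tendsto (fun r : ℕ => Real.log r / (r:ℝ)) atTop (nhds 0) :=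
      (Real.isLittleO_log_id_atTop.tendsto_div_nhds_zero).comp tendsto_natCast_atTop_atTop
    have h2 := h1.const_mul ((2*ρ)⁻¹ * (Real.log 2)⁻¹)
    rw [mul_zero] at h2
    refine h2.congr fun r => ?_
    rw [mul_inv (2*ρ)]
    ring
  have hlim : Tendsto (fun r : ℕ => (1 - (2 * ρ * (r:ℝ))⁻¹)^(M+2) - (1 + (2 * ρ * (r:ℝ))⁻¹)^M *
      (3/4 + (2 + (2 * ρ * (r:ℝ))⁻¹) * ((2 * ρ * (r:ℝ))⁻¹ * (Real.log r / Real.log 2)))) atTop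
      (nhds ((1 - 0)^(M+2) - (1+0)^M * (3/4 + (2 + 0) * 0))) :=
    ((ht.const_sub 1).pow _).sub (((ht.const_add 1).pow _).mul (((ht.const_add 2).mul htl).const_add _))
  have hlim' : (1/8:ℝ) < ((1 - 0)^(M+2) - (1+0)^M * (3/4 + (2 + 0) * 0)) := by norm_num
  have hL1 : ∀ᶠ r : ℕ in atTop, 1 ≤ 2 * ρ * (r:ℝ) :=
    ((tendsto_natCast_atTop_atTop).const_mul_atTop (by positivity : 0 < 2 * ρ)).eventually_ge_atTop 1
  filter_upwards [hlim.eventually (lt_mem_nhds hlim'), hL1, eventually_gt_atTop 0] with r h1 h2 h3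
  refine le_trans ?_ (hmain r h3 h2)
  set L : ℝ := 2 * ρ * r with hLdef
  have hL0 : 0 < L := by linarith
  have := mul_le_mul_of_nonneg_right h1.le (by positivity : 0 ≤ L^(M+2))
  refine this.trans (le_of_eq ?_)
  have e1 : (1 - L⁻¹)^(M+2) * L^(M+2) = (L-1)^(M+2) := by rw [← mul_pow]; congr 1; field_simp
  have e2 : (1 + L⁻¹)^M * L^M = (L+1)^M := by rw [← mul_pow]; congr 1; field_simp
  rw [sub_mul, e1, ← e2, pow_add L M 2]
  field_simp

lemma mem_bbox {N : ℕ} {x : Fin N → ℝ} {ρ : ℝ} (hρ : 0 ≤ ρ) {r : ℕ} (hr : 0 < r) {p : Fin N → ℤ} :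
    p ∈ bbox x ρ r ↔ (fun j => (p j : ℝ) / r) ∈ Metric.closedBall x ρ := by
  have hrR : (0:ℝ) < r := by exact_mod_cast hr
  rw [bbox, Fintype.mem_piFinset, mem_closedBall_iff_norm, pi_norm_le_iff_of_nonneg hρ]
  refine forall_congr' fun j => ?_
  rw [Finset.mem_Icc, Int.ceil_le, Int.le_floor, Pi.sub_apply, Real.norm_eq_abs, abs_le]
  have : (p j : ℝ) = r * (p j / r) := by field_simp
  constructor
  · rintro ⟨h1, h2⟩
    rw [this] at h1 h2
    have := le_of_mul_le_mul_left h1 hrR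
    have := le_of_mul_le_mul_left h2 hrR
    constructor <;> linarith
  · rintro ⟨h1, h2⟩
    rw [this]
    constructor <;> apply mul_le_mul_of_nonneg_left _ hrR.le <;> linarith

lemma prim_count_open (N : ℕ) (hN : 2 ≤ N) (G : Set (Fin N → ℝ)) (hG : IsOpen G)
    (hG1 : G ⊆ Metric.ball 0 1) (c : ℝ) (hc : ENNReal.ofReal c < volume G) :
    open Classical in
    ∀ᶠ r : ℕ in atTop, 1/8 * c * (r:ℝ) ^ N ≤
      (((ibox N r).filter (fun p => Prim r p ∧ (fun j => (p j : ℝ) / r) ∈ G)).card : ℝ) := by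
  classical
  obtain ⟨R, hR⟩ : ∃ R : (Fin N → ℝ) → ℝ, ∀ x ∈ G, 0 < R x ∧ Metric.ball x (R x) ⊆ G := by
    have : ∀ x, ∃ ε : ℝ, x ∈ G → 0 < ε ∧ Metric.ball x ε ⊆ G := by
      intro x
      by_cases hx : x ∈ G
      · obtain ⟨ε, h1, h2⟩ := Metric.isOpen_iff.1 hG x hx
        exact ⟨ε, fun _ => ⟨h1, h2⟩⟩
      · exact ⟨0, fun h => absurd h hx⟩
    choose R hR using this
    exact ⟨R, hR⟩
  obtain ⟨t, ρ, htc, htG, htρ, hcov, hdisj⟩ := Besicovitch.exists_disjoint_closedBall_covering_ae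
    (volume : Measure (Fin N → ℝ)) (fun _ => Set.univ) G
    (fun x _ δ hδ => ⟨δ/2, trivial, by constructor <;> linarith⟩) R (fun x hx => (hR x hx).1)
  have hvol : volume G ≤ ∑' x : t, volume (Metric.closedBall (x : Fin N → ℝ) (ρ x)) := by
    have : Countable t := htc
    calc volume G ≤ volume (G \ ⋃ x ∈ t, Metric.closedBall x (ρ x)) + volume (⋃ x ∈ t, Metric.closedBall x (ρ x)) := by
          refine (measure_mono ?_).trans (measure_union_le _ _)
          intro y hy
          by_cases h : y ∈ ⋃ x ∈ t, Metric.closedBall x (ρ x)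
          · exact Or.inr h
          · exact Or.inl ⟨hy, h⟩
      _ = volume (⋃ x ∈ t, Metric.closedBall x (ρ x)) := by rw [hcov, zero_add]
      _ ≤ _ := by
        rw [Set.biUnion_eq_iUnion]
        exact measure_iUnion_le _
  obtain ⟨F, hF⟩ : ∃ F : Finset t, ENNReal.ofReal c < ∑ x ∈ F, volume (Metric.closedBall (x : Fin N → ℝ) (ρ x)) := by
    rw [ENNReal.tsum_eq_iSup_sum] at hvol
    exact lt_iSup_iff.1 (hc.trans_le hvol)
  have hρ0 : ∀ x : t, 0 < ρ x := fun x => (htρ x x.2).2.1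
  have hF' : c ≤ ∑ x ∈ F, (2 * ρ x) ^ N := by
    have : ∀ x : t, volume (Metric.closedBall (x : Fin N → ℝ) (ρ x)) = ENNReal.ofReal ((2 * ρ x) ^ N) := by
      intro x
      rw [Real.volume_pi_closedBall _ (hρ0 x).le]
      simp
    simp only [this] at hF
    rw [← ENNReal.ofReal_sum_of_nonneg (fun x _ => by have := hρ0 x; positivity)] at hF
    exact (ENNReal.lt_ofReal_iff_toReal_lt (by simp)).1 hF |>.le |> fun h => (le_max_left c 0).trans (by simpa [ENNReal.toReal_ofReal'] using h)
  have hev : ∀ᶠ r : ℕ in atTop, ∀ x ∈ F, 1/8 * (2 * ρ x * r) ^ N ≤ (((bbox (x : Fin N → ℝ) (ρ x) r).filter (Prim r)).card : ℝ) :=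
    (Finset.eventually_all F).2 fun x _ => prim_count_ball N hN x (ρ x) (hρ0 x)
  filter_upwards [hev, eventually_gt_atTop 0] with r h1 h2
  have hrR : (0:ℝ) < r := by exact_mod_cast h2
  have hsub : F.biUnion (fun x => (bbox (x : Fin N → ℝ) (ρ x) r).filter (Prim r)) ⊆
      (ibox N r).filter (fun p => Prim r p ∧ (fun j => (p j : ℝ) / r) ∈ G) := by
    intro p hp
    rw [Finset.mem_biUnion] at hp
    obtain ⟨x, hx, hp⟩ := hp
    rw [Finset.mem_filter, mem_bbox (hρ0 x).le h2] at hp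
    have hpG : (fun j => (p j : ℝ) / r) ∈ G :=
      (hR x (htG x.2)).2 (Metric.closedBall_subset_ball (htρ x x.2).2.2 hp.1)
    refine Finset.mem_filter.2 ⟨?_, hp.2, hpG⟩
    rw [mem_ibox]
    intro j
    have h3 := hG1 hpG
    rw [mem_ball_zero_iff] at h3
    have h4 := (norm_le_pi_norm _ j).trans h3.le
    rw [Real.norm_eq_abs, abs_div, abs_of_pos hrR, div_le_one hrR] at h4
    exact_mod_cast h4
  have hcard := Finset.card_le_card hsub
  rw [Finset.card_biUnion] at hcard
  · calc 1/8 * c * (r:ℝ)^N ≤ 1/8 * (∑ x ∈ F, (2 * ρ x) ^ N) * (r:ℝ)^N := by gcongr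
      _ = ∑ x ∈ F, 1/8 * (2 * ρ x * r) ^ N := by
        rw [Finset.mul_sum, Finset.sum_mul]
        refine Finset.sum_congr rfl fun x _ => ?_
        rw [mul_pow _ (r:ℝ)]; ring
      _ ≤ ∑ x ∈ F, (((bbox (x : Fin N → ℝ) (ρ x) r).filter (Prim r)).card : ℝ) := Finset.sum_le_sum h1
      _ ≤ _ := by exact_mod_cast hcard
  · intro x _ y _ hxy
    rw [Function.onFun, Finset.disjoint_left]
    intro p hp hq
    rw [Finset.mem_filter, mem_bbox (hρ0 _).le h2] at hp hq
    have hd : Disjoint (Metric.closedBall (x : Fin N → ℝ) (ρ x)) (Metric.closedBall (y : Fin N → ℝ) (ρ y)) :=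
      hdisj x.2 y.2 (fun h => hxy (Subtype.ext h))
    exact Set.disjoint_left.1 hd hp.1 hq.1

/-- the vector `ξ X` -/
noncomputable def lf {N n : ℕ} (ξ : Fin N → ℝ) (X : Fin N → Fin n → ℝ) : Fin n → ℝ :=
  fun i => ∑ j, ξ j * X j i

noncomputable def zr {N : ℕ} (p : Fin N → ℤ) : Fin N → ℝ := fun j => (p j : ℝ)

/-- approximation sets -/
def AA {N n : ℕ} (a : Fin n → ℝ) (r : ℕ) (p : Fin N → ℤ) :
    Set ((Fin n → ℝ) × (Fin N → Fin n → ℝ)) :=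
  {x | ∀ i, |(r:ℝ) * x.1 i + lf (zr p) x.2 i| < a i}

def Om (N n : ℕ) (κ : ℕ) : Set (Fin N → Fin n → ℝ) :=
  {X | (∀ j i, |X j i| ≤ 1/2) ∧ (N = n → ∀ v : Fin N → ℤ, ‖v‖ ≤ κ * ‖lf (zr v) X‖)}

lemma continuous_lf {N n : ℕ} : Continuous (fun z : (Fin N → ℝ) × (Fin N → Fin n → ℝ) => lf z.1 z.2) := by
  unfold lf
  fun_prop

lemma continuous_lf_right {N n : ℕ} (ξ : Fin N → ℝ) : Continuous (fun X : Fin N → Fin n → ℝ => lf ξ X) := by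
  unfold lf
  fun_prop

lemma isOpen_AA {N n : ℕ} (a : Fin n → ℝ) (r : ℕ) (p : Fin N → ℤ) : IsOpen (AA a r p) := by
  have : AA a r p = ⋂ i, {x : (Fin n → ℝ) × (Fin N → Fin n → ℝ) | |(r:ℝ) * x.1 i + lf (zr p) x.2 i| < a i} := by
    ext; simp [AA]
  rw [this]
  refine isOpen_iInter_of_finite fun i => isOpen_lt ?_ continuous_const
  unfold lf
  fun_prop

lemma isClosed_Om (N n κ : ℕ) : IsClosed (Om N n κ) := by
  have : Om N n κ = (⋂ j, ⋂ i, {X : Fin N → Fin n → ℝ | |X j i| ≤ 1/2}) ∩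
      ⋂ (_ : N = n), ⋂ v : Fin N → ℤ, {X : Fin N → Fin n → ℝ | ‖v‖ ≤ κ * ‖lf (zr v) X‖} := by
    ext; simp [Om]
  rw [this]
  refine IsClosed.inter (isClosed_iInter fun j => isClosed_iInter fun i => isClosed_le (by fun_prop) continuous_const) ?_
  refine isClosed_iInter fun _ => isClosed_iInter fun v => isClosed_le continuous_const ?_
  exact continuous_const.mul (continuous_lf_right _).norm

lemma slab_eq (t y a : ℝ) (ht : t ≠ 0) : {x : ℝ | |t * x + y| < a} = Metric.ball (-y / t) (a / |t|) := by
  ext x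
  have h0 : 0 < |t| := abs_pos.2 ht
  rw [Set.mem_ofPred_eq, Metric.mem_ball, Real.dist_eq, lt_div_iff₀ h0, ← abs_mul]
  have : (x - -y / t) * t = t * x + y := by field_simp; ring
  rw [this]

lemma slab_vol (t y a : ℝ) (ht : t ≠ 0) : volume {x : ℝ | |t * x + y| < a} = ENNReal.ofReal (2 * (a / |t|)) := by
  rw [slab_eq t y a ht, Real.volume_ball]

lemma vol_pred_pi {n : ℕ} (P : Fin n → ℝ → Prop) :
    volume {x : Fin n → ℝ | ∀ i, P i (x i)} = ∏ i, volume {t | P i t} := by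
  have : {x : Fin n → ℝ | ∀ i, P i (x i)} = Set.pi Set.univ (fun i => {t | P i t}) := by
    ext; simp
  rw [this, volume_pi_pi]

lemma pfs_same {M n : ℕ} (j0 : Fin (M+1)) (x : Fin n → ℝ) (Y : Fin M → Fin n → ℝ) :
    (MeasurableEquiv.piFinSuccAbove (fun _ : Fin (M+1) => (Fin n → ℝ)) j0).symm (x, Y) j0 = x :=
  Fin.insertNth_apply_same (α := fun _ => Fin n → ℝ) j0 x Y

lemma pfs_succ {M n : ℕ} (j0 : Fin (M+1)) (x : Fin n → ℝ) (Y : Fin M → Fin n → ℝ) (k : Fin M) :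
    (MeasurableEquiv.piFinSuccAbove (fun _ : Fin (M+1) => (Fin n → ℝ)) j0).symm (x, Y) (j0.succAbove k) = Y k :=
  Fin.insertNth_apply_succAbove (α := fun _ => Fin n → ℝ) j0 x Y k

lemma vol_Om_slab {N n : ℕ} (v : Fin N → ℤ) (hv : v ≠ 0) (L : Fin n → ℝ) (hL : ∀ i, 0 ≤ L i) :
    volume {X : Fin N → Fin n → ℝ | (∀ j i, |X j i| ≤ 1/2) ∧ ∀ i, |lf (zr v) X i| < L i} ≤
      ENNReal.ofReal (∏ i, min 1 (2 * (L i / ‖v‖))) := by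
  obtain ⟨M, rfl⟩ : ∃ M, N = M + 1 := by
    cases N with
    | zero => exact absurd (Subsingleton.elim _ _) hv
    | succ M => exact ⟨M, rfl⟩
  obtain ⟨j0, hj0⟩ : ∃ j0, ‖v‖ = ‖v j0‖ := by
    obtain ⟨j0, -, h⟩ := Finset.exists_max_image Finset.univ (fun j => ‖v j‖) ⟨0, Finset.mem_univ _⟩
    exact ⟨j0, le_antisymm ((pi_norm_le_iff_of_nonneg (norm_nonneg _)).2 fun j => h j (Finset.mem_univ _)) (norm_le_pi_norm v j0)⟩
  have hvn : 0 < ‖v‖ := norm_pos_iff.2 hv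
  have ht : ((v j0 : ℤ) : ℝ) ≠ 0 := by
    rw [hj0, Int.norm_eq_abs] at hvn
    exact abs_pos.1 hvn
  have htn : |((v j0 : ℤ) : ℝ)| = ‖v‖ := by rw [hj0, Int.norm_eq_abs]
  set S := {X : Fin (M+1) → Fin n → ℝ | (∀ j i, |X j i| ≤ 1/2) ∧ ∀ i, |lf (zr v) X i| < L i} with hS
  have hSm : MeasurableSet S := by
    have : S = (⋂ j, ⋂ i, {X : Fin (M+1) → Fin n → ℝ | |X j i| ≤ 1/2}) ∩ ⋂ i, {X : Fin (M+1) → Fin n → ℝ | |lf (zr v) X i| < L i} := by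
      ext; simp [hS]
    rw [this]
    refine MeasurableSet.inter (MeasurableSet.iInter fun j => MeasurableSet.iInter fun i => ?_) (MeasurableSet.iInter fun i => ?_)
    · exact (isClosed_le (by fun_prop) continuous_const).measurableSet
    · refine (isOpen_lt ?_ continuous_const).measurableSet
      unfold lf
      fun_prop
  have hmp := volume_preserving_piFinSuccAbove (fun _ : Fin (M+1) => (Fin n → ℝ)) j0
  set e := MeasurableEquiv.piFinSuccAbove (fun _ : Fin (M+1) => (Fin n → ℝ)) j0 with he
  have h1 : volume S = volume (e.symm ⁻¹' S) := ((hmp.symm e).measure_preimage_equiv S).symm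
  rw [h1, Measure.volume_eq_prod, Measure.prod_apply_symm (e.symm.measurable hSm)]
  have hslice : ∀ Y : Fin M → Fin n → ℝ, volume ((fun x => (x, Y)) ⁻¹' (e.symm ⁻¹' S)) ≤
      Set.indicator (Set.pi Set.univ fun _ => Set.pi Set.univ fun _ => Set.Icc (-(1/2):ℝ) (1/2)) (fun _ => ENNReal.ofReal (∏ i, min 1 (2 * (L i / ‖v‖)))) Y := by
    intro Y
    by_cases hY : Y ∈ Set.pi Set.univ fun _ => Set.pi Set.univ fun _ => Set.Icc (-(1/2):ℝ) (1/2)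
    · rw [Set.indicator_of_mem hY]
      have hsub : ((fun x => (x, Y)) ⁻¹' (e.symm ⁻¹' S)) ⊆ {x : Fin n → ℝ | ∀ i, |x i| ≤ 1/2 ∧ |(v j0 : ℝ) * x i + ∑ k, (v (j0.succAbove k) : ℝ) * Y k i| < L i} := by
        intro x hx i
        simp only [Set.mem_preimage, hS, Set.mem_ofPred_eq] at hx
        have e1 : e.symm (x, Y) j0 = x := pfs_same j0 x Y
        have e2 : ∀ k, e.symm (x, Y) (j0.succAbove k) = Y k := pfs_succ j0 x Y
        have h3 := hx.1 j0 i
        have h4 := hx.2 i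
        rw [lf, Fin.sum_univ_succAbove _ j0] at h4
        simp only [e1, e2, zr] at h3 h4
        exact ⟨h3, h4⟩
      refine (measure_mono hsub).trans ?_
      rw [vol_pred_pi (fun i t => |t| ≤ 1/2 ∧ |(v j0 : ℝ) * t + ∑ k, (v (j0.succAbove k) : ℝ) * Y k i| < L i),
        ENNReal.ofReal_prod_of_nonneg (fun i _ => le_min zero_le_one (by have := hL i; positivity))]
      refine Finset.prod_le_prod' fun i _ => ?_
      rw [ENNReal.ofReal_min]
      refine le_min ?_ ?_
      · refine (measure_mono (t := Set.Icc (-(1/2):ℝ) (1/2)) ?_).trans ?_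
        · intro t ht
          exact abs_le.1 ht.1
        · rw [Real.volume_Icc]; norm_num
      · refine (measure_mono (t := {t | |(v j0 : ℝ) * t + ∑ k, (v (j0.succAbove k) : ℝ) * Y k i| < L i}) fun t ht => ht.2).trans ?_
        rw [slab_vol _ _ _ ht, htn]
    · rw [Set.indicator_of_notMem hY]
      have : ((fun x => (x, Y)) ⁻¹' (e.symm ⁻¹' S)) = ∅ := by
        rw [Set.eq_empty_iff_forall_notMem]
        intro x hx
        apply hY
        simp only [Set.mem_preimage, hS, Set.mem_ofPred_eq] at hx
        have e2 : ∀ k, e.symm (x, Y) (j0.succAbove k) = Y k := pfs_succ j0 x Y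
        intro k _ i _
        have := hx.1 (j0.succAbove k) i
        rw [e2] at this
        exact abs_le.1 this
      rw [this]; simp
  refine (lintegral_mono hslice).trans ?_
  rw [lintegral_indicator_const]
  · rw [volume_pi_pi]
    have : volume (Set.pi Set.univ fun _ : Fin n => Set.Icc (-(1/2):ℝ) (1/2)) = 1 := by
      rw [volume_pi_pi]
      simp only [Real.volume_Icc]
      norm_num
    simp only [this]
    simp
  · exact MeasurableSet.univ_pi fun _ => MeasurableSet.univ_pi fun _ => measurableSet_Icc

/-- the reference measure -/
noncomputable def mu (N n κ : ℕ) : Measure ((Fin n → ℝ) × (Fin N → Fin n → ℝ)) :=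
  (volume.restrict (Metric.ball 0 (1/2))).prod (volume.restrict (Om N n κ))

lemma lf_zr_sub {N n : ℕ} (r s : ℕ) (p q : Fin N → ℤ) (X : Fin N → Fin n → ℝ) (i : Fin n) :
    lf (zr ((s:ℤ) • p - (r:ℤ) • q)) X i = s * lf (zr p) X i - r * lf (zr q) X i := by
  simp only [lf, zr, Finset.mul_sum, ← Finset.sum_sub_distrib]
  refine Finset.sum_congr rfl fun j _ => ?_
  simp
  ring

lemma mu_pair_le {N n κ : ℕ} (a b : Fin n → ℝ) (ha : ∀ i, 0 < a i) (hb : ∀ i, 0 < b i) (r s : ℕ)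
    (hr : 0 < r) (hs : 0 < s) (p q : Fin N → ℤ) :
    mu N n κ (AA a r p ∩ AA b s q) ≤ ENNReal.ofReal (∏ i, 2 * min (a i / r) (b i / s)) *
      volume {X ∈ Om N n κ | ∀ i, |lf (zr ((s:ℤ) • p - (r:ℤ) • q)) X i| < s * a i + r * b i} := by
  have hrR : (0:ℝ) < r := by exact_mod_cast hr
  have hsR : (0:ℝ) < s := by exact_mod_cast hs
  set V := {X ∈ Om N n κ | ∀ i, |lf (zr ((s:ℤ) • p - (r:ℤ) • q)) X i| < s * a i + r * b i} with hV
  have hVm : MeasurableSet V := by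
    have : V = Om N n κ ∩ ⋂ i, {X : Fin N → Fin n → ℝ | |lf (zr ((s:ℤ) • p - (r:ℤ) • q)) X i| < s * a i + r * b i} := by
      ext; simp [hV]
    rw [this]
    refine (isClosed_Om N n κ).measurableSet.inter (MeasurableSet.iInter fun i => ?_)
    refine (isOpen_lt ?_ continuous_const).measurableSet
    unfold lf
    fun_prop
  have hAm : MeasurableSet (AA a r p ∩ AA b s q) := ((isOpen_AA a r p).inter (isOpen_AA b s q)).measurableSet
  rw [mu, Measure.prod_apply_symm hAm]
  have hsl : ∀ X ∈ Om N n κ, (volume.restrict (Metric.ball 0 (1/2))) ((fun x => (x, X)) ⁻¹' (AA a r p ∩ AA b s q)) ≤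
      V.indicator (fun _ => ENNReal.ofReal (∏ i, 2 * min (a i / r) (b i / s))) X := by
    intro X hX
    refine (Measure.restrict_apply_le _ _).trans ?_
    by_cases hXV : X ∈ V
    · rw [Set.indicator_of_mem hXV]
      refine (measure_mono (t := {x : Fin n → ℝ | ∀ i, |(r:ℝ) * x i + lf (zr p) X i| < a i ∧ |(s:ℝ) * x i + lf (zr q) X i| < b i}) ?_).trans ?_
      · intro x hx i
        exact ⟨hx.1 i, hx.2 i⟩
      · rw [vol_pred_pi (fun i t => |(r:ℝ) * t + lf (zr p) X i| < a i ∧ |(s:ℝ) * t + lf (zr q) X i| < b i),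
          ENNReal.ofReal_prod_of_nonneg (fun i _ => by have := ha i; have := hb i; positivity)]
        refine Finset.prod_le_prod' fun i _ => ?_
        rw [mul_min_of_nonneg _ _ (by norm_num), ENNReal.ofReal_min]
        refine le_min ?_ ?_
        · refine (measure_mono (t := {t | |(r:ℝ) * t + lf (zr p) X i| < a i}) fun t ht => ht.1).trans ?_
          rw [slab_vol _ _ _ hrR.ne', abs_of_pos hrR]
        · refine (measure_mono (t := {t | |(s:ℝ) * t + lf (zr q) X i| < b i}) fun t ht => ht.2).trans ?_
          rw [slab_vol _ _ _ hsR.ne', abs_of_pos hsR]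
    · rw [Set.indicator_of_notMem hXV]
      have : ((fun x => (x, X)) ⁻¹' (AA a r p ∩ AA b s q)) = ∅ := by
        rw [Set.eq_empty_iff_forall_notMem]
        intro x hx
        refine hXV ⟨hX, fun i => ?_⟩
        have h1 := hx.1 i
        have h2 := hx.2 i
        simp only at h1 h2
        rw [lf_zr_sub]
        rw [abs_lt] at h1 h2 ⊢
        constructor <;> nlinarith
      rw [this]; simp
  calc _ ≤ ∫⁻ X in Om N n κ, V.indicator (fun _ => ENNReal.ofReal (∏ i, 2 * min (a i / r) (b i / s))) X :=
        setLIntegral_mono' (isClosed_Om N n κ).measurableSet hsl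
    _ ≤ ∫⁻ X, V.indicator (fun _ => ENNReal.ofReal (∏ i, 2 * min (a i / r) (b i / s))) X := setLIntegral_le_lintegral _ _
    _ = _ := by rw [lintegral_indicator_const hVm]

lemma mu_single_le {N n κ : ℕ} (a : Fin n → ℝ) (ha : ∀ i, 0 < a i) (r : ℕ)
    (hr : 0 < r) (p : Fin N → ℤ) :
    mu N n κ (AA a r p) ≤ ENNReal.ofReal (∏ i, 2 * (a i / r)) := by
  have h := mu_pair_le (κ := κ) a a ha ha r r hr hr p p
  rw [Set.inter_self] at h
  refine h.trans ?_
  simp only [min_self]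
  calc _ ≤ ENNReal.ofReal (∏ i, 2 * (a i / r)) * volume (Set.pi Set.univ fun _ : Fin N => Set.pi Set.univ fun _ : Fin n => Set.Icc (-(1/2):ℝ) (1/2)) := by
        gcongr
        intro X hX j _ i _
        exact abs_le.1 (hX.1.1 j i)
    _ = _ := by
      rw [volume_pi_pi]
      have : volume (Set.pi Set.univ fun _ : Fin n => Set.Icc (-(1/2):ℝ) (1/2)) = 1 := by
        rw [volume_pi_pi]
        simp only [Real.volume_Icc]
        norm_num
      simp only [this]
      simp

lemma min_mul_max_aux (a b r s : ℝ) (ha : 0 < a) (hb : 0 < b) (hr : 0 < r) (hs : 0 < s) :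
    min (a / r) (b / s) * max (s * a) (r * b) = a * b := by
  rcases le_total (s * a) (r * b) with h | h
  · rw [max_eq_right h, min_eq_left]
    · field_simp
    · rw [div_le_div_iff₀ hr hs]; linarith
  · rw [max_eq_left h, min_eq_right]
    · field_simp
    · rw [div_le_div_iff₀ hs hr]; linarith

lemma pair_moment (N n κ : ℕ) (hn : 0 < n) (hnN : n ≤ N) : ∃ C : ℝ, 0 < C ∧
    ∀ (r s : ℕ), 0 < r → 0 < s → ∀ (a b : Fin n → ℝ), (∀ i, 0 < a i) → (∀ i, 0 < b i) →
    ∑ z ∈ (ibox N r ×ˢ ibox N s).filter (fun z => (s:ℤ) • z.1 - (r:ℤ) • z.2 ≠ 0),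
      mu N n κ (AA a r z.1 ∩ AA b s z.2) ≤
      ENNReal.ofReal (C * ((∏ i, a i) * (r:ℝ) ^ (N - n)) * ((∏ i, b i) * (s:ℝ) ^ (N - n))) := by
  classical
  rcases hnN.lt_or_eq with hlt | heq
  · obtain ⟨C, hC, hS⟩ := pair_sum N n hlt
    refine ⟨8 ^ n * (C * 2 ^ (N - n)), by positivity, fun r s hr hs a b ha hb => ?_⟩
    have hrR : (0:ℝ) < r := by exact_mod_cast hr
    have hsR : (0:ℝ) < s := by exact_mod_cast hs
    have hA : 0 < ∏ i, a i := Finset.prod_pos fun i _ => ha i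
    have hB : 0 < ∏ i, b i := Finset.prod_pos fun i _ => hb i
    have hterm : ∀ z ∈ (ibox N r ×ˢ ibox N s).filter (fun z => (s:ℤ) • z.1 - (r:ℤ) • z.2 ≠ 0),
        mu N n κ (AA a r z.1 ∩ AA b s z.2) ≤
        ENNReal.ofReal (8 ^ n * ((∏ i, a i) * ∏ i, b i) * (‖(s:ℤ) • z.1 - (r:ℤ) • z.2‖ ^ n)⁻¹) := by
      intro z hz
      have hv := (Finset.mem_filter.1 hz).2
      set v := (s:ℤ) • z.1 - (r:ℤ) • z.2 with hvdef
      have hvn : 0 < ‖v‖ := norm_pos_iff.2 hv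
      refine (mu_pair_le a b ha hb r s hr hs z.1 z.2).trans ?_
      have h1 : volume {X ∈ Om N n κ | ∀ i, |lf (zr v) X i| < s * a i + r * b i} ≤
          ENNReal.ofReal (∏ i, min 1 (2 * ((s * a i + r * b i) / ‖v‖))) := by
        refine (measure_mono ?_).trans (vol_Om_slab v hv _ fun i => by have := ha i; have := hb i; positivity)
        intro X hX
        exact ⟨hX.1.1, hX.2⟩
      refine (mul_le_mul_right h1 _).trans ?_
      rw [← ENNReal.ofReal_mul (Finset.prod_nonneg fun i _ => by have := ha i; have := hb i; positivity), ← Finset.prod_mul_distrib]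
      apply ENNReal.ofReal_le_ofReal
      calc _ ≤ ∏ i, (8 * (a i * b i) * ‖v‖⁻¹) := by
            refine Finset.prod_le_prod (fun i _ => ?_) fun i _ => ?_
            · have := ha i; have := hb i; positivity
            · have hai := ha i; have hbi := hb i
              calc _ ≤ 2 * min (a i / r) (b i / s) * (2 * (2 * max (s * a i) (r * b i) / ‖v‖)) := by
                    gcongr
                    refine (min_le_right _ _).trans ?_
                    gcongr
                    linarith [le_max_left (s * a i) (r * b i), le_max_right (s * a i) (r * b i)]
                _ = 8 * (min (a i / r) (b i / s) * max (s * a i) (r * b i)) * ‖v‖⁻¹ := by ring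
                _ = _ := by rw [min_mul_max_aux _ _ _ _ hai hbi hrR hsR]
        _ = _ := by
          rw [Finset.prod_mul_distrib, Finset.prod_mul_distrib, Finset.prod_mul_distrib]
          simp
    refine (Finset.sum_le_sum hterm).trans ?_
    rw [← ENNReal.ofReal_sum_of_nonneg (fun z _ => by positivity), ← Finset.mul_sum]
    apply ENNReal.ofReal_le_ofReal
    have hfil : (ibox N r ×ˢ ibox N s).filter (fun z => (s:ℤ) • z.1 - (r:ℤ) • z.2 ≠ 0) =
        (ibox N r ×ˢ ibox N s).filter (fun z => (s:ℤ) • z.1 - (r:ℤ) • z.2 ≠ 0 ∧ ‖(s:ℤ) • z.1 - (r:ℤ) • z.2‖ ≤ 2 * r * s) := by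
      refine Finset.filter_congr fun z hz => ?_
      rw [Finset.mem_product, mem_ibox_norm, mem_ibox_norm] at hz
      refine ⟨fun h => ⟨h, ?_⟩, fun h => h.1⟩
      calc _ ≤ ‖(s:ℤ) • z.1‖ + ‖(r:ℤ) • z.2‖ := norm_sub_le _ _
        _ ≤ ‖(s:ℤ)‖ * ‖z.1‖ + ‖(r:ℤ)‖ * ‖z.2‖ := add_le_add (norm_smul_le _ _) (norm_smul_le _ _)
        _ ≤ s * r + r * s := by
          rw [Int.norm_natCast, Int.norm_natCast]
          gcongr
          · exact hz.1
          · exact hz.2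
        _ = _ := by ring
    rw [hfil]
    calc _ ≤ 8 ^ n * ((∏ i, a i) * ∏ i, b i) * (C * (2 * r * s) ^ (N - n)) := by
          gcongr
          exact hS r s hr hs _ (by positivity)
      _ = _ := by rw [mul_pow, mul_pow]; ring
  · subst heq
    obtain ⟨C, hC, hS⟩ := pair_sum n (n-1) (by omega)
    refine ⟨8 ^ n * (C * (2 * κ) + 1), by positivity, fun r s hr hs a b ha hb => ?_⟩
    have hrR : (0:ℝ) < r := by exact_mod_cast hr
    have hsR : (0:ℝ) < s := by exact_mod_cast hs
    have hA : 0 < ∏ i, a i := Finset.prod_pos fun i _ => ha i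
    have hB : 0 < ∏ i, b i := Finset.prod_pos fun i _ => hb i
    obtain ⟨i0, -, hi0⟩ := Finset.exists_max_image Finset.univ (fun i => max (s * a i) (r * b i)) ⟨⟨0, hn⟩, Finset.mem_univ _⟩
    set M := max (s * a i0) (r * b i0) with hM
    have hMpos : 0 < M := lt_max_of_lt_left (mul_pos hsR (ha i0))
    have hterm : ∀ z ∈ (ibox n r ×ˢ ibox n s).filter (fun z => (s:ℤ) • z.1 - (r:ℤ) • z.2 ≠ 0),
        mu n n κ (AA a r z.1 ∩ AA b s z.2) ≤
        if ‖(s:ℤ) • z.1 - (r:ℤ) • z.2‖ ≤ 2 * κ * M then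
        ENNReal.ofReal (8 ^ n * ((∏ i, a i) * ∏ i, b i) * M⁻¹ * (‖(s:ℤ) • z.1 - (r:ℤ) • z.2‖ ^ (n-1))⁻¹) else 0 := by
      intro z hz
      have hv := (Finset.mem_filter.1 hz).2
      set v := (s:ℤ) • z.1 - (r:ℤ) • z.2 with hvdef
      have hvn : 0 < ‖v‖ := norm_pos_iff.2 hv
      refine (mu_pair_le a b ha hb r s hr hs z.1 z.2).trans ?_
      have hLM : ∀ i, s * a i + r * b i ≤ 2 * M := by
        intro i
        have : max (s * a i) (r * b i) ≤ M := hi0 i (Finset.mem_univ _)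
        linarith [le_max_left (s * a i) (r * b i), le_max_right (s * a i) (r * b i)]
      split_ifs with hcond
      · have h1 : volume {X ∈ Om n n κ | ∀ i, |lf (zr v) X i| < s * a i + r * b i} ≤
            ENNReal.ofReal (∏ i, min 1 (2 * ((s * a i + r * b i) / ‖v‖))) := by
          refine (measure_mono ?_).trans (vol_Om_slab v hv _ fun i => by have := ha i; have := hb i; positivity)
          intro X hX
          exact ⟨hX.1.1, hX.2⟩
        refine (mul_le_mul_right h1 _).trans ?_
        rw [← ENNReal.ofReal_mul (Finset.prod_nonneg fun i _ => by have := ha i; have := hb i; positivity), ← Finset.prod_mul_distrib]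
        apply ENNReal.ofReal_le_ofReal
        calc _ ≤ ∏ i, (8 * (a i * b i) * (if i = i0 then M⁻¹ else ‖v‖⁻¹)) := by
              refine Finset.prod_le_prod (fun i _ => ?_) fun i _ => ?_
              · have := ha i; have := hb i; positivity
              · have hai := ha i; have hbi := hb i
                split_ifs with hi
                · rw [hi]
                  have hai := ha i0; have hbi := hb i0
                  calc _ ≤ 2 * min (a i0 / r) (b i0 / s) * 1 := by gcongr; exact min_le_left _ _
                    _ = 2 * (min (a i0 / r) (b i0 / s) * M) * M⁻¹ := by field_simp
                    _ = 2 * (a i0 * b i0) * M⁻¹ := by rw [hM, min_mul_max_aux _ _ _ _ hai hbi hrR hsR]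
                    _ ≤ _ := by gcongr; norm_num
                · calc _ ≤ 2 * min (a i / r) (b i / s) * (2 * (2 * max (s * a i) (r * b i) / ‖v‖)) := by
                        gcongr
                        refine (min_le_right _ _).trans ?_
                        gcongr
                        linarith [le_max_left (s * a i) (r * b i), le_max_right (s * a i) (r * b i)]
                    _ = 8 * (min (a i / r) (b i / s) * max (s * a i) (r * b i)) * ‖v‖⁻¹ := by ring
                    _ = _ := by rw [min_mul_max_aux _ _ _ _ hai hbi hrR hsR]
          _ = _ := by
            rw [Finset.prod_mul_distrib, Finset.prod_mul_distrib, Finset.prod_mul_distrib]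
            have : ∏ i : Fin n, (if i = i0 then M⁻¹ else ‖v‖⁻¹) = M⁻¹ * (‖v‖ ^ (n-1))⁻¹ := by
              rw [← Finset.mul_prod_erase Finset.univ _ (Finset.mem_univ i0)]
              rw [Finset.prod_congr rfl (g := fun _ => ‖v‖⁻¹)]
              · simp
              · intro i hi
                simp [Finset.ne_of_mem_erase hi]
            rw [this]
            simp
            ring
      · have : {X ∈ Om n n κ | ∀ i, |lf (zr v) X i| < s * a i + r * b i} = ∅ := by
          rw [Set.eq_empty_iff_forall_notMem]
          rintro X ⟨hX1, hX2⟩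
          apply hcond
          refine (hX1.2 rfl v).trans ?_
          have : ‖lf (zr v) X‖ ≤ 2 * M := by
            rw [pi_norm_le_iff_of_nonneg (by positivity)]
            intro i
            rw [Real.norm_eq_abs]
            exact (hX2 i).le.trans (hLM i)
          calc _ ≤ κ * (2 * M) := by gcongr
            _ = _ := by ring
        rw [this]; simp
    refine (Finset.sum_le_sum hterm).trans ?_
    rw [← Finset.sum_filter, Finset.filter_filter]
    rw [← ENNReal.ofReal_sum_of_nonneg (fun z _ => by positivity), ← Finset.mul_sum]
    apply ENNReal.ofReal_le_ofReal
    have h1 : n - (n - 1) = 1 := by omega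
    have := hS r s hr hs (2 * κ * M) (by positivity)
    rw [h1, pow_one] at this
    calc _ ≤ 8 ^ n * ((∏ i, a i) * ∏ i, b i) * M⁻¹ * (C * (2 * κ * M)) := by gcongr
      _ = 8 ^ n * (C * (2 * κ)) * ((∏ i, a i) * ∏ i, b i) := by field_simp
      _ ≤ 8 ^ n * (C * (2 * κ) + 1) * ((∏ i, a i) * ∏ i, b i) := by gcongr; linarith
      _ = _ := by simp; ring

open Classical in
/-- primitive index sets -/
noncomputable def Ip (N : ℕ) (ρ : ℕ) : Finset (Fin N → ℤ) :=
  (ibox N (ρ+1)).filter (fun p => Prim (ρ+1) p)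

lemma diag_le (N n κ : ℕ) (hnN : n ≤ N) (a : Fin n → ℝ) (ha : ∀ i, 0 < a i) (ρ : ℕ) :
    ∑ p ∈ Ip N ρ, mu N n κ (AA a (ρ+1) p) ≤ ENNReal.ofReal (3 ^ N * 2 ^ n * ((∏ i, a i) * ((ρ:ℝ)+1) ^ (N - n))) := by
  classical
  have hA : 0 < ∏ i, a i := Finset.prod_pos fun i _ => ha i
  calc _ ≤ ∑ p ∈ Ip N ρ, ENNReal.ofReal (∏ i, 2 * (a i / ((ρ+1 : ℕ) : ℝ))) :=
        Finset.sum_le_sum fun p _ => mu_single_le a ha (ρ+1) (Nat.succ_pos _) p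
    _ = ((Ip N ρ).card : ℝ≥0∞) * ENNReal.ofReal (∏ i, 2 * (a i / ((ρ+1 : ℕ) : ℝ))) := by
        rw [Finset.sum_const, nsmul_eq_mul]
    _ ≤ ENNReal.ofReal ((3 * ((ρ:ℝ) + 1)) ^ N) * ENNReal.ofReal (∏ i, 2 * (a i / ((ρ+1 : ℕ) : ℝ))) := by
        gcongr
        rw [← ENNReal.ofReal_natCast]
        apply ENNReal.ofReal_le_ofReal
        calc ((Ip N ρ).card : ℝ) ≤ ((ibox N (ρ+1)).card : ℝ) := by
              exact_mod_cast Finset.card_filter_le _ _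
          _ = (2 * ((ρ:ℝ) + 1) + 1) ^ N := by rw [card_ibox]; push_cast; rfl
          _ ≤ _ := by
            gcongr
            have : (0:ℝ) ≤ ρ := by positivity
            linarith
    _ = _ := by
        rw [← ENNReal.ofReal_mul (by positivity)]
        congr 1
        rw [Finset.prod_mul_distrib, Finset.prod_div_distrib]
        simp only [Finset.prod_const, Finset.card_univ, Fintype.card_fin]
        push_cast
        have h : ((ρ:ℝ)+1) ^ N = ((ρ:ℝ)+1) ^ (N - n) * ((ρ:ℝ)+1) ^ n := by
          rw [← pow_add]; congr 1; omega
        have h0 : ((ρ:ℝ)+1) ^ n ≠ 0 := by positivity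
        rw [mul_pow, h]
        field_simp

lemma second_moment (N n κ : ℕ) (hn : 0 < n) (hnN : n ≤ N) (a : ℕ → Fin n → ℝ) (ha : ∀ r i, 0 < a r i)
    (hdiv : Tendsto (fun R => ∑ r ∈ Finset.range R, (∏ i, a r i) * ((r:ℝ)+1) ^ (N - n)) atTop atTop) :
    ∃ C : ℝ, 0 ≤ C ∧ ∀ᶠ R in atTop, ∑ r ∈ Finset.range R, ∑ p ∈ Ip N r, ∑ s ∈ Finset.range R, ∑ q ∈ Ip N s,
      mu N n κ (AA (a r) (r+1) p ∩ AA (a s) (s+1) q) ≤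
        ENNReal.ofReal (C * (∑ r ∈ Finset.range R, (∏ i, a r i) * ((r:ℝ)+1) ^ (N - n)) ^ 2) := by
  classical
  obtain ⟨C, hC, hP⟩ := pair_moment N n κ hn hnN
  set w : ℕ → ℝ := fun r => (∏ i, a r i) * ((r:ℝ)+1) ^ (N - n) with hw
  have hwp : ∀ r, 0 ≤ w r := fun r => mul_nonneg (Finset.prod_nonneg fun i _ => (ha r i).le) (by positivity)
  refine ⟨C + 3 ^ N * 2 ^ n, by positivity, ?_⟩
  have hrs : ∀ r s, ∑ p ∈ Ip N r, ∑ q ∈ Ip N s, mu N n κ (AA (a r) (r+1) p ∩ AA (a s) (s+1) q) ≤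
      ENNReal.ofReal (C * w r * w s) + if r = s then ENNReal.ofReal (3 ^ N * 2 ^ n * w r) else 0 := by
    intro r s
    calc _ ≤ ∑ p ∈ Ip N r, ∑ q ∈ Ip N s,
          ((if ((s+1:ℕ):ℤ) • p - ((r+1:ℕ):ℤ) • q ≠ 0 then mu N n κ (AA (a r) (r+1) p ∩ AA (a s) (s+1) q) else 0) +
          (if r = s then if p = q then mu N n κ (AA (a r) (r+1) p) else 0 else 0)) := by
          refine Finset.sum_le_sum fun p hp => Finset.sum_le_sum fun q hq => ?_
          by_cases hv : ((s+1:ℕ):ℤ) • p - ((r+1:ℕ):ℤ) • q = 0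
          · have := prim_eq (Nat.succ_pos r) (Nat.succ_pos s) (Finset.mem_filter.1 hp).2 (Finset.mem_filter.1 hq).2 hv
            have h1 : r = s := by have := this.1; omega
            rw [if_pos h1, if_pos this.2]
            refine le_add_left ?_
            exact measure_mono Set.inter_subset_left
          · rw [if_pos hv]
            exact le_self_add
      _ = (∑ p ∈ Ip N r, ∑ q ∈ Ip N s,
          (if ((s+1:ℕ):ℤ) • p - ((r+1:ℕ):ℤ) • q ≠ 0 then mu N n κ (AA (a r) (r+1) p ∩ AA (a s) (s+1) q) else 0)) +
          ∑ p ∈ Ip N r, ∑ q ∈ Ip N s, (if r = s then if p = q then mu N n κ (AA (a r) (r+1) p) else 0 else 0) := by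
          simp only [Finset.sum_add_distrib]
      _ ≤ _ := by
          gcongr
          · rw [← Finset.sum_product', ← Finset.sum_filter]
            refine le_trans ?_ ((hP (r+1) (s+1) (Nat.succ_pos _) (Nat.succ_pos _) (a r) (a s) (ha r) (ha s)).trans ?_)
            · refine Finset.sum_le_sum_of_subset ?_
              refine Finset.filter_subset_filter _ (Finset.product_subset_product (Finset.filter_subset _ _) (Finset.filter_subset _ _))
            · apply ENNReal.ofReal_le_ofReal
              simp only [hw]
              push_cast
              exact le_refl _
          · split_ifs with h
            · subst h
              simp only [Finset.sum_ite_eq]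
              rw [Finset.sum_congr rfl (fun p hp => if_pos hp)]
              exact diag_le N n κ hnN (a r) (ha r) r
            · simp
  filter_upwards [hdiv.eventually_ge_atTop 1] with R hR
  calc _ = ∑ r ∈ Finset.range R, ∑ s ∈ Finset.range R, ∑ p ∈ Ip N r, ∑ q ∈ Ip N s, mu N n κ (AA (a r) (r+1) p ∩ AA (a s) (s+1) q) := by
        refine Finset.sum_congr rfl fun r _ => ?_
        rw [Finset.sum_comm]
    _ ≤ ∑ r ∈ Finset.range R, ∑ s ∈ Finset.range R, (ENNReal.ofReal (C * w r * w s) + if r = s then ENNReal.ofReal (3 ^ N * 2 ^ n * w r) else 0) :=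
        Finset.sum_le_sum fun r _ => Finset.sum_le_sum fun s _ => hrs r s
    _ = ENNReal.ofReal (C * (∑ r ∈ Finset.range R, w r) ^ 2) + ENNReal.ofReal (3 ^ N * 2 ^ n * (∑ r ∈ Finset.range R, w r)) := by
        simp only [Finset.sum_add_distrib, Finset.sum_ite_eq]
        congr 1
        · rw [sq, Finset.sum_mul_sum, Finset.mul_sum, ENNReal.ofReal_sum_of_nonneg]
          · refine Finset.sum_congr rfl fun r _ => ?_
            rw [Finset.mul_sum, ENNReal.ofReal_sum_of_nonneg]
            · simp only [mul_assoc]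
            · intro s _
              have := hwp r; have := hwp s; positivity
          · intro r _
            exact mul_nonneg hC.le (Finset.sum_nonneg fun s _ => mul_nonneg (hwp r) (hwp s))
        · rw [Finset.sum_congr rfl (fun p hp => if_pos hp), Finset.mul_sum, ENNReal.ofReal_sum_of_nonneg]
          intro r _
          have := hwp r; positivity
    _ ≤ _ := by
        have h0 : 0 ≤ ∑ r ∈ Finset.range R, w r := by linarith
        rw [← ENNReal.ofReal_add (by positivity) (by positivity)]
        apply ENNReal.ofReal_le_ofReal
        rw [add_mul]
        gcongr
        nlinarith

lemma lf_neg_zr {N n : ℕ} (r : ℝ) (p : Fin N → ℤ) (X : Fin N → Fin n → ℝ) (i : Fin n) :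
    lf (fun j => (p j : ℝ) / r) X i = lf (zr p) X i / r := by
  simp only [lf, zr, Finset.sum_div]
  exact Finset.sum_congr rfl fun j _ => by ring

lemma continuous_lf_left {N n : ℕ} (X : Fin N → Fin n → ℝ) : Continuous (fun ξ : Fin N → ℝ => lf ξ X) := by
  unfold lf
  fun_prop

lemma slice_moment (N n : ℕ) (hN : 2 ≤ N) (hnN : n ≤ N) (a : ℕ → Fin n → ℝ) (ha : ∀ r i, 0 < a r i)
    (hlim : ∀ i, Tendsto (fun r => a r i) atTop (nhds 0)) (X : Fin N → Fin n → ℝ)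
    (V : Set (Fin n → ℝ)) (hV : IsOpen V) (c : ℝ)
    (hc : ENNReal.ofReal c < volume (Metric.ball 0 1 ∩ (fun ξ : Fin N → ℝ => - lf ξ X) ⁻¹' V)) :
    ∀ᶠ r : ℕ in atTop, ENNReal.ofReal (c * (2 ^ n / 8 * ((∏ i, a r i) * ((r:ℝ)+1) ^ (N - n)))) ≤
      ∑ p ∈ Ip N r, volume (V ∩ {z | ∀ i, |((r+1:ℕ):ℝ) * z i + lf (zr p) X i| < a r i}) := by
  classical
  have hcont : Continuous (fun ξ : Fin N → ℝ => - lf ξ X) := (continuous_lf_left X).neg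
  set G : ℕ → Set (Fin N → ℝ) := fun k => Metric.ball 0 1 ∩
    {ξ | ENNReal.ofReal (1 / ((k:ℝ) + 1)) < Metric.infEDist (- lf ξ X) Vᶜ} with hG
  have hGo : ∀ k, IsOpen (G k) := by
    intro k
    refine Metric.isOpen_ball.inter (isOpen_lt continuous_const ?_)
    exact Metric.continuous_infEDist.comp hcont
  have hGm : Monotone G := by
    intro k l hkl ξ hξ
    refine ⟨hξ.1, show ENNReal.ofReal (1 / ((l:ℝ) + 1)) < Metric.infEDist (- lf ξ X) Vᶜ from lt_of_le_of_lt ?_ hξ.2⟩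
    apply ENNReal.ofReal_le_ofReal
    apply one_div_le_one_div_of_le (by positivity)
    have : (k:ℝ) ≤ l := by exact_mod_cast hkl
    linarith
  have hGU : Metric.ball 0 1 ∩ (fun ξ : Fin N → ℝ => - lf ξ X) ⁻¹' V ⊆ ⋃ k, G k := by
    rintro ξ ⟨h1, h2⟩
    have hpos : 0 < Metric.infEDist (- lf ξ X) Vᶜ := by
      rw [pos_iff_ne_zero]
      intro h0
      have := (Metric.mem_iff_infEDist_zero_of_closed hV.isClosed_compl).2 h0
      exact this h2
    have ht : Tendsto (fun k : ℕ => ENNReal.ofReal (1 / ((k:ℝ) + 1))) atTop (nhds 0) := by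
      have := ENNReal.tendsto_ofReal (tendsto_one_div_add_atTop_nhds_zero_nat (𝕜 := ℝ))
      simpa using this
    obtain ⟨k, hk⟩ := (ht.eventually_lt_const hpos).exists
    exact Set.mem_iUnion.2 ⟨k, h1, hk⟩
  have hc2 := hc.trans_le (measure_mono hGU)
  obtain ⟨k, hk⟩ := ((tendsto_measure_iUnion_atTop hGm).eventually_const_lt hc2).exists
  have hcount := (tendsto_add_atTop_nat 1).eventually (prim_count_open N hN (G k) (hGo k) Set.inter_subset_left c hk)
  have hsmall : ∀ᶠ r in atTop, ∀ i, a r i < 1 / ((k:ℝ) + 1) := by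
    rw [Filter.eventually_all]
    intro i
    exact (hlim i).eventually_lt_const (by positivity)
  filter_upwards [hcount, hsmall] with r hr1 hr2
  have hr0 : (0:ℝ) < ((r+1 : ℕ) : ℝ) := by positivity
  have hr1' : (1:ℝ) ≤ ((r+1 : ℕ) : ℝ) := by push_cast; have : (0:ℝ) ≤ r := by positivity
                                            linarith
  have hP : 0 ≤ ∏ i, 2 * (a r i / ((r+1 : ℕ) : ℝ)) := Finset.prod_nonneg fun i _ => by have := ha r i; positivity
  set J := (ibox N (r+1)).filter (fun p => Prim (r+1) p ∧ (fun j => (p j:ℝ)/((r+1:ℕ):ℝ)) ∈ G k) with hJ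
  have hJI : J ⊆ Ip N r := by
    intro p hp
    have := Finset.mem_filter.1 hp
    exact Finset.mem_filter.2 ⟨this.1, this.2.1⟩
  have hr1J : 1 / 8 * c * ((r+1:ℕ):ℝ) ^ N ≤ (J.card : ℝ) := by convert hr1
  calc _ ≤ ENNReal.ofReal ((J.card : ℝ) * ∏ i, 2 * (a r i / ((r+1 : ℕ) : ℝ))) := by
        apply ENNReal.ofReal_le_ofReal
        refine le_trans (le_of_eq ?_) (mul_le_mul_of_nonneg_right hr1J hP)
        rw [Finset.prod_mul_distrib, Finset.prod_div_distrib]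
        simp only [Finset.prod_const, Finset.card_univ, Fintype.card_fin]
        push_cast
        have h : ((r:ℝ)+1) ^ N = ((r:ℝ)+1) ^ (N - n) * ((r:ℝ)+1) ^ n := by
          rw [← pow_add]; congr 1; omega
        have h0 : ((r:ℝ)+1) ^ n ≠ 0 := by positivity
        rw [h]
        field_simp
    _ = ∑ p ∈ J, ENNReal.ofReal (∏ i, 2 * (a r i / ((r+1 : ℕ) : ℝ))) := by
        rw [Finset.sum_const, nsmul_eq_mul, ENNReal.ofReal_mul (by positivity), ENNReal.ofReal_natCast]
    _ ≤ ∑ p ∈ J, volume (V ∩ {z | ∀ i, |((r+1:ℕ):ℝ) * z i + lf (zr p) X i| < a r i}) := by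
        refine Finset.sum_le_sum fun p hp => ?_
        have hpG := (Finset.mem_filter.1 hp).2.2.2
        have hsub : {z : Fin n → ℝ | ∀ i, |((r+1:ℕ):ℝ) * z i + lf (zr p) X i| < a r i} ⊆ V := by
          intro z hz
          by_contra hzV
          have h1 : Metric.infEDist (- lf (fun j => (p j:ℝ)/((r+1:ℕ):ℝ)) X) Vᶜ ≤ edist (- lf (fun j => (p j:ℝ)/((r+1:ℕ):ℝ)) X) z :=
            Metric.infEDist_le_edist_of_mem hzV
          have h2 : edist (- lf (fun j => (p j:ℝ)/((r+1:ℕ):ℝ)) X) z ≤ ENNReal.ofReal (1 / ((k:ℝ) + 1)) := by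
            rw [edist_dist]
            apply ENNReal.ofReal_le_ofReal
            rw [dist_pi_le_iff (by positivity)]
            intro i
            rw [Pi.neg_apply, lf_neg_zr, Real.dist_eq]
            have hz1 := hz i
            have e : -(lf (zr p) X i / ((r+1:ℕ):ℝ)) - z i = -((((r+1:ℕ):ℝ) * z i + lf (zr p) X i) / ((r+1:ℕ):ℝ)) := by
              field_simp
              ring
            rw [e, abs_neg, abs_div, abs_of_pos hr0]
            calc _ ≤ a r i / 1 := div_le_div₀ (ha r i).le hz1.le one_pos hr1'
              _ ≤ _ := by rw [div_one]; exact (hr2 i).le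
          exact absurd (hpG.trans_le (h1.trans h2)) (lt_irrefl _)
        rw [Set.inter_eq_right.2 hsub, vol_pred_pi (fun i t => |((r+1:ℕ):ℝ) * t + lf (zr p) X i| < a r i),
          ENNReal.ofReal_prod_of_nonneg (fun i _ => by have := ha r i; positivity)]
        refine le_of_eq (Finset.prod_congr rfl fun i _ => ?_)
        rw [slab_vol _ _ _ hr0.ne', abs_of_pos hr0]
    _ ≤ _ := Finset.sum_le_sum_of_subset hJI

/-- pushed forward measure -/
noncomputable def nu (N n κ : ℕ) : Measure ((Fin n → ℝ) × (Fin N → Fin n → ℝ)) :=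
  Measure.map (fun x : (Fin N → ℝ) × (Fin N → Fin n → ℝ) => (- lf x.1 x.2, x.2))
    (((volume.restrict (Metric.ball 0 1)).prod (volume.restrict (Om N n κ))).restrict
      {x | - lf x.1 x.2 ∈ Metric.ball 0 (1/2)})

lemma continuous_phi {N n : ℕ} : Continuous (fun x : (Fin N → ℝ) × (Fin N → Fin n → ℝ) => (- lf x.1 x.2, x.2)) :=
  (continuous_lf.neg).prodMk continuous_snd

lemma nu_open (N n κ : ℕ) (U : Set ((Fin n → ℝ) × (Fin N → Fin n → ℝ))) (hU : IsOpen U) :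
    nu N n κ U = ∫⁻ X in Om N n κ, volume (Metric.ball 0 1 ∩ (fun ξ : Fin N → ℝ => - lf ξ X) ⁻¹'
      (Metric.ball 0 (1/2) ∩ {z | (z, X) ∈ U})) := by
  have hm : MeasurableSet ((fun x : (Fin N → ℝ) × (Fin N → Fin n → ℝ) => (- lf x.1 x.2, x.2)) ⁻¹' U) :=
    (hU.preimage continuous_phi).measurableSet
  have hm2 : MeasurableSet {x : (Fin N → ℝ) × (Fin N → Fin n → ℝ) | - lf x.1 x.2 ∈ Metric.ball (0 : Fin n → ℝ) (1/2)} :=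
    (Metric.isOpen_ball.preimage continuous_lf.neg).measurableSet
  rw [nu, Measure.map_apply continuous_phi.measurable hU.measurableSet, Measure.restrict_apply hm,
    Measure.prod_apply_symm (hm.inter hm2)]
  refine lintegral_congr fun X => ?_
  rw [Measure.restrict_apply']
  · congr 1
    ext ξ
    simp only [Set.mem_inter_iff, Set.mem_preimage, Set.mem_ofPred_eq]
    tauto
  · exact measurableSet_ball

lemma first_moment (N n κ : ℕ) (hN : 2 ≤ N) (hnN : n ≤ N) (a : ℕ → Fin n → ℝ) (ha : ∀ r i, 0 < a r i)
    (hlim : ∀ i, Tendsto (fun r => a r i) atTop (nhds 0))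
    (U : Set ((Fin n → ℝ) × (Fin N → Fin n → ℝ))) (hU : IsOpen U) (c : ℝ)
    (hc : ENNReal.ofReal c < nu N n κ U) :
    ∀ᶠ r : ℕ in atTop, ENNReal.ofReal (c * (2 ^ n / 8 * ((∏ i, a r i) * ((r:ℝ)+1) ^ (N - n)))) ≤
      ∑ p ∈ Ip N r, mu N n κ (AA (a r) (r+1) p ∩ U) := by
  set w : ℕ → ℝ := fun r => 2 ^ n / 8 * ((∏ i, a r i) * ((r:ℝ)+1) ^ (N - n)) with hw
  have hwp : ∀ r, 0 < w r := fun r => by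
    have := Finset.prod_pos fun i (_ : i ∈ Finset.univ) => ha r i
    simp only [hw]
    positivity
  set F : ℕ → (Fin N → Fin n → ℝ) → ℝ≥0∞ := fun r X => ∑ p ∈ Ip N r,
    (volume.restrict (Metric.ball 0 (1/2))) ((fun z => (z, X)) ⁻¹' (AA (a r) (r+1) p ∩ U)) with hF
  have hAm : ∀ r p, MeasurableSet (AA (a r) (r+1) p ∩ U) := fun r p => ((isOpen_AA (a r) (r+1) p).inter hU).measurableSet
  have hFm1 : ∀ r p, Measurable (fun X => (volume.restrict (Metric.ball 0 (1/2))) ((fun z => (z, X)) ⁻¹' (AA (a r) (r+1) p ∩ U))) :=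
    fun r p => measurable_measure_prodMk_right (hAm r p)
  have hFm : ∀ r, Measurable (F r) := fun r => Finset.measurable_fun_sum _ fun p _ => hFm1 r p
  have hFint : ∀ r, ∫⁻ X in Om N n κ, F r X = ∑ p ∈ Ip N r, mu N n κ (AA (a r) (r+1) p ∩ U) := by
    intro r
    rw [lintegral_finsetSum _ (fun p _ => hFm1 r p)]
    refine Finset.sum_congr rfl fun p _ => ?_
    rw [mu, Measure.prod_apply_symm (hAm r p)]
  have hkey : ∀ X, volume (Metric.ball 0 1 ∩ (fun ξ : Fin N → ℝ => - lf ξ X) ⁻¹'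
      (Metric.ball 0 (1/2) ∩ {z | (z, X) ∈ U})) ≤ liminf (fun r => F r X / ENNReal.ofReal (w r)) atTop := by
    intro X
    refine ENNReal.le_of_forall_nnreal_lt fun t ht => ?_
    have hV : IsOpen (Metric.ball (0 : Fin n → ℝ) (1/2) ∩ {z | (z, X) ∈ U}) :=
      Metric.isOpen_ball.inter (hU.preimage (by fun_prop : Continuous fun z : Fin n → ℝ => (z, X)))
    have := slice_moment N n hN hnN a ha hlim X _ hV t (by rwa [ENNReal.ofReal_coe_nnreal])
    refine le_liminf_of_le (by isBoundedDefault) ?_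
    filter_upwards [this] with r hr
    rw [ENNReal.le_div_iff_mul_le (Or.inl (by simpa using hwp r)) (Or.inl ENNReal.ofReal_ne_top)]
    rw [← ENNReal.ofReal_coe_nnreal, ← ENNReal.ofReal_mul t.coe_nonneg]
    refine hr.trans (le_of_eq (Finset.sum_congr rfl fun p _ => ?_))
    rw [Measure.restrict_apply' measurableSet_ball]
    congr 1
    ext z
    simp only [AA, Set.mem_inter_iff, Set.mem_preimage, Set.mem_ofPred_eq]
    tauto
  have h1 : nu N n κ U ≤ liminf (fun r => (∑ p ∈ Ip N r, mu N n κ (AA (a r) (r+1) p ∩ U)) / ENNReal.ofReal (w r)) atTop := by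
    rw [nu_open N n κ U hU]
    refine (lintegral_mono hkey).trans ?_
    refine (lintegral_liminf_le fun r => (hFm r).div_const _).trans (le_of_eq ?_)
    congr 1
    ext r
    simp only [div_eq_mul_inv]
    rw [lintegral_mul_const _ (hFm r), hFint]
  have h2 := eventually_lt_of_lt_liminf (hc.trans_le h1) (by isBoundedDefault)
  filter_upwards [h2] with r hr
  have h3 := hr.le
  rw [ENNReal.le_div_iff_mul_le (Or.inl (by simpa using hwp r)) (Or.inl ENNReal.ofReal_ne_top)] at h3
  rwa [ENNReal.ofReal_mul' (hwp r).le]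

lemma nu_bad (N n κ : ℕ) (hN : 2 ≤ N) (hn : 0 < n) (hnN : n ≤ N) (a : ℕ → Fin n → ℝ) (ha : ∀ r i, 0 < a r i)
    (hlim : ∀ i, Tendsto (fun r => a r i) atTop (nhds 0))
    (hdiv : Tendsto (fun R => ∑ r ∈ Finset.range R, (∏ i, a r i) * ((r:ℝ)+1) ^ (N - n)) atTop atTop) :
    nu N n κ {x | {rp : ℕ × (Fin N → ℤ) | rp.2 ∈ Ip N rp.1 ∧ x ∈ AA (a rp.1) (rp.1+1) rp.2}.Finite} = 0 := by
  obtain ⟨C, hC, hS⟩ := second_moment N n κ hn hnN a ha hdiv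
  have hc0 : (0:ℝ) < 2 ^ n / 8 := by positivity
  have hsum : ∀ R, ∑ r ∈ Finset.range R, 2 ^ n / 8 * ((∏ i, a r i) * ((r:ℝ)+1) ^ (N - n)) =
      2 ^ n / 8 * ∑ r ∈ Finset.range R, ((∏ i, a r i) * ((r:ℝ)+1) ^ (N - n)) := fun R => by rw [Finset.mul_sum]
  have hfin : IsFiniteMeasure (mu N n κ) := by
    have h1 : IsFiniteMeasure (volume.restrict (Metric.ball (0 : Fin n → ℝ) (1/2))) :=
      ⟨by rw [Measure.restrict_apply_univ]; exact measure_ball_lt_top⟩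
    have h2 : IsFiniteMeasure (volume.restrict (Om N n κ)) := by
      refine ⟨?_⟩
      rw [Measure.restrict_apply_univ]
      refine (measure_mono (t := Metric.closedBall 0 (1/2)) ?_).trans_lt measure_closedBall_lt_top
      intro X hX
      rw [mem_closedBall_zero_iff, pi_norm_le_iff_of_nonneg (by norm_num)]
      intro j
      rw [pi_norm_le_iff_of_nonneg (by norm_num)]
      intro i
      exact hX.1 j i
    unfold mu
    infer_instance
  refine abs_bc (mu N n κ) (nu N n κ) (Ip N) (fun r p => AA (a r) (r+1) p)
    (fun r p => (isOpen_AA _ _ _).measurableSet) (fun r => 2 ^ n / 8 * ((∏ i, a r i) * ((r:ℝ)+1) ^ (N - n))) ?_ ?_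
    (C / (2 ^ n / 8) ^ 2) (by positivity) ?_ ?_
  · intro r
    have := Finset.prod_pos fun i (_ : i ∈ Finset.univ) => ha r i
    positivity
  · simp only [hsum]
    exact hdiv.const_mul_atTop hc0
  · filter_upwards [hS] with R hR
    refine hR.trans (le_of_eq ?_)
    congr 1
    rw [hsum]
    field_simp
  · intro U hU c hc hcU
    exact first_moment N n κ hN hnN a ha hlim U hU c hcU

lemma transfer_aux {N n : ℕ} (L : (Fin N → ℝ) →ₗ[ℝ] (Fin n → ℝ)) (hL : Function.Surjective L)
    (A : Set (Fin n → ℝ)) (hA : MeasurableSet A)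
    (h : volume (Metric.ball 0 1 ∩ L ⁻¹' A) = 0) :
    volume (A ∩ L '' Metric.closedBall 0 1) = 0 := by
  set V : Set (Fin N → ℝ) := Metric.ball 0 1 with hV
  have hcont : Continuous L := L.continuous_of_finiteDimensional
  have hopen : IsOpen (L '' V) := L.isOpenMap_of_finiteDimensional hL _ Metric.isOpen_ball
  have h1 : volume (L ⁻¹' (A ∩ L '' V)) = 0 := by
    set d := TopologicalSpace.denseSeq (LinearMap.ker L) with hd
    have hsub : L ⁻¹' (A ∩ L '' V) ⊆ ⋃ i, (fun ξ => ξ + (d i : Fin N → ℝ)) ⁻¹' (V ∩ L ⁻¹' A) := by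
      rintro ξ ⟨hξA, η, hη, hξη⟩
      have ho : IsOpen ((fun k : LinearMap.ker L => ξ + (k : Fin N → ℝ)) ⁻¹' V) :=
        Metric.isOpen_ball.preimage (by fun_prop)
      have hk : η - ξ ∈ LinearMap.ker L := by
        rw [LinearMap.mem_ker, map_sub, hξη, sub_self]
      obtain ⟨i, hi⟩ := (TopologicalSpace.denseRange_denseSeq (LinearMap.ker L)).exists_mem_open ho
        ⟨⟨η - ξ, hk⟩, by simpa using hη⟩
      refine Set.mem_iUnion.2 ⟨i, hi, ?_⟩
      have : L (ξ + (d i : Fin N → ℝ)) = L ξ := by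
        rw [map_add, LinearMap.mem_ker.1 (d i).2, add_zero]
      show L (ξ + (d i : Fin N → ℝ)) ∈ A
      rw [this]; exact hξA
    refine measure_mono_null hsub (measure_iUnion_null fun i => ?_)
    rw [measure_preimage_add_right]
    exact h
  have h2 : volume (A ∩ L '' V) = 0 := by
    obtain ⟨c, hc, hm⟩ := L.exists_map_addHaar_eq_smul_addHaar volume volume hL
    have h3 : Measure.map L volume (A ∩ L '' V) = 0 := by
      rw [Measure.map_apply hcont.measurable (hA.inter hopen.measurableSet), h1]
    rw [hm, Measure.smul_apply, smul_eq_mul, mul_eq_zero] at h3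
    exact h3.resolve_left hc.ne'
  have h3 : volume (frontier (L '' V)) = 0 :=
    Convex.addHaar_frontier volume ((convex_ball 0 1).linear_image L)
  refine measure_mono_null (t := (A ∩ L '' V) ∪ frontier (L '' V)) ?_ (measure_union_null h2 h3)
  rintro z ⟨hzA, hz⟩
  by_cases hzV : z ∈ L '' V
  · exact Or.inl ⟨hzA, hzV⟩
  · right
    refine ⟨?_, by rwa [hopen.interior_eq]⟩
    rw [← closure_ball (0 : Fin N → ℝ) one_ne_zero] at hz
    exact image_closure_subset_closure_image hcont hz

/-- the linear map `ξ ↦ ξ X` -/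
noncomputable def lfL {N n : ℕ} (X : Fin N → Fin n → ℝ) : (Fin N → ℝ) →ₗ[ℝ] (Fin n → ℝ) where
  toFun ξ := lf ξ X
  map_add' ξ η := by
    ext i
    simp [lf, add_mul, Finset.sum_add_distrib]
  map_smul' c ξ := by
    ext i
    simp [lf, Finset.mul_sum, mul_assoc]

lemma lfL_apply {N n : ℕ} (X : Fin N → Fin n → ℝ) (ξ : Fin N → ℝ) : lfL X ξ = lf ξ X := rfl

lemma lfL_single {N n : ℕ} (X : Fin N → Fin n → ℝ) (j : Fin N) : lfL X (Pi.single j 1) = X j := by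
  ext i
  simp [lfL_apply, lf, Pi.single_apply]

lemma surj_of_det {N n : ℕ} (hnN : n ≤ N) (X : Fin N → Fin n → ℝ)
    (h : (Matrix.of fun i j : Fin n => X (Fin.castLE hnN i) j).det ≠ 0) : Function.Surjective (lfL X) := by
  intro z
  set M : Matrix (Fin n) (Fin n) ℝ := Matrix.of fun i j : Fin n => X (Fin.castLE hnN i) j with hM
  have hu : IsUnit M.det := isUnit_iff_ne_zero.2 h
  refine ⟨∑ i, (Matrix.vecMul z M⁻¹) i • Pi.single (Fin.castLE hnN i) 1, ?_⟩
  rw [map_sum]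
  simp only [map_smul, lfL_single]
  have h2 : Matrix.vecMul (Matrix.vecMul z M⁻¹) M = z := by
    rw [Matrix.vecMul_vecMul, Matrix.nonsing_inv_mul _ hu, Matrix.vecMul_one]
  conv_rhs => rw [← h2]
  ext i
  simp [Matrix.vecMul, dotProduct, hM]

lemma ae_surj {N n : ℕ} (hnN : n ≤ N) : ∀ᵐ X : Fin N → Fin n → ℝ, Function.Surjective (lfL X) := by
  set f : (Fin N → Fin n → ℝ) → ℝ := fun X => (Matrix.of fun i j : Fin n => X (Fin.castLE hnN i) j).det with hf
  have hfc : Continuous f := by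
    refine Continuous.matrix_det ?_
    refine continuous_matrix fun i j => ?_
    simp only [Matrix.of_apply]
    fun_prop
  suffices h : volume {X | f X = 0} = 0 by
    have : ∀ᵐ X, ¬ (f X = 0) := by
      rw [ae_iff]
      simpa using h
    filter_upwards [this] with X hX
    exact surj_of_det hnN X hX
  set E : Fin N → Fin n → ℝ := fun j i => if j = Fin.castLE hnN i then 1 else 0 with hE
  set S : Set (ℝ × (Fin N → Fin n → ℝ)) := {x | f (x.2 + x.1 • E) = 0} with hS
  have hSm : MeasurableSet S := by
    refine (isClosed_eq ?_ continuous_const).measurableSet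
    exact hfc.comp (by fun_prop)
  have h0 : (volume : Measure (ℝ × (Fin N → Fin n → ℝ))) S = 0 := by
    rw [Measure.volume_eq_prod, Measure.prod_apply_symm hSm]
    rw [lintegral_eq_zero_of_ae_eq_zero]
    refine Filter.Eventually.of_forall fun X => ?_
    refine Set.Finite.measure_zero ?_ _
    set M : Matrix (Fin n) (Fin n) ℝ := -(Matrix.of fun i j : Fin n => X (Fin.castLE hnN i) j) with hM
    refine (M.charpoly.roots.toFinset.finite_toSet).subset ?_
    intro t ht
    have ht' : f (X + t • E) = 0 := ht
    simp only [Finset.mem_coe, Multiset.mem_toFinset]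
    rw [Polynomial.mem_roots M.charpoly_monic.ne_zero, Polynomial.IsRoot, Matrix.eval_charpoly]
    rw [← ht', hf]
    simp only
    congr 1
    ext i j
    simp only [hM, hE, Matrix.sub_apply, Matrix.neg_apply, Matrix.of_apply, Pi.add_apply, Pi.smul_apply, smul_eq_mul,
      Matrix.scalar_apply, Matrix.diagonal_apply, (Fin.castLE_injective hnN).eq_iff]
    split_ifs <;> ring
  rw [Measure.volume_eq_prod] at h0
  have h1 := Measure.measure_ae_null_of_prod_null h0
  obtain ⟨t, ht⟩ := h1.exists
  have e : Prod.mk t ⁻¹' S = (fun X => X + t • E) ⁻¹' {X | f X = 0} := by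
    ext X; simp [hS]
  have ht2 : volume (Prod.mk t ⁻¹' S) = 0 := ht
  rw [e, measure_preimage_add_right] at ht2
  exact ht2

lemma mem_Om {N n : ℕ} (X : Fin N → Fin n → ℝ) (hX : ∀ j i, |X j i| ≤ 1/2)
    (hs : Function.Surjective (lfL X)) : ∃ κ, X ∈ Om N n κ := by
  by_cases h : N = n
  · subst h
    have hinj : Function.Injective (lfL X) := LinearMap.injective_iff_surjective.2 hs
    obtain ⟨K, -, hK⟩ := (lfL X).exists_antilipschitzWith (LinearMap.ker_eq_bot.2 hinj)
    refine ⟨⌈(K:ℝ)⌉₊, hX, fun _ v => ?_⟩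
    have h1 : ‖v‖ = ‖zr v‖ := by
      apply le_antisymm
      · rw [pi_norm_le_iff_of_nonneg (norm_nonneg _)]
        intro j
        have := norm_le_pi_norm (zr v) j
        rwa [zr, Real.norm_eq_abs, ← Int.norm_eq_abs] at this
      · rw [pi_norm_le_iff_of_nonneg (norm_nonneg _)]
        intro j
        have := norm_le_pi_norm v j
        rwa [Int.norm_eq_abs] at this
    have h2 : ‖zr v‖ ≤ K * ‖lf (zr v) X‖ := by
      have := hK.le_mul_dist (zr v) 0
      rwa [map_zero, dist_zero_right, dist_zero_right] at this
    rw [h1]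
    refine h2.trans ?_
    gcongr
    exact Nat.le_ceil _
  · exact ⟨0, hX, fun h' => absurd h' h⟩

/-- bad set -/
def bad {N n : ℕ} (a : ℕ → Fin n → ℝ) : Set ((Fin n → ℝ) × (Fin N → Fin n → ℝ)) :=
  {x | {rp : ℕ × (Fin N → ℤ) | rp.2 ∈ Ip N rp.1 ∧ x ∈ AA (a rp.1) (rp.1+1) rp.2}.Finite}

lemma measurableSet_bad {N n : ℕ} (a : ℕ → Fin n → ℝ) : MeasurableSet (bad (N := N) a) := by
  have : bad (N := N) a = ⋃ F : Finset (ℕ × (Fin N → ℤ)), ⋂ rp : ℕ × (Fin N → ℤ), ⋂ (_ : rp ∉ F ∧ rp.2 ∈ Ip N rp.1),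
      (AA (a rp.1) (rp.1+1) rp.2)ᶜ := by
    ext x
    simp only [Set.mem_iUnion, Set.mem_iInter, Set.mem_compl_iff]
    constructor
    · intro hx
      have hx' : {rp : ℕ × (Fin N → ℤ) | rp.2 ∈ Ip N rp.1 ∧ x ∈ AA (a rp.1) (rp.1+1) rp.2}.Finite := hx
      refine ⟨hx'.toFinset, fun rp h1 h2 => h1.1 ?_⟩
      rw [Set.Finite.mem_toFinset]
      exact ⟨h1.2, h2⟩
    · rintro ⟨F, hF⟩
      refine (F.finite_toSet).subset ?_
      rintro rp ⟨h1, h2⟩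
      by_contra h3
      exact hF rp ⟨h3, h1⟩ h2
  rw [this]
  refine MeasurableSet.iUnion fun F => MeasurableSet.iInter fun rp => MeasurableSet.iInter fun _ => ?_
  exact (isOpen_AA _ _ _).measurableSet.compl

lemma isClosed_img {N n : ℕ} : IsClosed {x : (Fin n → ℝ) × (Fin N → Fin n → ℝ) |
    ∃ ξ : Fin N → ℝ, ξ ∈ Metric.closedBall 0 1 ∧ - lf ξ x.2 = x.1} := by
  have : {x : (Fin n → ℝ) × (Fin N → Fin n → ℝ) | ∃ ξ : Fin N → ℝ, ξ ∈ Metric.closedBall 0 1 ∧ - lf ξ x.2 = x.1} =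
      Prod.snd '' {y : (Metric.closedBall (0 : Fin N → ℝ) 1) × ((Fin n → ℝ) × (Fin N → Fin n → ℝ)) |
        - lf (y.1 : Fin N → ℝ) y.2.2 = y.2.1} := by
    ext x
    simp only [Set.mem_image, Set.mem_ofPred_eq, Prod.exists]
    constructor
    · rintro ⟨ξ, h1, h2⟩
      exact ⟨⟨ξ, h1⟩, x.1, x.2, h2, rfl⟩
    · rintro ⟨ξ, z, X, h, rfl⟩
      exact ⟨ξ, ξ.2, h⟩
  rw [this]
  have hcpt : CompactSpace (Metric.closedBall (0 : Fin N → ℝ) 1) :=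
    isCompact_iff_compactSpace.1 (isCompact_closedBall 0 1)
  refine isClosedMap_snd_of_compactSpace _ (isClosed_eq ?_ (by fun_prop))
  have hc : Continuous (fun y : (Metric.closedBall (0 : Fin N → ℝ) 1) × ((Fin n → ℝ) × (Fin N → Fin n → ℝ)) =>
    ((y.1 : Fin N → ℝ), y.2.2)) := by fun_prop
  exact (continuous_lf.comp hc).neg

lemma ae_good (N n : ℕ) (hN : 2 ≤ N) (hn : 0 < n) (hnN : n ≤ N) (a : ℕ → Fin n → ℝ) (ha : ∀ r i, 0 < a r i)
    (hlim : ∀ i, Tendsto (fun r => a r i) atTop (nhds 0))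
    (hdiv : Tendsto (fun R => ∑ r ∈ Finset.range R, (∏ i, a r i) * ((r:ℝ)+1) ^ (N - n)) atTop atTop) :
    ∀ᵐ x : (Fin n → ℝ) × (Fin N → Fin n → ℝ), x.1 ∈ Metric.ball 0 (1/2) → x.2 ∈ Metric.closedBall 0 (1/2) →
      (∃ ξ : Fin N → ℝ, ξ ∈ Metric.closedBall 0 1 ∧ - lf ξ x.2 = x.1) → x ∉ bad a := by
  set T : Set ((Fin n → ℝ) × (Fin N → Fin n → ℝ)) := {x | x.1 ∈ Metric.ball 0 (1/2)} ∩
    ({x | x.2 ∈ Metric.closedBall 0 (1/2)} ∩ ({x | ∃ ξ : Fin N → ℝ, ξ ∈ Metric.closedBall 0 1 ∧ - lf ξ x.2 = x.1} ∩ bad a)) with hT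
  have hTm : MeasurableSet T := by
    refine MeasurableSet.inter ?_ (MeasurableSet.inter ?_ (MeasurableSet.inter isClosed_img.measurableSet (measurableSet_bad a)))
    · exact measurable_fst measurableSet_ball
    · exact measurable_snd measurableSet_closedBall
  suffices h : (volume : Measure ((Fin n → ℝ) × (Fin N → Fin n → ℝ))) T = 0 by
    have : ∀ᵐ x, x ∉ T := measure_eq_zero_iff_ae_notMem.1 h
    filter_upwards [this] with x hx h1 h2 h3 h4
    exact hx ⟨h1, h2, h3, h4⟩
  have hκ : ∀ κ : ℕ, ∀ᵐ X : Fin N → Fin n → ℝ, X ∈ Om N n κ → ∀ᵐ ξ ∂(volume.restrict (Metric.ball (0 : Fin N → ℝ) 1)),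
      - lf ξ X ∈ Metric.ball 0 (1/2) → (- lf ξ X, X) ∉ bad a := by
    intro κ
    have h1 : ∀ᵐ y ∂(nu N n κ), y ∉ bad a := measure_eq_zero_iff_ae_notMem.1 (nu_bad N n κ hN hn hnN a ha hlim hdiv)
    have h2 := ae_of_ae_map continuous_phi.measurable.aemeasurable h1
    have hm2 : MeasurableSet {x : (Fin N → ℝ) × (Fin N → Fin n → ℝ) | - lf x.1 x.2 ∈ Metric.ball (0 : Fin n → ℝ) (1/2)} :=
      (Metric.isOpen_ball.preimage continuous_lf.neg).measurableSet
    rw [ae_restrict_iff' hm2, ← Measure.prod_swap] at h2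
    have h3 := ae_of_ae_map measurable_swap.aemeasurable h2
    have h4 := Measure.ae_ae_of_ae_prod h3
    rw [ae_restrict_iff' (isClosed_Om N n κ).measurableSet] at h4
    exact h4
  rw [Measure.volume_eq_prod, Measure.prod_apply_symm hTm]
  rw [lintegral_eq_zero_of_ae_eq_zero]
  filter_upwards [ae_surj hnN, ae_all_iff.2 hκ] with X hX1 hX2
  by_cases hXc : X ∈ Metric.closedBall (0 : Fin N → Fin n → ℝ) (1/2)
  · have hXc' : ∀ j i, |X j i| ≤ 1/2 := by
      intro j i
      rw [mem_closedBall_zero_iff] at hXc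
      exact (norm_le_pi_norm (X j) i).trans ((norm_le_pi_norm X j).trans hXc)
    obtain ⟨κ, hκX⟩ := mem_Om X hXc' hX1
    have h3 := hX2 κ hκX
    set A : Set (Fin n → ℝ) := Metric.ball 0 (1/2) ∩ (fun z => (z, X)) ⁻¹' (bad a) with hA
    have hAm : MeasurableSet A := measurableSet_ball.inter (measurable_prodMk_right (measurableSet_bad a))
    have hs : Function.Surjective (-(lfL X)) := by
      intro z
      obtain ⟨ξ, hξ⟩ := hX1 (-z)
      exact ⟨ξ, by rw [LinearMap.neg_apply, hξ, neg_neg]⟩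
    have h4 := transfer_aux (-(lfL X)) hs A hAm (by
      rw [ae_iff, Measure.restrict_apply' measurableSet_ball] at h3
      refine measure_mono_null ?_ h3
      rintro ξ ⟨h5, h6, h7⟩
      refine ⟨?_, h5⟩
      simp only [Set.mem_ofPred_eq, not_forall, not_not]
      exact ⟨h6, h7⟩)
    refine measure_mono_null ?_ h4
    rintro z ⟨h5, h6, ⟨ξ, h7, h8⟩, h9⟩
    exact ⟨⟨h5, h9⟩, ξ, h7, h8⟩
  · have : (fun x => (x, X)) ⁻¹' T = ∅ := by
      rw [Set.eq_empty_iff_forall_notMem]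
      rintro z ⟨h5, h6, h7⟩
      exact hXc h6
    rw [this]; simp

lemma W0_of_good {N n : ℕ} (hnN : n ≤ N) (ψ : Fin n → ℝ → ℝ) (X : Fin (N+1) → Fin n → ℝ)
    (hXc : ∀ j i, -(1:ℝ)/2 < X j i ∧ X j i < 1/2)
    (hX : ∀ c : Fin (N+1), X c ∈ Metric.ball 0 (1/2) →
      (fun k => X (c.succAbove k)) ∈ Metric.closedBall 0 (1/2) →
      (∃ ξ : Fin N → ℝ, ξ ∈ Metric.closedBall 0 1 ∧ - lf ξ (fun k => X (c.succAbove k)) = X c) →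
      (X c, fun k => X (c.succAbove k)) ∉ bad (fun (r : ℕ) i => ψ i ((r:ℝ) + 1))) :
    X ∈ W0 (N+1) n ψ := by
  classical
  refine ⟨fun j i => ⟨(hXc j i).1.le, (hXc j i).2.le⟩, ?_⟩
  have hker : LinearMap.ker (lfL X) ≠ ⊥ := by
    apply LinearMap.ker_ne_bot_of_finrank_lt
    simp
    omega
  obtain ⟨η, hη, hη0⟩ := Submodule.exists_mem_ne_zero_of_ne_bot hker
  have hηX : lf η X = 0 := hη
  obtain ⟨c, -, hc⟩ := Finset.exists_max_image Finset.univ (fun j => |η j|) ⟨0, Finset.mem_univ _⟩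
  have hc0 : η c ≠ 0 := by
    intro h0
    apply hη0
    ext j
    have := hc j (Finset.mem_univ _)
    rw [h0, abs_zero] at this
    simpa using this
  have habs : ∀ j i, |X j i| < 1/2 := fun j i => abs_lt.2 ⟨by linarith [(hXc j i).1], (hXc j i).2⟩
  have h1 : X c ∈ Metric.ball (0 : Fin n → ℝ) (1/2) := by
    rw [mem_ball_zero_iff, pi_norm_lt_iff (by norm_num)]
    exact fun i => habs c i
  have h2 : (fun k => X (c.succAbove k)) ∈ Metric.closedBall (0 : Fin N → Fin n → ℝ) (1/2) := by
    rw [mem_closedBall_zero_iff, pi_norm_le_iff_of_nonneg (by norm_num)]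
    intro k
    rw [pi_norm_le_iff_of_nonneg (by norm_num)]
    exact fun i => (habs _ i).le
  have hbad := hX c h1 h2 ⟨fun k => η (c.succAbove k) / η c, by
    rw [mem_closedBall_zero_iff, pi_norm_le_iff_of_nonneg (by norm_num)]
    intro k
    rw [Real.norm_eq_abs, abs_div, div_le_one (abs_pos.2 hc0)]
    exact hc _ (Finset.mem_univ _), by
    ext i
    have h3 := congrFun hηX i
    rw [lf, Fin.sum_univ_succAbove _ c, Pi.zero_apply] at h3
    have h4 : ∑ k, η (c.succAbove k) / η c * X (c.succAbove k) i = (∑ k, η (c.succAbove k) * X (c.succAbove k) i) / η c := by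
      rw [Finset.sum_div]
      exact Finset.sum_congr rfl fun k _ => by ring
    rw [Pi.neg_apply, lf, h4]
    field_simp
    linarith⟩
  have hinf : {rp : ℕ × (Fin N → ℤ) | rp.2 ∈ Ip N rp.1 ∧ (X c, fun k => X (c.succAbove k)) ∈
      AA (fun i => ψ i ((rp.1:ℝ) + 1)) (rp.1+1) rp.2}.Infinite := hbad
  set g : ℕ × (Fin N → ℤ) → (Fin (N+1) → ℤ) := fun rp => Fin.insertNth (α := fun _ => ℤ) c ((rp.1 : ℤ) + 1) rp.2 with hg
  have hg1 : ∀ rp, g rp c = (rp.1 : ℤ) + 1 := fun rp => Fin.insertNth_apply_same (α := fun _ => ℤ) c _ _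
  have hg2 : ∀ rp k, g rp (c.succAbove k) = rp.2 k := fun rp k => Fin.insertNth_apply_succAbove (α := fun _ => ℤ) c _ _ k
  have hginj : Function.Injective g := by
    intro x y hxy
    refine Prod.ext ?_ ?_
    · have := congrFun hxy c
      rw [hg1, hg1] at this
      omega
    · ext k
      have := congrFun hxy (c.succAbove k)
      rwa [hg2, hg2] at this
  refine (hinf.image hginj.injOn).mono ?_
  rintro q ⟨rp, ⟨hp, hrp⟩, rfl⟩
  have hbox := (Finset.mem_filter.1 hp).1
  rw [mem_ibox] at hbox
  have hsup : supZ (g rp) = (rp.1 : ℝ) + 1 := by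
    unfold supZ
    apply le_antisymm
    · rw [pi_norm_le_iff_of_nonneg (by positivity)]
      intro j
      rw [Real.norm_eq_abs]
      rcases Fin.eq_self_or_eq_succAbove c j with rfl | ⟨k, rfl⟩
      · rw [hg1]
        push_cast
        rw [abs_of_nonneg (by positivity)]
      · rw [hg2]
        have := hbox k
        exact_mod_cast this
    · have := norm_le_pi_norm (fun i => ((g rp i : ℤ) : ℝ)) c
      simp only [hg1] at this
      push_cast at this
      rwa [Real.norm_eq_abs, abs_of_nonneg (by positivity)] at this
  refine ⟨?_, fun i => ?_⟩
  · intro h0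
    have := congrFun h0 c
    rw [hg1, Pi.zero_apply] at this
    omega
  · rw [hsup, Fin.sum_univ_succAbove _ c, hg1]
    simp only [hg2]
    have := hrp i
    simp only [lf, zr] at this
    push_cast at this ⊢
    exact this

theorem stmt1 (m n : ℕ) (hn : 0 < n) (hmn : n < m)
    (ψ : Fin n → ℝ → ℝ)
    (hpos : ∀ i, ∀ r > (0:ℝ), 0 < ψ i r)
    (hlim : ∀ i, Tendsto (ψ i) atTop (nhds 0))
    (hne : ¬ (m = 2 ∧ n = 1))
    (hdiv : ¬ Summable (fun r : ℕ =>
      (∏ i, ψ i ((r : ℝ) + 1)) * ((r : ℝ) + 1) ^ (m - n - 1))) :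
    volume (W0 m n ψ) = 1 := by
  obtain ⟨N, rfl⟩ : ∃ N, m = N + 1 := ⟨m - 1, by omega⟩
  have hnN : n ≤ N := by omega
  have hN : 2 ≤ N := by omega
  set a : ℕ → Fin n → ℝ := fun r i => ψ i ((r:ℝ) + 1) with ha
  have hap : ∀ r i, 0 < a r i := fun r i => hpos i _ (by positivity)
  have halim : ∀ i, Tendsto (fun r => a r i) atTop (nhds 0) := fun i =>
    (hlim i).comp (tendsto_atTop_add_const_right _ _ tendsto_natCast_atTop_atTop)
  have hexp : N + 1 - n - 1 = N - n := by omega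
  rw [hexp] at hdiv
  have hdiv2 : Tendsto (fun R => ∑ r ∈ Finset.range R, (∏ i, a r i) * ((r:ℝ)+1) ^ (N - n)) atTop atTop := by
    refine (not_summable_iff_tendsto_nat_atTop_of_nonneg fun r => ?_).1 hdiv
    have := Finset.prod_pos fun i (_ : i ∈ Finset.univ) => hap r i
    exact mul_nonneg this.le (by positivity)
  have hgood := ae_good N n hN hn hnN a hap halim hdiv2
  have hae : ∀ᵐ X : Fin (N+1) → Fin n → ℝ, ∀ c : Fin (N+1), _ := ae_all_iff.2 fun c =>
    (volume_preserving_piFinSuccAbove (fun _ : Fin (N+1) => (Fin n → ℝ)) c).quasiMeasurePreserving.ae hgood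
  apply le_antisymm
  · calc volume (W0 (N+1) n ψ) ≤ volume (Set.pi Set.univ fun _ : Fin (N+1) => Set.pi Set.univ fun _ : Fin n => Set.Icc (-(1:ℝ)/2) (1/2)) := by
          refine measure_mono ?_
          intro X hX j _ i _
          exact hX.1 j i
      _ = 1 := by
          rw [volume_pi_pi]
          have : volume (Set.pi Set.univ fun _ : Fin n => Set.Icc (-(1:ℝ)/2) (1/2)) = 1 := by
            rw [volume_pi_pi]
            simp only [Real.volume_Icc]
            norm_num
          simp only [this]
          simp
  · have hvol : volume (Set.pi Set.univ fun _ : Fin (N+1) => Set.pi Set.univ fun _ : Fin n => Set.Ioo (-(1:ℝ)/2) (1/2)) = 1 := by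
      rw [volume_pi_pi]
      have : volume (Set.pi Set.univ fun _ : Fin n => Set.Ioo (-(1:ℝ)/2) (1/2)) = 1 := by
        rw [volume_pi_pi]
        simp only [Real.volume_Ioo]
        norm_num
      simp only [this]
      simp
    rw [← hvol]
    refine measure_mono_ae ?_
    filter_upwards [hae] with X hX hXc
    have hXc' : ∀ j i, -(1:ℝ)/2 < X j i ∧ X j i < 1/2 := fun j i => hXc j (Set.mem_univ _) i (Set.mem_univ _)
    exact W0_of_good hnN ψ X hXc' hX
end

section
/- Let m = 2, n = 1, and let ψ : (0,∞) → (0,∞) be a monotonically decreasing function tending to zero at infinity. If the series ∑_{r=1}^∞ ψ(r) diverges, then the set W₀(2,1,ψ) has 2-dimensional Lebesgue measure 1, i.e. full measure in [−1/2,1/2]². -/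
open MeasureTheory Filter

lemma kh_CE {X ι : Type*} [MeasurableSpace X] (μ : Measure X) [IsFiniteMeasure μ]
    (s : Finset ι) (B : ι → Set X) (hB : ∀ i, MeasurableSet (B i)) (t : ℝ) :
    2 * t * ∑ i ∈ s, μ.real (B i) - t ^ 2 * ∑ i ∈ s, ∑ j ∈ s, μ.real (B i ∩ B j)
      ≤ μ.real (⋃ i ∈ s, B i) := by
  classical
  have hU : MeasurableSet (⋃ i ∈ s, B i) := Finset.measurableSet_biUnion s fun i _ => hB i
  have key : ∀ x, 2 * t * ∑ i ∈ s, (B i).indicator (fun _ => (1:ℝ)) x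
      - t ^ 2 * ∑ i ∈ s, ∑ j ∈ s, (B i ∩ B j).indicator (fun _ => (1:ℝ)) x
      ≤ (⋃ i ∈ s, B i).indicator (fun _ => (1:ℝ)) x := by
    intro x
    have h1 : ∑ i ∈ s, ∑ j ∈ s, (B i ∩ B j).indicator (fun _ => (1:ℝ)) x
        = (∑ i ∈ s, (B i).indicator (fun _ => (1:ℝ)) x) ^ 2 := by
      rw [sq, Finset.sum_mul_sum]
      refine Finset.sum_congr rfl fun i _ => Finset.sum_congr rfl fun j _ => ?_
      by_cases hi : x ∈ B i <;> by_cases hj : x ∈ B j <;> simp [hi, hj]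
    rw [h1]
    by_cases hx : x ∈ ⋃ i ∈ s, B i
    · rw [Set.indicator_of_mem hx]
      nlinarith [sq_nonneg (1 - t * ∑ i ∈ s, (B i).indicator (fun _ => (1:ℝ)) x)]
    · rw [Set.indicator_of_notMem hx]
      have : ∑ i ∈ s, (B i).indicator (fun _ => (1:ℝ)) x = 0 := by
        refine Finset.sum_eq_zero fun i hi => Set.indicator_of_notMem ?_ _
        intro h
        exact hx (Set.mem_biUnion (s := (s : Set ι)) hi h)
      rw [this]; simp
  have hint : ∀ A : Set X, MeasurableSet A → Integrable (A.indicator (fun _ => (1:ℝ))) μ :=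
    fun A hA => (integrable_const 1).indicator hA
  have hval : ∀ A : Set X, MeasurableSet A → ∫ x, A.indicator (fun _ => (1:ℝ)) x ∂μ = μ.real A := by
    intro A hA
    rw [integral_indicator hA]; simp
  have i1 : Integrable (fun x => ∑ i ∈ s, (B i).indicator (fun _ => (1:ℝ)) x) μ :=
    integrable_finsetSum _ fun i _ => hint _ (hB i)
  have i2' : ∀ i, Integrable (fun x => ∑ j ∈ s, (B i ∩ B j).indicator (fun _ => (1:ℝ)) x) μ :=
    fun i => integrable_finsetSum _ fun j _ => hint _ ((hB i).inter (hB j))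
  have i2 : Integrable (fun x => ∑ i ∈ s, ∑ j ∈ s, (B i ∩ B j).indicator (fun _ => (1:ℝ)) x) μ :=
    integrable_finsetSum _ fun i _ => i2' i
  have := integral_mono ((i1.const_mul (2*t)).sub (i2.const_mul (t^2))) (hint _ hU) key
  rw [integral_sub' (i1.const_mul _) (i2.const_mul _), integral_const_mul, integral_const_mul,
    integral_finsetSum _ (fun i _ => hint _ (hB i)), integral_finsetSum _ (fun i _ => i2' i),
    hval _ hU] at this
  have e1 : ∑ i ∈ s, ∫ x, (B i).indicator (fun _ => (1:ℝ)) x ∂μ = ∑ i ∈ s, μ.real (B i) :=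
    Finset.sum_congr rfl fun i _ => hval _ (hB i)
  have e2 : ∑ i ∈ s, ∫ x, ∑ j ∈ s, (B i ∩ B j).indicator (fun _ => (1:ℝ)) x ∂μ
      = ∑ i ∈ s, ∑ j ∈ s, μ.real (B i ∩ B j) := by
    refine Finset.sum_congr rfl fun i _ => ?_
    rw [integral_finsetSum _ (fun j _ => hint _ ((hB i).inter (hB j)))]
    exact Finset.sum_congr rfl fun j _ => hval _ ((hB i).inter (hB j))
  rw [e1, e2] at this
  exact this

lemma kh_tot (N : ℕ) :
    (0:ℝ) ≤ ∑ k ∈ Finset.range N, (((k+1).totient : ℝ) / ((k:ℝ)+1) - 1/2) := by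
  have h1 : ∀ n < N, n + 1 = ∑ d ∈ Finset.range N, if (d+1) ∣ (n+1) then (d+1).totient else 0 := by
    intro n hn
    conv_lhs => rw [← Nat.sum_totient (n+1)]
    rw [← Finset.sum_filter]
    refine Finset.sum_bij' (fun d _ => d - 1) (fun d _ => d + 1) ?_ ?_ ?_ ?_ ?_
    · intro d hd
      have hp := Nat.pos_of_mem_divisors hd
      have hdv := Nat.dvd_of_mem_divisors hd
      have := Nat.le_of_dvd (by omega) hdv
      simp only [Finset.mem_filter, Finset.mem_range]
      refine ⟨by omega, ?_⟩
      rwa [Nat.sub_add_cancel hp]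
    · intro d hd
      simp only [Finset.mem_filter, Finset.mem_range] at hd
      simp [hd.2]
    · intro d hd
      exact Nat.sub_add_cancel (Nat.pos_of_mem_divisors hd)
    · intro d hd; simp
    · intro d hd
      rw [Nat.sub_add_cancel (Nat.pos_of_mem_divisors hd)]
  have h2 : ∑ n ∈ Finset.range N, (n+1) = ∑ d ∈ Finset.range N, (d+1).totient * (N / (d+1)) := by
    rw [Finset.sum_congr rfl fun n hn => h1 n (Finset.mem_range.1 hn), Finset.sum_comm]
    refine Finset.sum_congr rfl fun d _ => ?_
    rw [← Finset.sum_filter, Finset.sum_const, Nat.card_multiples, smul_eq_mul, mul_comm]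
  have h3 : (∑ n ∈ Finset.range N, ((n:ℝ)+1)) ≤ N * ∑ d ∈ Finset.range N, ((d+1).totient : ℝ) / ((d:ℝ)+1) := by
    have : (∑ n ∈ Finset.range N, ((n:ℝ)+1)) = ∑ d ∈ Finset.range N, ((d+1).totient : ℝ) * ((N / (d+1) : ℕ) : ℝ) := by
      exact_mod_cast h2
    rw [this, Finset.mul_sum]
    refine Finset.sum_le_sum fun d _ => ?_
    have : ((N / (d+1) : ℕ) : ℝ) ≤ (N:ℝ) / ((d:ℝ)+1) := by
      have := @Nat.cast_div_le ℝ _ _ _ N (d+1)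
      push_cast at this; exact this
    calc _ ≤ ((d+1).totient : ℝ) * ((N:ℝ) / ((d:ℝ)+1)) := by gcongr
      _ = _ := by ring
  have h4 : (∑ n ∈ Finset.range N, ((n:ℝ)+1)) = N * (N+1) / 2 := by
    clear h1 h2 h3
    induction N with
    | zero => simp
    | succ k ih => rw [Finset.sum_range_succ, ih]; push_cast; ring
  rw [Finset.sum_sub_distrib]
  simp only [Finset.sum_const, Finset.card_range, nsmul_eq_mul]
  rcases Nat.eq_zero_or_pos N with rfl | hN
  · simp
  have hN' : (0:ℝ) < N := by exact_mod_cast hN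
  rw [h4] at h3
  have : ((N:ℝ)+1)/2 ≤ ∑ d ∈ Finset.range N, ((d+1).totient : ℝ) / ((d:ℝ)+1) := by
    refine le_of_mul_le_mul_left ?_ hN'
    linarith
  linarith

lemma kh_abel (f c : ℕ → ℝ) (hf : Antitone f) (hc : ∀ N, 0 ≤ ∑ k ∈ Finset.range N, c k) (N : ℕ) :
    f N * ∑ k ∈ Finset.range N, c k ≤ ∑ k ∈ Finset.range N, f k * c k := by
  induction N with
  | zero => simp
  | succ n ih =>
    have := mul_le_mul_of_nonneg_right (hf (Nat.le_succ n)) (hc (n+1))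
    refine this.trans ?_
    rw [Finset.sum_range_succ, Finset.sum_range_succ]
    linarith

lemma kh_T_card (n : ℕ) (hn : 0 < n) (S : Finset UnitAddCircle) (hS : ∀ x ∈ S, n • x = 0) :
    S.card ≤ n := by
  classical
  have : S ⊆ (Finset.range n).image (fun m : ℕ => (((m:ℝ)/n * 1 : ℝ) : UnitAddCircle)) := by
    intro x hx
    obtain ⟨m, hm, h⟩ := (AddCircle.nsmul_eq_zero_iff hn).1 (hS x hx)
    exact Finset.mem_image.2 ⟨m, Finset.mem_range.2 hm, h⟩
  simpa using (Finset.card_le_card this).trans Finset.card_image_le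

lemma kh_T_near (L : ℕ) (hL : 0 < L) (η : ℝ) (hη : 0 ≤ η) (S : Finset UnitAddCircle)
    (hS : ∀ x ∈ S, L • x = 0 ∧ x ≠ 0 ∧ ‖x‖ ≤ η) : (S.card : ℝ) ≤ 2 * (η * L) := by
  classical
  have hL' : (0:ℝ) < L := by exact_mod_cast hL
  set K := ⌊η * L⌋₊ with hK
  have : S ⊆ (Finset.Icc 1 K).image (fun m : ℕ => (((m:ℝ)/L * 1 : ℝ) : UnitAddCircle)) ∪
     (Finset.Icc 1 K).image (fun m : ℕ => ((((L - m : ℕ):ℝ)/L * 1 : ℝ) : UnitAddCircle)) := by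
    intro x hx
    obtain ⟨h0, hne, hno⟩ := hS x hx
    obtain ⟨m, hm, rfl⟩ := (AddCircle.nsmul_eq_zero_iff hL).1 h0
    rw [AddCircle.norm_div_natCast, Nat.mod_eq_of_lt hm, one_mul, div_le_iff₀ hL'] at hno
    have hm0 : m ≠ 0 := by
      rintro rfl
      simp at hne
    have hmin : min m (L - m) ≤ K := Nat.le_floor hno
    rw [Finset.mem_union]
    rcases le_total m (L - m) with h | h
    · left
      rw [min_eq_left h] at hmin
      exact Finset.mem_image.2 ⟨m, Finset.mem_Icc.2 ⟨by omega, hmin⟩, rfl⟩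
    · right
      rw [min_eq_right h] at hmin
      refine Finset.mem_image.2 ⟨L - m, Finset.mem_Icc.2 ⟨by omega, hmin⟩, ?_⟩
      rw [Nat.sub_sub_self hm.le]
  have h2 := (Finset.card_le_card this).trans ((Finset.card_union_le _ _).trans
    (add_le_add Finset.card_image_le Finset.card_image_le))
  simp only [Nat.card_Icc, Nat.add_sub_cancel] at h2
  have h3 : (K:ℝ) ≤ η * L := Nat.floor_le (by positivity)
  have h4 : (S.card:ℝ) ≤ K + K := by exact_mod_cast h2
  linarith

lemma kh_pairs (q r : ℕ) (hq : 0 < q) (hr : 0 < r) (η : ℝ) (hη : 0 ≤ η)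
    (P : Finset (UnitAddCircle × UnitAddCircle))
    (hP : ∀ p ∈ P, q • p.1 = 0 ∧ r • p.2 = 0 ∧ p.1 ≠ p.2 ∧ ‖p.1 - p.2‖ ≤ η) :
    (P.card : ℝ) ≤ 2 * η * q * r := by
  classical
  have h1 : P.card ≤ Nat.gcd q r * (P.image (fun p => p.1 - p.2)).card := by
    refine Finset.card_le_mul_card_image P _ ?_
    intro d hd
    obtain ⟨p0, hp0, rfl⟩ := Finset.mem_image.1 hd
    have hinj : Set.InjOn (fun p : UnitAddCircle × UnitAddCircle => p.1 - p0.1)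
        ({a ∈ P | a.1 - a.2 = p0.1 - p0.2} : Finset _) := by
      intro a ha b hb hab
      simp only [Finset.coe_filter, Set.mem_ofPred_eq] at ha hb
      have h1 : a.1 = b.1 := by simpa using hab
      have h2 : a.2 = b.2 := by
        have := ha.2.trans hb.2.symm
        rw [h1] at this
        simpa using this
      exact Prod.ext h1 h2
    rw [← Finset.card_image_of_injOn hinj]
    refine kh_T_card _ (Nat.gcd_pos_of_pos_left _ hq) _ ?_
    intro x hx
    obtain ⟨a, ha, rfl⟩ := Finset.mem_image.1 hx
    rw [Finset.mem_filter] at ha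
    have e : a.1 - p0.1 = a.2 - p0.2 := by
      have := ha.2
      rw [sub_eq_sub_iff_add_eq_add] at this ⊢
      rw [this]; abel
    rw [← addOrderOf_dvd_iff_nsmul_eq_zero]
    refine Nat.dvd_gcd ?_ ?_
    · rw [addOrderOf_dvd_iff_nsmul_eq_zero, nsmul_sub, (hP a ha.1).1, (hP p0 hp0).1, sub_zero]
    · rw [addOrderOf_dvd_iff_nsmul_eq_zero]
      show r • (a.1 - p0.1) = 0
      rw [e, nsmul_sub, (hP a ha.1).2.1, (hP p0 hp0).2.1, sub_zero]
  have h2 : ((P.image (fun p => p.1 - p.2)).card : ℝ) ≤ 2 * (η * (Nat.lcm q r : ℕ)) := by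
    refine kh_T_near _ (Nat.lcm_pos hq hr) η hη _ ?_
    intro x hx
    obtain ⟨a, ha, rfl⟩ := Finset.mem_image.1 hx
    obtain ⟨e1, e2, e3, e4⟩ := hP a ha
    refine ⟨?_, sub_ne_zero.2 e3, e4⟩
    obtain ⟨u, hu⟩ := Nat.dvd_lcm_left q r
    obtain ⟨v, hv⟩ := Nat.dvd_lcm_right q r
    rw [nsmul_sub]
    have : Nat.lcm q r • a.1 = 0 := by rw [hu, mul_comm, mul_nsmul', e1, nsmul_zero]
    rw [this]
    have : Nat.lcm q r • a.2 = 0 := by rw [hv, mul_comm, mul_nsmul', e2, nsmul_zero]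
    rw [this, sub_zero]
  have h3 : (Nat.gcd q r : ℝ) * (Nat.lcm q r : ℕ) = q * r := by exact_mod_cast Nat.gcd_mul_lcm q r
  have h4 : (P.card : ℝ) ≤ Nat.gcd q r * ((P.image (fun p => p.1 - p.2)).card : ℝ) := by
    exact_mod_cast h1
  calc (P.card : ℝ) ≤ Nat.gcd q r * (2 * (η * (Nat.lcm q r : ℕ))) := h4.trans (by gcongr)
    _ = 2 * η * (Nat.gcd q r * (Nat.lcm q r : ℕ)) := by ring
    _ = _ := by rw [h3]; ring

noncomputable def khF (k : ℕ) : Finset UnitAddCircle :=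
  (AddCircle.finite_setOfPred_addOrderOf_eq (1:ℝ) (Nat.succ_pos k)).toFinset

lemma mem_khF {k : ℕ} {b : UnitAddCircle} : b ∈ khF k ↔ addOrderOf b = k + 1 := by
  simp [khF]

lemma card_khF (k : ℕ) : (khF k).card = (k+1).totient := by
  rw [← AddCircle.card_addOrderOf_eq_totient (p := (1:ℝ)), khF,
    ← Set.ncard_eq_toFinset_card _ (AddCircle.finite_setOfPred_addOrderOf_eq (1:ℝ) (Nat.succ_pos k))]
  rfl

lemma kh_vol (b : UnitAddCircle) (e : ℝ) (he : 0 ≤ e) (he1 : e ≤ 1) :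
    (volume : Measure UnitAddCircle).real (Metric.closedBall b (e/2)) = e := by
  rw [Measure.real, AddCircle.volume_closedBall, ENNReal.toReal_ofReal]
  · rw [min_eq_right] <;> linarith
  · exact le_min zero_le_one (by linarith)

lemma kh_inner (k l : ℕ) (d e : ℝ) (hd : 0 ≤ d) (he : 0 ≤ e) (hd1 : d ≤ 1) (he1 : e ≤ 1) :
    ∑ b ∈ khF k, ∑ c ∈ khF l, (volume : Measure UnitAddCircle).real
      (Metric.closedBall b (d/2) ∩ Metric.closedBall c (e/2)) ≤
    (if k = l then ((k+1).totient : ℝ) * d else 0) + 2 * (d * (k+1)) * (e * (l+1)) := by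
  classical
  have h1 : ∀ b ∈ khF k, ∀ c ∈ khF l, (volume : Measure UnitAddCircle).real
      (Metric.closedBall b (d/2) ∩ Metric.closedBall c (e/2)) ≤
      (if b = c then (if k = l then d else 0) else 0) +
      (if b ≠ c ∧ ‖b - c‖ ≤ max d e then min d e else 0) := by
    intro b hb c hc
    rw [mem_khF] at hb hc
    have m1 := measureReal_mono (μ := (volume : Measure UnitAddCircle))
      (Set.inter_subset_left (s := Metric.closedBall b (d/2)) (t := Metric.closedBall c (e/2)))
    have m2 := measureReal_mono (μ := (volume : Measure UnitAddCircle))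
      (Set.inter_subset_right (s := Metric.closedBall b (d/2)) (t := Metric.closedBall c (e/2)))
    rw [kh_vol _ _ hd hd1] at m1
    rw [kh_vol _ _ he he1] at m2
    by_cases hbc : b = c
    · have hkl : k = l := by rw [hbc] at hb; omega
      simp only [hbc, hkl, if_true, ne_eq, not_true, false_and, if_false, add_zero]
      rwa [hbc] at m1
    · simp only [hbc, if_false, ne_eq, not_false_eq_true, true_and, zero_add]
      split_ifs with hn
      · exact le_min m1 m2
      · have : Metric.closedBall b (d/2) ∩ Metric.closedBall c (e/2) = ∅ := by
          rw [Set.eq_empty_iff_forall_notMem]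
          rintro x ⟨hx1, hx2⟩
          apply hn
          rw [← dist_eq_norm]
          have := dist_triangle_left b c x
          rw [Metric.mem_closedBall] at hx1 hx2
          have := le_max_left d e
          have := le_max_right d e
          linarith
        rw [this]; simp
  have h2 := Finset.sum_le_sum fun b hb => Finset.sum_le_sum (h1 b hb)
  refine h2.trans ?_
  simp only [Finset.sum_add_distrib]
  refine add_le_add ?_ ?_
  · rw [← card_khF, ← nsmul_eq_mul]
    split_ifs with hkl
    · rw [← Finset.sum_const]
      refine Finset.sum_le_sum fun b _ => ?_
      rw [Finset.sum_ite_eq]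
      split_ifs <;> simp [hd]
    · simp
  · rw [← Finset.sum_product', ← Finset.sum_filter, Finset.sum_const, nsmul_eq_mul]
    have := kh_pairs (k+1) (l+1) (by omega) (by omega) (max d e) (le_max_of_le_left hd)
      ({p ∈ khF k ×ˢ khF l | p.1 ≠ p.2 ∧ ‖p.1 - p.2‖ ≤ max d e}) (by
        intro p hp
        simp only [Finset.mem_filter, Finset.mem_product, mem_khF] at hp
        obtain ⟨⟨a1, a2⟩, a3, a4⟩ := hp
        refine ⟨?_, ?_, a3, a4⟩
        · rw [← a1]; exact addOrderOf_nsmul_eq_zero _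
        · rw [← a2]; exact addOrderOf_nsmul_eq_zero _)
    push_cast at this
    calc _ ≤ (2 * max d e * (k+1) * (l+1)) * min d e := by
            refine mul_le_mul_of_nonneg_right this (le_min hd he)
      _ = 2 * (max d e * min d e) * (k+1) * (l+1) := by ring
      _ = _ := by rw [max_mul_min]; ring
      _ ≤ _ := le_rfl

lemma kh_union (f : ℕ → ℝ) (hf : Antitone f) (hpos : ∀ k, 0 < f k) (hdiv : ¬ Summable f)
    (M : ℕ) (hM : ∀ k ≥ M, f k ≤ 1) :
    1/33 ≤ (volume : Measure UnitAddCircle).real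
      (⋃ k ≥ M, approxAddOrderOf UnitAddCircle (k+1) (f k / (k+1))) := by
  classical
  have hT : Tendsto (fun N => ∑ k ∈ Finset.range N, f k) atTop atTop :=
    (not_summable_iff_tendsto_nat_atTop_of_nonneg fun k => (hpos k).le).1 hdiv
  set Q := ∑ k ∈ Finset.range M, f k with hQ
  obtain ⟨N, hMN, hN⟩ := ((eventually_ge_atTop M).and (hT.eventually_ge_atTop (4 * Q + 4))).exists
  set Ψ := ∑ k ∈ Finset.range N, f k with hΨ
  have hQ0 : 0 ≤ Q := Finset.sum_nonneg fun k _ => (hpos k).le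
  set δ : ℕ → ℝ := fun k => f k / (k+1) with hδ
  have hδ0 : ∀ k, 0 < δ k := fun k => by have := hpos k; positivity
  have hδ1 : ∀ k ≥ M, δ k ≤ 1 := fun k hk => by
    refine (div_le_self (hpos k).le ?_).trans (hM k hk)
    have : (0:ℝ) ≤ k := by positivity
    linarith
  have hδf : ∀ k, δ k * (k+1) = f k := fun k => by
    have : ((k:ℝ)+1) ≠ 0 := by positivity
    simp [hδ, this]
  set S := ∑ k ∈ Finset.Ico M N, ((k+1).totient : ℝ) * δ k with hS
  have hab : Ψ / 2 ≤ ∑ k ∈ Finset.range N, ((k+1).totient : ℝ) * δ k := by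
    have h1 := kh_abel f _ hf kh_tot N
    have h2 := mul_nonneg (hpos N).le (kh_tot N)
    have h3 := h2.trans h1
    simp only [mul_sub, Finset.sum_sub_distrib] at h3
    rw [← Finset.sum_mul] at h3
    have : ∑ k ∈ Finset.range N, f k * (((k+1).totient : ℝ) / ((k:ℝ)+1)) =
        ∑ k ∈ Finset.range N, ((k+1).totient : ℝ) * δ k :=
      Finset.sum_congr rfl fun k _ => by simp only [hδ]; ring
    rw [this] at h3
    linarith
  have hsmall : ∑ k ∈ Finset.range M, ((k+1).totient : ℝ) * δ k ≤ Q := by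
    refine Finset.sum_le_sum fun k _ => ?_
    have : (((k+1).totient : ℕ) : ℝ) ≤ (k:ℝ)+1 := by exact_mod_cast Nat.totient_le (k+1)
    calc _ ≤ ((k:ℝ)+1) * δ k := mul_le_mul_of_nonneg_right this (hδ0 k).le
      _ = f k := by rw [mul_comm, hδf]
  have hsplit := Finset.sum_range_add_sum_Ico (fun k => ((k+1).totient : ℝ) * δ k) hMN
  have hSΨ : Ψ / 4 ≤ S := by linarith
  have hS1 : 1 ≤ S := by linarith
  have hIco : ∑ k ∈ Finset.Ico M N, f k ≤ Ψ := by
    have := Finset.sum_range_add_sum_Ico f hMN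
    linarith
  have hIco0 : 0 ≤ ∑ k ∈ Finset.Ico M N, f k := Finset.sum_nonneg fun k _ => (hpos k).le
  let B : (Σ _ : ℕ, UnitAddCircle) → Set UnitAddCircle := fun i => Metric.closedBall i.2 (δ i.1 / 2)
  have hce := kh_CE (volume : Measure UnitAddCircle) ((Finset.Ico M N).sigma khF) B
    (fun i => Metric.isClosed_closedBall.measurableSet) (1 / (33 * S))
  have e1 : ∑ i ∈ (Finset.Ico M N).sigma khF, (volume : Measure UnitAddCircle).real (B i) = S := by
    rw [Finset.sum_sigma]
    refine Finset.sum_congr rfl fun k hk => ?_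
    rw [Finset.sum_congr rfl fun b _ => kh_vol b (δ k) (hδ0 k).le (hδ1 k (Finset.mem_Ico.1 hk).1),
      Finset.sum_const, card_khF, nsmul_eq_mul]
  have e2 : ∑ i ∈ (Finset.Ico M N).sigma khF, ∑ j ∈ (Finset.Ico M N).sigma khF,
      (volume : Measure UnitAddCircle).real (B i ∩ B j) ≤ 33 * S ^ 2 := by
    have : ∑ i ∈ (Finset.Ico M N).sigma khF, ∑ j ∈ (Finset.Ico M N).sigma khF,
      (volume : Measure UnitAddCircle).real (B i ∩ B j) = ∑ k ∈ Finset.Ico M N,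
        ∑ l ∈ Finset.Ico M N, ∑ b ∈ khF k, ∑ c ∈ khF l, (volume : Measure UnitAddCircle).real
          (Metric.closedBall b (δ k/2) ∩ Metric.closedBall c (δ l/2)) := by
      rw [Finset.sum_sigma]
      refine Finset.sum_congr rfl fun k hk => ?_
      simp only [Finset.sum_sigma]
      rw [Finset.sum_comm]
    rw [this]
    calc _ ≤ ∑ k ∈ Finset.Ico M N, ∑ l ∈ Finset.Ico M N,
          ((if k = l then ((k+1).totient : ℝ) * δ k else 0) + 2 * f k * f l) := by
            refine Finset.sum_le_sum fun k hk => Finset.sum_le_sum fun l hl => ?_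
            have := kh_inner k l (δ k) (δ l) (hδ0 k).le (hδ0 l).le (hδ1 k (Finset.mem_Ico.1 hk).1)
              (hδ1 l (Finset.mem_Ico.1 hl).1)
            rwa [hδf, hδf] at this
      _ = S + 2 * (∑ k ∈ Finset.Ico M N, f k) ^ 2 := by
            simp only [Finset.sum_add_distrib]
            congr 1
            · refine Finset.sum_congr rfl fun k hk => ?_
              rw [Finset.sum_ite_eq, if_pos hk]
            · rw [sq, Finset.sum_mul_sum, Finset.mul_sum]
              refine Finset.sum_congr rfl fun k _ => ?_
              rw [Finset.mul_sum]
              exact Finset.sum_congr rfl fun l _ => by ring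
      _ ≤ S + 2 * (4 * S) ^ 2 := by
            gcongr
            linarith
      _ ≤ _ := by nlinarith
  rw [e1] at hce
  have h33 : (1:ℝ)/33 ≤ (volume : Measure UnitAddCircle).real
      (⋃ i ∈ (Finset.Ico M N).sigma khF, B i) := by
    refine le_trans ?_ hce
    have : (1 / (33 * S)) ^ 2 * ∑ i ∈ (Finset.Ico M N).sigma khF,
      ∑ j ∈ (Finset.Ico M N).sigma khF,
      (volume : Measure UnitAddCircle).real (B i ∩ B j) ≤ (1 / (33 * S)) ^ 2 * (33 * S ^ 2) := by
      gcongr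
    have hS0 : S ≠ 0 := by linarith
    have q1 : (1 / (33 * S)) ^ 2 * (33 * S ^ 2) = 1/33 := by field_simp
    have q2 : 2 * (1 / (33 * S)) * S = 2/33 := by field_simp
    rw [q2]; linarith
  refine h33.trans (measureReal_mono ?_ (measure_ne_top _ _))
  refine Set.iUnion₂_subset fun i hi => ?_
  rw [Finset.mem_sigma, Finset.mem_Ico, mem_khF] at hi
  intro x hx
  refine Set.mem_iUnion₂.2 ⟨i.1, hi.1.1, ?_⟩
  rw [mem_approx_add_orderOf_iff]
  refine ⟨i.2, hi.2, ?_⟩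
  have := hδ0 i.1
  exact lt_of_le_of_lt (Metric.mem_closedBall.1 hx) (by simp only [hδ] at this ⊢; linarith)

lemma kh_circle (f : ℕ → ℝ) (hf : Antitone f) (hpos : ∀ k, 0 < f k) (hdiv : ¬ Summable f)
    (hlim : Tendsto f atTop (nhds 0)) (δ : ℕ → ℝ) (hδ : ∀ k, δ (k+1) = f k / (k+1)) :
    ∀ᵐ x : UnitAddCircle, x ∈ addWellApproximable UnitAddCircle δ := by
  have hδlim : Tendsto δ atTop (nhds 0) := by
    rw [← tendsto_add_atTop_iff_nat 1]
    refine squeeze_zero (fun k => ?_) (fun k => ?_) hlim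
    · rw [hδ]; have := hpos k; positivity
    · rw [hδ]
      refine div_le_self (hpos k).le ?_
      have : (0:ℝ) ≤ k := by positivity
      linarith
  rcases AddCircle.addWellApproximable_ae_empty_or_univ (T := (1:ℝ)) δ hδlim with h | h
  · exfalso
    let V : ℕ → Set UnitAddCircle := fun M =>
      ⋃ k ≥ M, approxAddOrderOf UnitAddCircle (k+1) (f k / (k+1))
    have hanti : Antitone V := by
      intro a b hab
      exact Set.iUnion₂_subset fun k hk => Set.subset_iUnion₂_of_subset k (hab.trans hk) subset_rfl
    have hopen : ∀ M, IsOpen (V M) := fun M =>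
      isOpen_iUnion fun k => isOpen_iUnion fun _ => Metric.isOpen_thickening
    have ht := tendsto_measure_iInter_atTop (μ := (volume : Measure UnitAddCircle)) (s := V)
      (fun M => (hopen M).measurableSet.nullMeasurableSet) hanti ⟨0, measure_ne_top _ _⟩
    have h0 : (volume : Measure UnitAddCircle) (⋂ M, V M) = 0 := by
      refine measure_mono_null ?_ h
      intro x hx
      simp only [Set.mem_compl_iff, Set.mem_ofPred_eq, not_not]
      rw [mem_add_wellApproximable_iff, blimsup_eq_iInf_biSup_of_nat]
      simp only [Set.iInf_eq_iInter, Set.iSup_eq_iUnion, Set.mem_iInter, Set.mem_iUnion]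
      intro a
      obtain ⟨k, hk, hx⟩ := Set.mem_iUnion₂.1 (Set.mem_iInter.1 hx a)
      refine ⟨k+1, ⟨by omega, by omega⟩, ?_⟩
      rw [hδ]; exact hx
    rw [h0] at ht
    obtain ⟨M, hM1, hM2⟩ := ((hlim.eventually_le_const (zero_lt_one)).and
      (ht.eventually_lt_const (u := ENNReal.ofReal (1/33)) (by simp))).exists
    have hu := kh_union f hf hpos hdiv M fun k hk => (hf hk).trans hM1
    have := (ENNReal.ofReal_le_iff_le_toReal (measure_ne_top _ _)).2 hu
    exact absurd hM2 (not_lt.2 this)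
  · exact h

lemma kh_real {P : UnitAddCircle → Prop} (h : ∀ᵐ x : UnitAddCircle, P x) :
    ∀ᵐ x : ℝ, P (x : UnitAddCircle) := by
  have h1 : ∀ n : ℤ, ∀ᵐ x : ℝ ∂(volume.restrict (Set.Ioc (n:ℝ) (n+1))), P (x : UnitAddCircle) :=
    fun n => (UnitAddCircle.measurePreserving_mk (n:ℝ)).quasiMeasurePreserving.ae h
  have h2 := (ae_restrict_iUnion_iff (μ := (volume : Measure ℝ)) (fun n : ℤ => Set.Ioc (n:ℝ) (n+1))
    (fun x => P (x : UnitAddCircle))).2 h1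
  rw [iUnion_Ioc_intCast, Measure.restrict_univ] at h2
  exact h2

lemma kh_prod {P : ℝ → Prop} (h : ∀ᵐ a : ℝ, P a) :
    ∀ᵐ x : ℝ × ℝ, P (x.2 / x.1) := by
  have h0 : volume {a : ℝ | ¬ P a} = 0 := h
  set N := toMeasurable volume {a : ℝ | ¬ P a} with hN
  have hN0 : volume N = 0 := by rw [hN, measure_toMeasurable, h0]
  have hm : MeasurableSet N := measurableSet_toMeasurable _ _
  have hs : MeasurableSet {x : ℝ × ℝ | x.2 / x.1 ∈ N} :=
    (measurable_snd.div measurable_fst) hm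
  have : (volume : Measure (ℝ × ℝ)) {x : ℝ × ℝ | x.2 / x.1 ∈ N} = 0 := by
    rw [Measure.volume_eq_prod, Measure.measure_prod_null hs]
    have : ∀ᵐ a : ℝ, a ≠ 0 := by simp [ae_iff]
    filter_upwards [this] with a ha
    have e : (Prod.mk a ⁻¹' {x : ℝ × ℝ | x.2 / x.1 ∈ N}) = (fun y => y * a⁻¹) ⁻¹' N := by
      ext y; simp [div_eq_mul_inv]
    rw [e, Real.volume_preimage_mul_right (inv_ne_zero ha), hN0]
    simp
  refine measure_mono_null ?_ this
  intro x hx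
  exact subset_toMeasurable _ _ hx

lemma kh_det (ψ : ℝ → ℝ) (hlim : Tendsto ψ atTop (nhds 0)) (u v : ℝ)
    (hu0 : u ≠ 0) (hu : |u| ≤ 1/2) (huv : |v| ≤ |u|)
    (h : ((v / u : ℝ) : UnitAddCircle) ∈ addWellApproximable UnitAddCircle (fun n : ℕ => ψ n / n)) :
    ∀ K : ℕ, ∃ p : ℤ, ∃ n : ℕ, K ≤ n ∧ 0 < n ∧ |p| ≤ (n:ℤ) ∧ |(p:ℝ) * u + n * v| < ψ n := by
  intro K
  rw [UnitAddCircle.mem_addWellApproximable_iff] at h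
  have hl : ∀ᶠ n : ℕ in atTop, ψ n < 1 :=
    (hlim.comp tendsto_natCast_atTop_atTop).eventually_lt_const zero_lt_one
  obtain ⟨K', hK'⟩ := eventually_atTop.1 hl
  obtain ⟨n, ⟨m, hm, -, hn⟩, hgt⟩ := h.exists_gt (max K K')
  have hn0 : 0 < n := by omega
  have hn0' : (0:ℝ) < n := by exact_mod_cast hn0
  have hKn : K ≤ n := (le_max_left _ _).trans hgt.le
  have hψ : ψ n < 1 := hK' n ((le_max_right _ _).trans hgt.le)
  rw [← AddCircle.coe_sub, UnitAddCircle.norm_eq] at hn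
  set z := round (v / u - (m:ℝ) / n)
  have h1 : |(n:ℝ) * (v/u) - ((m + z * n : ℤ) : ℝ)| < ψ n := by
    have : (n:ℝ) * (v/u) - ((m + z * n : ℤ) : ℝ) = n * (v / u - (m:ℝ) / n - z) := by
      push_cast; field_simp; ring
    rw [this, abs_mul, abs_of_pos hn0', mul_comm]
    exact (lt_div_iff₀ hn0').1 hn
  refine ⟨-(m + z * n), n, hKn, hn0, ?_, ?_⟩
  · rw [abs_neg]
    have h2 : |v / u| ≤ 1 := by
      rw [abs_div]; exact div_le_one_of_le₀ huv (abs_nonneg _)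
    have h3 : |((m + z * n : ℤ) : ℝ)| < n + 1 := by
      have h4 : |(n:ℝ) * (v/u)| ≤ n := by
        rw [abs_mul, abs_of_pos hn0']
        exact mul_le_of_le_one_right hn0'.le h2
      rw [abs_le] at h4
      rw [abs_lt] at h1 ⊢
      constructor <;> linarith [h1.1, h1.2, h4.1, h4.2]
    have h5 : |m + z * n| < (n:ℤ) + 1 := by exact_mod_cast h3
    omega
  · have : ((-(m + z * n) : ℤ) : ℝ) * u + n * v = u * ((n:ℝ) * (v/u) - ((m + z * n : ℤ) : ℝ)) := by
      push_cast; field_simp; ring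
    rw [this, abs_mul]
    have := abs_nonneg ((n:ℝ) * (v/u) - ((m + z * n : ℤ) : ℝ))
    nlinarith [abs_nonneg u]

lemma kh_inf (S : Set (ℤ × ℤ)) (h : ∀ K : ℕ, ∃ q ∈ S, (K:ℤ) ≤ max |q.1| |q.2|) : S.Infinite := by
  intro hf
  obtain ⟨C, hC⟩ := (hf.image (fun q => max |q.1| |q.2|)).bddAbove
  obtain ⟨q, hq, hK⟩ := h (C.toNat + 1)
  have := hC (Set.mem_image_of_mem _ hq)
  push_cast at hK
  omega

theorem stmt2 (ψ : ℝ → ℝ)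
    (hpos : ∀ r > (0:ℝ), 0 < ψ r)
    (hmono : ∀ ⦃r s : ℝ⦄, 0 < r → r ≤ s → ψ s ≤ ψ r)
    (hlim : Tendsto ψ atTop (nhds 0))
    (hdiv : ¬ Summable (fun r : ℕ => ψ ((r : ℝ) + 1))) :
    volume {x : ℝ × ℝ |
      x.1 ∈ Set.Icc (-(1:ℝ)/2) (1/2) ∧ x.2 ∈ Set.Icc (-(1:ℝ)/2) (1/2) ∧
      {q : ℤ × ℤ | q ≠ 0 ∧
        |(q.1 : ℝ) * x.1 + (q.2 : ℝ) * x.2| < ψ (max |(q.1 : ℝ)| |(q.2 : ℝ)|)}.Infinite} = 1 := by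
  have hc := kh_circle (fun k : ℕ => ψ ((k:ℝ)+1))
    (fun a b hab => hmono (by positivity) (by simpa using hab))
    (fun k => hpos _ (by positivity)) hdiv
    (by
      have := hlim.comp (tendsto_natCast_atTop_atTop (R := ℝ))
      have := (tendsto_add_atTop_iff_nat 1).2 this
      simpa [Function.comp_def] using this)
    (fun n : ℕ => ψ n / n) (fun k => by push_cast; rfl)
  have hp := kh_prod (kh_real hc)
  have hp' : ∀ᵐ x : ℝ × ℝ, ((x.1 / x.2 : ℝ) : UnitAddCircle) ∈
      addWellApproximable UnitAddCircle (fun n : ℕ => ψ n / n) :=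
    (Measure.measurePreserving_swap (μ := (volume : Measure ℝ))
      (ν := (volume : Measure ℝ))).quasiMeasurePreserving.ae hp
  have hz : ∀ᵐ x : ℝ × ℝ, x.1 ≠ 0 :=
    (Measure.quasiMeasurePreserving_fst (μ := (volume : Measure ℝ))
      (ν := (volume : Measure ℝ))).ae (by simp [ae_iff] : ∀ᵐ a : ℝ, a ≠ 0)
  have hz' : ∀ᵐ x : ℝ × ℝ, x.2 ≠ 0 :=
    (Measure.quasiMeasurePreserving_snd (μ := (volume : Measure ℝ))
      (ν := (volume : Measure ℝ))).ae (by simp [ae_iff] : ∀ᵐ a : ℝ, a ≠ 0)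
  have hsq : (volume : Measure (ℝ × ℝ))
      (Set.Icc (-(1:ℝ)/2) (1/2) ×ˢ Set.Icc (-(1:ℝ)/2) (1/2)) = 1 := by
    rw [Measure.volume_eq_prod, Measure.prod_prod, Real.volume_Icc]
    norm_num
  rw [← hsq]
  apply measure_congr
  filter_upwards [hp, hp', hz, hz'] with x h1 h2 h3 h4
  apply propext
  constructor
  · rintro ⟨a, b, -⟩
    exact ⟨a, b⟩
  · rintro ⟨a, b⟩
    refine ⟨a, b, kh_inf _ fun K => ?_⟩
    have ha : |x.1| ≤ 1/2 := abs_le.2 ⟨by linarith [a.1], a.2⟩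
    have hb : |x.2| ≤ 1/2 := abs_le.2 ⟨by linarith [b.1], b.2⟩
    rcases le_total |x.2| |x.1| with hle | hle
    · obtain ⟨p, n, hK, hn, hpn, hlt⟩ := kh_det ψ hlim x.1 x.2 h3 ha hle h1 K
      have hpn' : |(p:ℝ)| ≤ n := by exact_mod_cast hpn
      refine ⟨(p, n), ⟨?_, ?_⟩, ?_⟩
      · intro h
        have := congrArg Prod.snd h
        simp at this
        omega
      · simpa [max_eq_right hpn'] using hlt
      · exact le_max_of_le_right (by simpa using hK)
    · obtain ⟨p, n, hK, hn, hpn, hlt⟩ := kh_det ψ hlim x.2 x.1 h4 hb hle h2 K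
      have hpn' : |(p:ℝ)| ≤ n := by exact_mod_cast hpn
      refine ⟨(n, p), ⟨?_, ?_⟩, ?_⟩
      · intro h
        have := congrArg Prod.fst h
        simp at this
        omega
      · rw [add_comm] at hlt
        simpa [max_eq_left hpn'] using hlt
      · exact le_max_of_le_left (by simpa using hK)
end

section
/- Let m > n > 0 be integers, let e₁, …, e_n ∈ ℝ^m, and let τ₁, …, τ_n be pairwise distinct positive real numbers. Assume there are functions ε₁, …, ε_n : ℕ → ℝ with ε_i(Q) → 0 as Q → ∞ such that for every sufficiently large positive integer Q there exists q ∈ ℤ^m satisfying ‖q‖ ≤ Q and Q^{−τ_i − ε_i(Q)} ≤ |q · e_i| ≤ Q^{−τ_i + ε_i(Q)} for all i ∈ {1,…,n}. Then every linear subspace F of ℝ^m which is defined over the rationals and contains e₁, …, e_n satisfies dim F ≥ n + τ₁ + … + τ_n. -/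
open MeasureTheory Filter

/-- A subspace of `ℝ^m` is defined over the rationals if it is spanned by
vectors all of whose coordinates are rational. -/
def DefinedOverQ {m : ℕ} (F : Submodule ℝ (Fin m → ℝ)) : Prop :=
  ∃ B : Set (Fin m → ℝ), (∀ v ∈ B, ∀ i, ∃ a : ℚ, v i = (a : ℝ)) ∧ F = Submodule.span ℝ B


lemma stmt4_key (n : ℕ) (hn : 0 < n) (τ : Fin n → ℝ) (a : ℕ) (ha : 1 ≤ a) (κ : ℝ) (hκ : 0 < κ)
    (hgap : ∀ i j, i ≠ j → 3 * κ * ((a : ℝ) + (n * n : ℕ)) ≤ |τ i - τ j|)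
    (P : ℕ) (hP2 : 2 ≤ P) (hP : 2 * (n : ℝ) ≤ (P : ℝ) ^ κ)
    (l : ℕ → Fin n → ℝ)
    (hl : ∀ Q, P ≤ Q → ∀ i, (Q : ℝ) ^ (-(τ i) - κ) ≤ |l Q i| ∧ |l Q i| ≤ (Q : ℝ) ^ (-(τ i) + κ))
    (c : Fin n → ℝ) (hc : c ≠ 0) :
    ∃ k ≤ n * n, ∀ i, (1 / 2) * (|c i| * ((P ^ (a + k) : ℕ) : ℝ) ^ (-(τ i) - κ)) ≤
      |∑ i, c i * l (P ^ (a + k)) i| := by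
  by_contra hcon
  push Not at hcon
  have hne : Nonempty (Fin n) := ⟨⟨0, hn⟩⟩
  have hP1 : (1 : ℝ) < P := by exact_mod_cast (by omega : 1 < P)
  have hP0 : (0 : ℝ) < P := by linarith
  have step : ∀ k : Fin (n * n + 1), ∃ p : Fin n × Fin n, p.1 ≠ p.2 ∧ c p.1 ≠ 0 ∧
      |c p.2| * ((P ^ (a + k) : ℕ) : ℝ) ^ (-(τ p.2)) ≤ |c p.1| * ((P ^ (a + k) : ℕ) : ℝ) ^ (-(τ p.1)) ∧
      |c p.1| * ((P ^ (a + k) : ℕ) : ℝ) ^ (-(τ p.1)) * ((P ^ (a + k) : ℕ) : ℝ) ^ (-(3 * κ)) <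
        |c p.2| * ((P ^ (a + k) : ℕ) : ℝ) ^ (-(τ p.2)) := by
    intro k
    obtain ⟨i1, hi1⟩ := hcon k (by omega)
    have hPQ : P ≤ P ^ (a + k.1) := Nat.le_self_pow (by omega) P
    have hl' := hl _ hPQ
    have hPQ' : (P : ℝ) ≤ ((P ^ (a + k.1) : ℕ) : ℝ) := by exact_mod_cast hPQ
    generalize P ^ (a + k.1) = Q at *
    set X : ℝ := (Q : ℝ) with hX
    have hX0 : 0 < X := by linarith
    obtain ⟨i, hi⟩ := Finite.exists_max (fun i => |c i| * X ^ (-(τ i)))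
    have hci : c i ≠ 0 := by
      intro h0
      apply hc
      funext j
      have := hi j
      simp only [h0, abs_zero, zero_mul] at this
      have h2 : 0 < X ^ (-(τ j)) := Real.rpow_pos_of_pos hX0 _
      have h3 : |c j| ≤ 0 := by
        by_contra h
        push Not at h
        nlinarith [mul_pos h h2]
      simpa using abs_eq_zero.1 (le_antisymm h3 (abs_nonneg _))
    by_contra hno
    push Not at hno
    have hdom : ∀ j, j ≠ i → |c j| * X ^ (-(τ j)) ≤ |c i| * X ^ (-(τ i)) * X ^ (-(3 * κ)) := by
      intro j hj
      exact hno (i, j) hj.symm hci (hi j)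
    set w : ℝ := |c i| * X ^ (-(τ i)) with hw
    have hw0 : 0 < w := mul_pos (abs_pos.2 hci) (Real.rpow_pos_of_pos hX0 _)
    have hXk : 2 * (n : ℝ) ≤ X ^ κ := hP.trans (Real.rpow_le_rpow hP0.le hPQ' hκ.le)
    have hsplit : ∑ j, c j * l Q j = c i * l Q i + ∑ j ∈ Finset.univ.erase i, c j * l Q j := by
      exact (Finset.add_sum_erase _ (fun j => c j * l Q j) (Finset.mem_univ i)).symm
    have hXκ0 : 0 < X ^ (-κ) := Real.rpow_pos_of_pos hX0 _
    have e1 : w * X ^ (-κ) ≤ |c i * l Q i| := by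
      rw [abs_mul, hw, mul_assoc, ← Real.rpow_add hX0]
      exact mul_le_mul_of_nonneg_left (hl' i).1 (abs_nonneg _)
    have e2 : |∑ j ∈ Finset.univ.erase i, c j * l Q j| ≤ n * (w * X ^ (-κ) * X ^ (-κ)) := by
      refine (Finset.abs_sum_le_sum_abs _ _).trans ?_
      have : ∀ j ∈ Finset.univ.erase i, |c j * l Q j| ≤ w * X ^ (-κ) * X ^ (-κ) := by
        intro j hj
        have h1 := hdom j (Finset.ne_of_mem_erase hj)
        calc |c j * l Q j| ≤ |c j| * X ^ (-(τ j) + κ) := by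
              rw [abs_mul]; exact mul_le_mul_of_nonneg_left (hl' j).2 (abs_nonneg _)
          _ = |c j| * X ^ (-(τ j)) * X ^ κ := by rw [Real.rpow_add hX0, mul_assoc]
          _ ≤ w * X ^ (-(3 * κ)) * X ^ κ := by gcongr
          _ = w * X ^ (-κ) * X ^ (-κ) := by
              have h2 : X ^ (-(3 * κ)) * X ^ κ = X ^ (-κ) * X ^ (-κ) := by
                rw [← Real.rpow_add hX0, ← Real.rpow_add hX0]; congr 1; ring
              linear_combination w * h2
      refine (Finset.sum_le_card_nsmul _ _ _ this).trans ?_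
      rw [nsmul_eq_mul]
      gcongr
      exact (Finset.card_le_univ _).trans (by simp)
    have e3 : (n : ℝ) * X ^ (-κ) ≤ 1 / 2 := by
      rw [Real.rpow_neg hX0.le, ← div_eq_mul_inv, div_le_iff₀ (Real.rpow_pos_of_pos hX0 _)]
      linarith
    have e4 : (1 / 2) * (w * X ^ (-κ)) ≤ |∑ j, c j * l Q j| := by
      rw [hsplit]
      have h1 := abs_sub_abs_le_abs_sub (c i * l Q i) (-(∑ j ∈ Finset.univ.erase i, c j * l Q j))
      rw [abs_neg, sub_neg_eq_add] at h1
      have h2 : (n : ℝ) * (w * X ^ (-κ) * X ^ (-κ)) ≤ (1 / 2) * (w * X ^ (-κ)) := by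
        have := mul_le_mul_of_nonneg_left e3 (mul_pos hw0 hXκ0).le
        nlinarith
      linarith
    have e5 : |c i1| * X ^ (-(τ i1) - κ) ≤ w * X ^ (-κ) := by
      rw [sub_eq_add_neg, Real.rpow_add hX0, ← mul_assoc]
      gcongr
      exact hi i1
    linarith
  choose p hp1 hp2 hp3 hp4 using step
  obtain ⟨k, k', hkk, hpk⟩ := Fintype.exists_ne_map_eq_of_card_lt p (by simp)
  have fin : ∀ k k' : Fin (n * n + 1), k < k' → p k = p k' → False := by
    intro k k' hlt hpe
    have A := hp3 k; have B := hp4 k; have A' := hp3 k'; have B' := hp4 k'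
    have hne := hp1 k
    have hci := hp2 k
    rw [← hpe] at A' B'
    generalize (p k).1 = i at *
    generalize (p k).2 = j at *
    have hci' := abs_pos.2 hci
    have hcj' : 0 < |c j| := by
      by_contra h
      have h0 : |c j| = 0 := le_antisymm (not_lt.1 h) (abs_nonneg _)
      rw [h0, zero_mul] at B
      have : 0 < |c i| * ((P ^ (a + k) : ℕ) : ℝ) ^ (-(τ i)) * ((P ^ (a + k) : ℕ) : ℝ) ^ (-(3 * κ)) := by
        positivity
      linarith
    have hlog : 0 < Real.log P := Real.log_pos hP1
    have trA : ∀ k : ℕ, |c j| * ((P ^ (a + k) : ℕ) : ℝ) ^ (-(τ j)) ≤ |c i| * ((P ^ (a + k) : ℕ) : ℝ) ^ (-(τ i)) →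
        Real.log |c j| - τ j * ((a + k) * Real.log P) ≤ Real.log |c i| - τ i * ((a + k) * Real.log P) := by
      intro k h
      have hX : (0 : ℝ) < ((P ^ (a + k) : ℕ) : ℝ) := by positivity
      have h := Real.log_le_log (by positivity) h
      rw [Real.log_mul (by positivity) (by positivity), Real.log_mul (by positivity) (by positivity),
        Real.log_rpow hX, Real.log_rpow hX] at h
      push_cast at h
      rw [Real.log_pow] at h
      push_cast at h
      linarith
    have trB : ∀ k : ℕ, |c i| * ((P ^ (a + k) : ℕ) : ℝ) ^ (-(τ i)) * ((P ^ (a + k) : ℕ) : ℝ) ^ (-(3 * κ)) <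
        |c j| * ((P ^ (a + k) : ℕ) : ℝ) ^ (-(τ j)) →
        Real.log |c i| - τ i * ((a + k) * Real.log P) - 3 * κ * ((a + k) * Real.log P) <
          Real.log |c j| - τ j * ((a + k) * Real.log P) := by
      intro k h
      have hX : (0 : ℝ) < ((P ^ (a + k) : ℕ) : ℝ) := by positivity
      have h := Real.log_lt_log (by positivity) h
      rw [Real.log_mul (by positivity) (by positivity), Real.log_mul (by positivity) (by positivity),
        Real.log_mul (by positivity) (by positivity),
        Real.log_rpow hX, Real.log_rpow hX, Real.log_rpow hX] at h
      push_cast at h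
      rw [Real.log_pow] at h
      push_cast at h
      linarith
    have A := trA _ A; have A' := trA _ A'; have B := trB _ B; have B' := trB _ B'
    have hg := hgap i j hne
    have hk1 : (k.1 : ℝ) + 1 ≤ k'.1 := by exact_mod_cast hlt
    have hk2 : (k'.1 : ℝ) ≤ (n * n : ℕ) := by exact_mod_cast (by omega : k'.1 ≤ n * n)
    set y := Real.log P
    set T := ((a : ℝ) + k.1) * y with hT
    set T' := ((a : ℝ) + k'.1) * y with hT'
    have hTT : y ≤ T' - T := by rw [hT, hT']; nlinarith
    have hT'b : T' ≤ ((a : ℝ) + (n * n : ℕ)) * y := by rw [hT']; gcongr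
    have h1 : 3 * κ * T' ≤ |τ i - τ j| * y := by
      calc 3 * κ * T' ≤ 3 * κ * (((a : ℝ) + (n * n : ℕ)) * y) := by gcongr
        _ = 3 * κ * ((a : ℝ) + (n * n : ℕ)) * y := by ring
        _ ≤ _ := by gcongr
    have h2 : |τ i - τ j| * y ≤ |τ i - τ j| * (T' - T) := by gcongr
    have h3 : κ * T ≤ κ * T' := by gcongr; linarith
    rcases abs_cases (τ i - τ j) with ⟨h, _⟩ | ⟨h, _⟩ <;> rw [h] at h1 h2 <;> nlinarith
  rcases lt_or_gt_of_ne hkk with h | h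
  · exact fin _ _ h hpk
  · exact fin _ _ h hpk.symm

lemma stmt4_mink {ι : Type*} [Fintype ι] (d : ℕ) (b : Module.Basis ι ℝ (Fin d → ℝ)) :
    ∃ c0 : ℝ, ∀ A : ι → ℝ, (∀ s, 0 < A s) → c0 < ∏ s, A s →
      ∃ x : Fin d → ℤ, x ≠ 0 ∧ ∀ s, |b.repr (fun t => (x t : ℝ)) s| ≤ A s := by
  classical
  have hcard : Fintype.card ι = d := by
    have := Module.finrank_eq_card_basis b
    simpa using this.symm
  let σ : ι ≃ Fin d := Fintype.equivFinOfCardEq hcard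
  let f : (Fin d → ℝ) ≃ₗ[ℝ] (Fin d → ℝ) := (b.reindex σ).equivFun
  set D := LinearMap.det (f.symm : (Fin d → ℝ) →ₗ[ℝ] (Fin d → ℝ)) with hD
  have hD0 : D ≠ 0 := (LinearEquiv.isUnit_det' f.symm).ne_zero
  refine ⟨|D|⁻¹, fun A hA hc => ?_⟩
  let box : Set (Fin d → ℝ) := Set.pi Set.univ (fun s => Set.Icc (-(A (σ.symm s))) (A (σ.symm s)))
  have hbox : volume box = ENNReal.ofReal (2 ^ d * ∏ s, A s) := by
    rw [volume_pi, Measure.pi_pi]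
    simp only [Real.volume_Icc]
    rw [← ENNReal.ofReal_prod_of_nonneg (fun s _ => by linarith [hA (σ.symm s)])]
    congr 1
    rw [← Equiv.prod_comp σ.symm A]
    have : ∀ s, A (σ.symm s) - -A (σ.symm s) = 2 * A (σ.symm s) := fun s => by ring
    simp only [this, Finset.prod_mul_distrib]
    simp
  have hvol : volume (f ⁻¹' box) = ENNReal.ofReal (|D| * (2 ^ d * ∏ s, A s)) := by
    rw [Measure.addHaar_preimage_linearEquiv, hbox, ← ENNReal.ofReal_mul (abs_nonneg _)]
  have hconvbox : Convex ℝ box := convex_pi (fun s _ => convex_Icc _ _)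
  have fund := ZSpan.isAddFundamentalDomain' (Pi.basisFun ℝ (Fin d)) volume
  have hF : volume (ZSpan.fundamentalDomain (Pi.basisFun ℝ (Fin d))) = 1 := by
    rw [ZSpan.fundamentalDomain_pi_basisFun, volume_pi, Measure.pi_pi]
    simp
  have hlt : volume (ZSpan.fundamentalDomain (Pi.basisFun ℝ (Fin d))) *
      2 ^ Module.finrank ℝ (Fin d → ℝ) < volume (f ⁻¹' box) := by
    rw [hF, hvol, one_mul, Module.finrank_fin_fun]
    have h2 : (2 : ENNReal) ^ d = ENNReal.ofReal (2 ^ d) := by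
      rw [ENNReal.ofReal_pow (by norm_num)]; simp
    rw [h2]
    have hD1 := abs_pos.2 hD0
    have h3 : 1 < |D| * ∏ s, A s := by
      have := mul_lt_mul_of_pos_left hc hD1
      rwa [mul_inv_cancel₀ hD1.ne'] at this
    have h4 : (2 : ℝ) ^ d < |D| * (2 ^ d * ∏ s, A s) := by
      have := mul_lt_mul_of_pos_left h3 (by positivity : (0 : ℝ) < 2 ^ d)
      linarith
    exact (ENNReal.ofReal_lt_ofReal_iff (lt_trans (by positivity) h4)).2 h4
  have hcount : Countable (Submodule.span ℤ (Set.range (Pi.basisFun ℝ (Fin d)))).toAddSubgroup :=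
    inferInstanceAs (Countable (Submodule.span ℤ (Set.range (Pi.basisFun ℝ (Fin d)))))
  obtain ⟨x, hx0, hx⟩ := exists_ne_zero_mem_lattice_of_measure_mul_two_pow_lt_measure fund
    (s := f ⁻¹' box) (by
      intro x hx
      simp only [box, Set.mem_preimage, Set.mem_pi, Set.mem_univ, forall_true_left, Set.mem_Icc,
        map_neg, Pi.neg_apply] at hx ⊢
      intro s
      have := hx s
      constructor <;> linarith) (hconvbox.linear_preimage f.toLinearMap) hlt
  have hmem : ∀ t, ∃ z : ℤ, (z : ℝ) = (x : Fin d → ℝ) t := by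
    intro t
    have := ((Pi.basisFun ℝ (Fin d)).mem_span_iff_repr_mem ℤ (x : Fin d → ℝ)).1 x.2 t
    simpa using this
  choose z hz using hmem
  have hzx : (fun t => (z t : ℝ)) = (x : Fin d → ℝ) := funext hz
  refine ⟨z, ?_, ?_⟩
  · rintro rfl
    apply hx0
    apply Subtype.ext
    rw [← hzx]
    funext t
    simp
  · intro s
    rw [hzx]
    have := hx (σ s) (Set.mem_univ _)
    simp [f] at this
    exact abs_le.2 this

lemma stmt4_ext (d n : ℕ) (c : Fin n → Fin d → ℝ) (hc : LinearIndependent ℝ c) :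
    ∃ (J : Type) (_ : Fintype J) (b : Module.Basis (Fin n ⊕ J) ℝ (Fin d → ℝ)),
      (∀ i, b (Sum.inl i) = c i) ∧ n + Fintype.card J = d := by
  classical
  let b := Module.Basis.sumExtend hc
  have : Finite (Fin n ⊕ Module.Basis.sumExtendIndex hc) := Module.Finite.finite_basis b
  have : Finite (Module.Basis.sumExtendIndex hc) := Finite.of_injective (Sum.inr (α := Fin n)) Sum.inr_injective
  have fJ : Fintype (Module.Basis.sumExtendIndex hc) := Fintype.ofFinite _
  refine ⟨_, fJ, b, ?_, ?_⟩
  · intro i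
    simp [b, Module.Basis.sumExtend]
    try rfl
  · have := Module.finrank_eq_card_basis b
    simpa using this.symm

lemma stmt4_pow (P e : ℕ) (x : ℝ) : ((P ^ e : ℕ) : ℝ) ^ x = (P : ℝ) ^ ((e : ℝ) * x) := by
  push_cast
  rw [← Real.rpow_natCast, ← Real.rpow_mul (Nat.cast_nonneg _)]

lemma stmt4_scale (n : ℕ) (hn : 0 < n) (τ : Fin n → ℝ) (T : ℝ) (hT : ∀ i, τ i ≤ T) (a K : ℕ)
    (κ : ℝ) (hκ : 0 < κ) (hκτ : ∀ i, κ ≤ τ i) (P0 : ℕ) (hP0 : 2 ≤ P0) (c1 : ℝ) (hc1 : 0 < c1) :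
    ∃ c3 : ℝ, 0 < c3 ∧ ∀ R : ℕ, P0 ≤ R → ∀ lam : Fin n → ℝ, (∃ i, c1 ≤ |lam i|) →
      (∀ i, |lam i| * (R : ℝ) ^ (-(a * (τ i - κ))) ≤ 1 / (4 * n)) →
      ∃ P : ℕ, P0 ≤ P ∧ P ≤ R ∧
        (∀ i, ∀ k ≤ K, |lam i| * ((P ^ (a + k) : ℕ) : ℝ) ^ (-(τ i) + κ) ≤ 1 / (4 * n)) ∧
        ∃ i, ∀ k ≤ K, c3 * (R : ℝ) ^ (-((2 * a + K) * κ + K * T)) ≤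
          |lam i| * ((P ^ (a + k) : ℕ) : ℝ) ^ (-(τ i) - κ) := by
  classical
  have hnR : (0 : ℝ) < n := by exact_mod_cast hn
  have hP0R : (2 : ℝ) ≤ P0 := by exact_mod_cast hP0
  have hT0 : 0 < T := hκ.trans_le ((hκτ ⟨0, hn⟩).trans (hT _))
  refine ⟨min (c1 * (P0 : ℝ) ^ (-((a + K) * (T + κ)))) (1 / (4 * n) * 2 ^ (-(a * T))), by positivity, ?_⟩
  intro R hR lam hlam hlamR
  set c3 := min (c1 * (P0 : ℝ) ^ (-((a + K) * (T + κ)))) (1 / (4 * n) * 2 ^ (-(a * T))) with hc3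
  have hc30 : 0 < c3 := by positivity
  have hex : ∃ P : ℕ, P0 ≤ P ∧ ∀ i, |lam i| * (P : ℝ) ^ (-(a * (τ i - κ))) ≤ 1 / (4 * n) :=
    ⟨R, hR, hlamR⟩
  set P := Nat.find hex with hPdef
  obtain ⟨hP1, hP2⟩ := Nat.find_spec hex
  rw [← hPdef] at hP1 hP2
  have hPR : P ≤ R := Nat.find_min' hex ⟨hR, hlamR⟩
  have hPR' : (P : ℝ) ≤ R := by exact_mod_cast hPR
  have hPge : (2 : ℝ) ≤ P := by exact_mod_cast hP0.trans hP1
  have hPpos : (0 : ℝ) < P := by linarith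
  have hRge : (2 : ℝ) ≤ R := by linarith
  refine ⟨P, hP1, hPR, ?_, ?_⟩
  · intro i k _
    refine le_trans ?_ (hP2 i)
    rw [stmt4_pow]
    refine mul_le_mul_of_nonneg_left ?_ (abs_nonneg _)
    refine Real.rpow_le_rpow_of_exponent_le (by linarith) ?_
    push_cast
    have : 0 ≤ (k : ℝ) * (τ i - κ) := mul_nonneg (Nat.cast_nonneg _) (by linarith [hκτ i])
    nlinarith
  · rcases eq_or_lt_of_le hP1 with hEq | hLt
    · obtain ⟨i, hi⟩ := hlam
      refine ⟨i, fun k hk => ?_⟩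
      have hkR : (k : ℝ) ≤ K := by exact_mod_cast hk
      have h1 : (R : ℝ) ^ (-((2 * a + K) * κ + K * T)) ≤ 1 := by
        apply Real.rpow_le_one_of_one_le_of_nonpos (by linarith)
        have : 0 ≤ (2 * a + K) * κ + K * T := by positivity
        linarith
      calc c3 * (R : ℝ) ^ (-((2 * a + K) * κ + K * T)) ≤ c3 * 1 := by gcongr
        _ ≤ c1 * (P0 : ℝ) ^ (-((a + K) * (T + κ))) := by rw [mul_one]; exact min_le_left _ _
        _ ≤ _ := by
          rw [stmt4_pow, ← hEq]
          refine mul_le_mul hi ?_ (by positivity) (abs_nonneg _)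
          refine Real.rpow_le_rpow_of_exponent_le (by linarith) ?_
          push_cast
          have : ((a : ℝ) + k) * (τ i + κ) ≤ (a + K) * (T + κ) := by
            have := hT i
            have := hκτ i
            have : 0 ≤ τ i + κ := by linarith
            gcongr
          linarith
    · have hmin := Nat.find_min hex (m := P - 1) (by omega)
      push Not at hmin
      obtain ⟨i, hi⟩ := hmin (by omega)
      refine ⟨i, fun k hk => ?_⟩
      have hkR : (k : ℝ) ≤ K := by exact_mod_cast hk
      have hx0 : 0 ≤ a * (τ i - κ) := mul_nonneg (Nat.cast_nonneg _) (by linarith [hκτ i])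
      have hc : ((P - 1 : ℕ) : ℝ) = P - 1 := by
        rw [Nat.cast_sub (by omega)]; simp
      have hhalf : (P : ℝ) * 2⁻¹ ≤ ((P - 1 : ℕ) : ℝ) := by rw [hc]; linarith
      have hpos1 : (0 : ℝ) < ((P - 1 : ℕ) : ℝ) := by rw [hc]; linarith
      have h2 : 1 / (4 * n) * ((P : ℝ) * 2⁻¹) ^ (a * (τ i - κ)) ≤ |lam i| := by
        calc 1 / (4 * n) * ((P : ℝ) * 2⁻¹) ^ (a * (τ i - κ))
            ≤ 1 / (4 * n) * ((P - 1 : ℕ) : ℝ) ^ (a * (τ i - κ)) := by gcongr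
          _ ≤ (|lam i| * ((P - 1 : ℕ) : ℝ) ^ (-(a * (τ i - κ)))) * ((P - 1 : ℕ) : ℝ) ^ (a * (τ i - κ)) := by
              gcongr
          _ = |lam i| := by
              rw [mul_assoc, ← Real.rpow_add hpos1]; simp
      have h3 : ((P : ℝ) * 2⁻¹) ^ (a * (τ i - κ)) = (P : ℝ) ^ (a * (τ i - κ)) * 2 ^ (-(a * (τ i - κ))) := by
        rw [Real.mul_rpow (by positivity) (by positivity), Real.inv_rpow (by norm_num), Real.rpow_neg (by norm_num)]
      have h4 : (2 : ℝ) ^ (-(a * T)) ≤ 2 ^ (-(a * (τ i - κ))) := by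
        refine Real.rpow_le_rpow_of_exponent_le (by norm_num) ?_
        have : (a : ℝ) * (τ i - κ) ≤ a * T := by gcongr; linarith [hT i]
        linarith
      have h5 : (R : ℝ) ^ (-((2 * a + K) * κ + K * T)) ≤ (P : ℝ) ^ (-((2 * a + K) * κ + K * T)) := by
        apply Real.rpow_le_rpow_of_nonpos hPpos hPR'
        have : 0 ≤ (2 * a + K) * κ + K * T := by positivity
        linarith
      have h6 : (P : ℝ) ^ (-((2 * a + K) * κ + K * T)) ≤
          (P : ℝ) ^ (a * (τ i - κ)) * (P : ℝ) ^ ((((a + k : ℕ) : ℝ)) * (-(τ i) - κ)) := by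
        rw [← Real.rpow_add hPpos]
        refine Real.rpow_le_rpow_of_exponent_le (by linarith) ?_
        push_cast
        have e1 : (k : ℝ) * (τ i + κ) ≤ K * (T + κ) := by
          have := hT i
          have := hκτ i
          have : 0 ≤ τ i + κ := by linarith
          gcongr
        nlinarith
      rw [stmt4_pow]
      calc c3 * (R : ℝ) ^ (-((2 * a + K) * κ + K * T))
          ≤ (1 / (4 * n) * 2 ^ (-(a * (τ i - κ)))) *
            ((P : ℝ) ^ (a * (τ i - κ)) * (P : ℝ) ^ ((((a + k : ℕ) : ℝ)) * (-(τ i) - κ))) := by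
            apply mul_le_mul _ (h5.trans h6) (by positivity) (by positivity)
            exact (min_le_right _ _).trans (by gcongr)
        _ = (1 / (4 * n) * ((P : ℝ) * 2⁻¹) ^ (a * (τ i - κ))) * (P : ℝ) ^ ((((a + k : ℕ) : ℝ)) * (-(τ i) - κ)) := by
            rw [h3]; ring
        _ ≤ _ := by gcongr

set_option maxHeartbeats 2000000 in
lemma stmt4_core (d n : ℕ) (hn : 0 < n) (c : Fin n → Fin d → ℝ) (τ : Fin n → ℝ)
    (hτ : ∀ i, 0 < τ i) (hinj : Function.Injective τ) (C : ℝ) (hC : 0 ≤ C)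
    (H : ∀ κ : ℝ, 0 < κ → ∀ᶠ Q : ℕ in atTop, ∃ q : Fin d → ℤ, (∀ s, |(q s : ℝ)| ≤ C * Q) ∧
      ∀ i, (Q : ℝ) ^ (-(τ i) - κ) ≤ |∑ s, (q s : ℝ) * c i s| ∧
        |∑ s, (q s : ℝ) * c i s| ≤ (Q : ℝ) ^ (-(τ i) + κ)) :
    (n : ℝ) + ∑ i, τ i ≤ d := by
  by_contra hlt
  push Not at hlt
  have hnR : (0 : ℝ) < n := by exact_mod_cast hn
  set T := ∑ i, τ i with hTdef
  have hT : ∀ i, τ i ≤ T := fun i =>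
    Finset.single_le_sum (f := τ) (fun j _ => (hτ j).le) (Finset.mem_univ i)
  have hT0 : 0 < T := (hτ ⟨0, hn⟩).trans_le (hT _)
  -- parameters
  obtain ⟨η, hη, hηd⟩ : ∃ η : ℝ, 0 < η ∧ d * η < n + T - d := by
    refine ⟨(n + T - d) / (d + 1), by have : (0 : ℝ) < n + T - d := by linarith
                                      positivity, ?_⟩
    have h1 : (0 : ℝ) < n + T - d := by linarith
    rw [mul_div_assoc', div_lt_iff₀ (by positivity)]
    nlinarith
  set K := n * n with hK
  obtain ⟨a, haη⟩ := exists_nat_ge (2 * (K * T + 1) / η)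
  rw [div_le_iff₀ hη] at haη
  have ha : 1 ≤ a := by
    rcases Nat.eq_zero_or_pos a with h | h
    · subst h
      have : 0 ≤ (K : ℝ) * T := by positivity
      simp at haη
      linarith
    · exact h
  obtain ⟨κ, hκ, hκη, hκτ, hgap⟩ : ∃ κ : ℝ, 0 < κ ∧ κ ≤ η / 4 ∧ (∀ i, κ ≤ τ i) ∧
      ∀ i j, i ≠ j → 3 * κ * ((a : ℝ) + (n * n : ℕ)) ≤ |τ i - τ j| := by
    have e1 : ∀ᶠ κ : ℝ in nhdsWithin 0 (Set.Ioi 0), κ ≤ η / 4 :=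
      nhdsWithin_le_nhds (eventually_le_nhds (by positivity))
    have e2 : ∀ᶠ κ : ℝ in nhdsWithin 0 (Set.Ioi 0), ∀ i, κ ≤ τ i := by
      rw [eventually_all]
      exact fun i => nhdsWithin_le_nhds (eventually_le_nhds (hτ i))
    have e3 : ∀ᶠ κ : ℝ in nhdsWithin 0 (Set.Ioi 0), ∀ i j, i ≠ j →
        3 * κ * ((a : ℝ) + (n * n : ℕ)) ≤ |τ i - τ j| := by
      rw [eventually_all]; intro i
      rw [eventually_all]; intro j
      by_cases hij : i = j
      · exact Eventually.of_forall fun _ h => absurd hij h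
      · have hpos : 0 < |τ i - τ j| := abs_pos.2 (sub_ne_zero.2 (fun h => hij (hinj h)))
        have ht : Tendsto (fun κ : ℝ => 3 * κ * ((a : ℝ) + (n * n : ℕ))) (nhds 0) (nhds 0) := by
          have : Continuous (fun κ : ℝ => 3 * κ * ((a : ℝ) + (n * n : ℕ))) := by fun_prop
          simpa using this.tendsto 0
        exact nhdsWithin_le_nhds ((ht.eventually (eventually_le_nhds hpos)).mono fun _ h _ => h)
    obtain ⟨κ, h1, h2, h3, h4⟩ := (e1.and (e2.and (e3.and self_mem_nhdsWithin))).exists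
    exact ⟨κ, h4, h1, h2, h3⟩
  obtain ⟨N0, hN0⟩ := eventually_atTop.1 (H κ hκ)
  have hq' : ∀ Q : ℕ, ∃ q : Fin d → ℤ, N0 ≤ Q → (∀ s, |(q s : ℝ)| ≤ C * Q) ∧
      ∀ i, (Q : ℝ) ^ (-(τ i) - κ) ≤ |∑ s, (q s : ℝ) * c i s| ∧
        |∑ s, (q s : ℝ) * c i s| ≤ (Q : ℝ) ^ (-(τ i) + κ) := by
    intro Q
    by_cases h : N0 ≤ Q
    · obtain ⟨q, hq⟩ := hN0 Q h
      exact ⟨q, fun _ => hq⟩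
    · exact ⟨0, fun h' => absurd h' h⟩
  choose q hq using hq'
  have hpowtend : Tendsto (fun P : ℕ => (P : ℝ) ^ κ) atTop atTop :=
    (tendsto_rpow_atTop hκ).comp tendsto_natCast_atTop_atTop
  obtain ⟨P0, hP0N, hP02, hP0n⟩ := ((eventually_ge_atTop N0).and
    ((eventually_ge_atTop 2).and (hpowtend.eventually_ge_atTop (2 * (n : ℝ))))).exists
  set l : ℕ → Fin n → ℝ := fun Q i => ∑ s, (q Q s : ℝ) * c i s with hl
  have key : ∀ P : ℕ, P0 ≤ P → ∀ lam : Fin n → ℝ, lam ≠ 0 → ∃ k ≤ K,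
      ∀ i, (1 / 2) * (|lam i| * ((P ^ (a + k) : ℕ) : ℝ) ^ (-(τ i) - κ)) ≤
      |∑ i, lam i * l (P ^ (a + k)) i| := by
    intro P hP lam hlam
    refine stmt4_key n hn τ a ha κ hκ hgap P (hP02.trans hP) ?_ l ?_ lam hlam
    · refine hP0n.trans (Real.rpow_le_rpow (by positivity) (by exact_mod_cast hP) hκ.le)
    · intro Q hQ i
      exact (hq Q (hP0N.trans (hP.trans hQ))).2 i
  have hdot : ∀ (Q : ℕ) (lam : Fin n → ℝ), ∑ i, lam i * l Q i = ∑ s, (q Q s : ℝ) * (∑ i, lam i • c i) s := by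
    intro Q lam
    simp only [hl, Finset.mul_sum, Finset.sum_apply, Pi.smul_apply, smul_eq_mul]
    rw [Finset.sum_comm]
    refine Finset.sum_congr rfl fun s _ => Finset.sum_congr rfl fun i _ => by ring
  have hli : LinearIndependent ℝ c := by
    rw [Fintype.linearIndependent_iff]
    intro g hg i
    by_contra hgi
    obtain ⟨k, _, hk⟩ := key P0 le_rfl g (fun h => hgi (by rw [h]; rfl))
    have := hk i
    rw [hdot, hg] at this
    simp only [Pi.zero_apply, mul_zero, Finset.sum_const_zero, abs_zero] at this
    have hpos : 0 < |g i| := abs_pos.2 hgi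
    have hP0R : (0 : ℝ) < ((P0 ^ (a + k) : ℕ) : ℝ) := by
      have : 0 < P0 := by omega
      positivity
    have : 0 < (1 / 2) * (|g i| * ((P0 ^ (a + k) : ℕ) : ℝ) ^ (-(τ i) - κ)) := by positivity
    linarith
  obtain ⟨J, fJ, b, hb, hcard⟩ := stmt4_ext d n c hli
  obtain ⟨c0, hmink⟩ := stmt4_mink d b
  set S := ∑ s, ‖b s‖ with hS
  have hS0 : 0 ≤ S := by positivity
  set c1 := 1 / (2 * (S + 1)) with hc1
  have hc10 : 0 < c1 := by positivity
  obtain ⟨c3, hc30, hscale⟩ := stmt4_scale n hn τ T hT a K κ hκ hκτ P0 hP02 c1 hc10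
  set C2 := d * C * S with hC2
  have hC20 : 0 ≤ C2 := by positivity
  have hσ : 0 < (n : ℝ) + T - d - d * η := by linarith
  have hσtend : Tendsto (fun P : ℕ => (P : ℝ) ^ ((n : ℝ) + T - d - d * η)) atTop atTop :=
    (tendsto_rpow_atTop hσ).comp tendsto_natCast_atTop_atTop
  have hcast : Tendsto (fun P : ℕ => (P : ℝ)) atTop atTop := tendsto_natCast_atTop_atTop
  obtain ⟨R, hRP0, hR4n, hRS, hRC2, hRc3, hRc0⟩ := ((eventually_ge_atTop P0).and
    ((hcast.eventually_ge_atTop (4 * (n : ℝ))).and ((hcast.eventually_ge_atTop (2 * S)).and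
    ((hcast.eventually_ge_atTop (4 * C2)).and ((hcast.eventually_gt_atTop (2 * C2 / c3)).and
    (hσtend.eventually_gt_atTop c0)))))).exists
  have hR2 : (2 : ℝ) ≤ R := by exact_mod_cast hP02.trans hRP0
  have hR0 : (0 : ℝ) < R := by linarith
  set Q := R ^ (a + K) with hQ
  have hRQ : R ≤ Q := Nat.le_self_pow (by omega) R
  have hRQ' : (R : ℝ) ≤ (Q : ℝ) := by exact_mod_cast hRQ
  have hQ0 : (0 : ℝ) < Q := by linarith
  have hKT : 0 ≤ (K : ℝ) * T := by positivity
  have hbη : (2 : ℝ) * (K * T + 1) ≤ (a + K) * η := by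
    have : 0 ≤ (K : ℝ) * η := by positivity
    linarith
  -- Minkowski
  obtain ⟨x, hx0, hx⟩ := hmink (Sum.elim (fun i => (Q : ℝ) ^ (τ i - η)) (fun _ => (Q : ℝ) ^ (-1 - η)))
    (by rintro (i | j) <;> simp <;> positivity) (by
      rw [Fintype.prod_sum_type]
      simp only [Sum.elim_inl, Sum.elim_inr]
      rw [← Real.rpow_sum_of_pos hQ0, ← Real.rpow_sum_of_pos hQ0, ← Real.rpow_add hQ0]
      have : (∑ i, (τ i - η)) + ∑ _j : J, (-1 - η) = (n : ℝ) + T - d - d * η := by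
        rw [Finset.sum_sub_distrib, ← hTdef]
        simp only [Finset.sum_const, Finset.card_univ, Fintype.card_fin, nsmul_eq_mul]
        have : (d : ℝ) = n + Fintype.card J := by exact_mod_cast hcard.symm
        rw [this]; ring
      rw [this]
      exact hRc0.trans_le (Real.rpow_le_rpow hR0.le hRQ' hσ.le))
  set xr : Fin d → ℝ := fun t => (x t : ℝ) with hxr
  set lam : Fin n → ℝ := fun i => b.repr xr (Sum.inl i) with hlam
  set u : J → ℝ := fun j => b.repr xr (Sum.inr j) with hu
  set U : Fin d → ℝ := ∑ j, u j • b (Sum.inr j) with hU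
  have hxdec : xr = ∑ i, lam i • c i + U := by
    conv_lhs => rw [← b.sum_repr xr]
    rw [Fintype.sum_sum_type]
    simp only [hb]
    rfl
  have hlamA : ∀ i, |lam i| ≤ (Q : ℝ) ^ (τ i - η) := fun i => hx (Sum.inl i)
  have huA : ∀ j, |u j| ≤ (Q : ℝ) ^ (-1 - η) := fun j => hx (Sum.inr j)
  set δ := (Q : ℝ) ^ (-1 - η) with hδ
  have hδ0 : 0 < δ := by positivity
  have hSsplit : S = ∑ i, ‖c i‖ + ∑ j, ‖b (Sum.inr j)‖ := by
    rw [hS, Fintype.sum_sum_type]; simp only [hb]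
  have hUn : ‖U‖ ≤ δ * S := by
    calc ‖U‖ ≤ ∑ j, ‖u j • b (Sum.inr j)‖ := norm_sum_le _ _
      _ ≤ ∑ j, δ * ‖b (Sum.inr j)‖ := by
          refine Finset.sum_le_sum fun j _ => ?_
          rw [norm_smul, Real.norm_eq_abs]
          gcongr
          exact huA j
      _ = δ * ∑ j, ‖b (Sum.inr j)‖ := by rw [Finset.mul_sum]
      _ ≤ δ * S := by
          gcongr
          rw [hSsplit]
          have : 0 ≤ ∑ i, ‖c i‖ := by positivity
          linarith
  have hδR : δ ≤ (R : ℝ)⁻¹ := by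
    calc δ ≤ (Q : ℝ) ^ (-1 : ℝ) := Real.rpow_le_rpow_of_exponent_le (by linarith) (by linarith)
      _ = (Q : ℝ)⁻¹ := Real.rpow_neg_one _
      _ ≤ (R : ℝ)⁻¹ := by gcongr
  have hxn : 1 ≤ ‖xr‖ := by
    obtain ⟨t, ht⟩ := Function.ne_iff.1 hx0
    have h1 := norm_le_pi_norm xr t
    refine le_trans ?_ h1
    rw [Real.norm_eq_abs]
    change 1 ≤ |(x t : ℝ)|
    have : (1 : ℤ) ≤ |x t| := Int.one_le_abs ht
    exact_mod_cast this
  have hlamlow : ∃ i, c1 ≤ |lam i| := by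
    by_contra hno
    push Not at hno
    have h1 : ‖∑ i, lam i • c i‖ ≤ c1 * S := by
      calc ‖∑ i, lam i • c i‖ ≤ ∑ i, ‖lam i • c i‖ := norm_sum_le _ _
        _ ≤ ∑ i, c1 * ‖c i‖ := by
            refine Finset.sum_le_sum fun i _ => ?_
            rw [norm_smul, Real.norm_eq_abs]
            gcongr
            exact (hno i).le
        _ = c1 * ∑ i, ‖c i‖ := by rw [Finset.mul_sum]
        _ ≤ c1 * S := by
            gcongr
            rw [hSsplit]
            have : 0 ≤ ∑ j, ‖b (Sum.inr j)‖ := by positivity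
            linarith
    have h2 : c1 * S < 1 / 2 := by
      rw [hc1, div_mul_eq_mul_div, div_lt_iff₀ (by positivity)]
      linarith
    have h3 : δ * S ≤ 1 / 2 := by
      calc δ * S ≤ (R : ℝ)⁻¹ * S := by gcongr
        _ ≤ 1 / 2 := by
          rw [inv_mul_eq_div, div_le_iff₀ hR0]; linarith
    have h4 := norm_add_le (∑ i, lam i • c i) U
    rw [← hxdec] at h4
    linarith
  have hlam0 : lam ≠ 0 := by
    obtain ⟨i, hi⟩ := hlamlow
    intro h
    rw [h] at hi
    simp at hi
    linarith
  obtain ⟨P, hPP0, hPR, hPup, i0, hPlow⟩ := hscale R hRP0 lam hlamlow (by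
    intro i
    calc |lam i| * (R : ℝ) ^ (-(a * (τ i - κ))) ≤ (Q : ℝ) ^ (τ i - η) * (R : ℝ) ^ (-(a * (τ i - κ))) := by
          gcongr; exact hlamA i
      _ = (R : ℝ) ^ (((a : ℝ) + K) * (τ i - η) + -(a * (τ i - κ))) := by
          rw [hQ, stmt4_pow, ← Real.rpow_add hR0]; push_cast; rfl
      _ ≤ (R : ℝ) ^ (-1 : ℝ) := by
          refine Real.rpow_le_rpow_of_exponent_le (by linarith) ?_
          have h1 : (K : ℝ) * τ i ≤ K * T := by gcongr; exact hT i
          have h2 : (a : ℝ) * κ ≤ a * (η / 4) := by gcongr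
          have h3 : 0 ≤ (K : ℝ) * η := by positivity
          nlinarith
      _ = (R : ℝ)⁻¹ := Real.rpow_neg_one _
      _ ≤ 1 / (4 * n) := by
          rw [one_div]
          gcongr)
  obtain ⟨k, hkK, hkey⟩ := key P hPP0 lam hlam0
  have hPlow := hPlow k hkK
  have hkey := hkey i0
  have hPup : ∀ i, _ := fun i => hPup i k hkK
  set Q' := P ^ (a + k) with hQ'
  have hP2 : 2 ≤ P := hP02.trans hPP0
  have hQ'Q : Q' ≤ Q :=
    (Nat.pow_le_pow_left hPR _).trans (Nat.pow_le_pow_right (by omega) (by omega))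
  have hQ'N : N0 ≤ Q' := hP0N.trans (hPP0.trans (Nat.le_self_pow (by omega) P))
  obtain ⟨hqs, hqi⟩ := hq Q' hQ'N
  have hqU : |∑ s, (q Q' s : ℝ) * U s| ≤ C2 * (R : ℝ) ^ (-((a + K) * η)) := by
    calc |∑ s, (q Q' s : ℝ) * U s| ≤ ∑ s, |(q Q' s : ℝ) * U s| := Finset.abs_sum_le_sum_abs _ _
      _ ≤ ∑ _s : Fin d, C * Q * (δ * S) := by
          refine Finset.sum_le_sum fun s _ => ?_
          rw [abs_mul]
          have h1 : |(q Q' s : ℝ)| ≤ C * Q := (hqs s).trans (by gcongr)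
          have h2 : |U s| ≤ δ * S := by
            have := norm_le_pi_norm U s
            rw [Real.norm_eq_abs] at this
            exact this.trans hUn
          exact mul_le_mul h1 h2 (abs_nonneg _) (by positivity)
      _ = C2 * ((Q : ℝ) * δ) := by simp [hC2]; ring
      _ = C2 * (R : ℝ) ^ (-((a + K) * η)) := by
          congr 1
          have : (Q : ℝ) * δ = (Q : ℝ) ^ (-η) := by
            rw [hδ]
            nth_rewrite 1 [← Real.rpow_one (Q : ℝ)]
            rw [← Real.rpow_add hQ0]
            congr 1; ring
          rw [this, hQ, stmt4_pow]
          congr 1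
          push_cast; ring
  have hqU4 : |∑ s, (q Q' s : ℝ) * U s| ≤ 1 / 4 := by
    refine hqU.trans ?_
    calc C2 * (R : ℝ) ^ (-((a + K) * η)) ≤ C2 * (R : ℝ) ^ (-1 : ℝ) := by
          gcongr
          · linarith
          · linarith
      _ = C2 / R := by rw [Real.rpow_neg_one]; rfl
      _ ≤ 1 / 4 := by rw [div_le_iff₀ hR0]; linarith
  have hlamsum : |∑ i, lam i * l Q' i| ≤ 1 / 4 := by
    calc |∑ i, lam i * l Q' i| ≤ ∑ i, |lam i * l Q' i| := Finset.abs_sum_le_sum_abs _ _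
      _ ≤ ∑ _i : Fin n, 1 / (4 * (n : ℝ)) := by
          refine Finset.sum_le_sum fun i _ => ?_
          rw [abs_mul]
          exact (mul_le_mul_of_nonneg_left (hqi i).2 (abs_nonneg _)).trans (hPup i)
      _ = 1 / 4 := by
          simp only [Finset.sum_const, Finset.card_univ, Fintype.card_fin, nsmul_eq_mul]
          field_simp
  have htot : ((∑ s, q Q' s * x s : ℤ) : ℝ) = ∑ i, lam i * l Q' i + ∑ s, (q Q' s : ℝ) * U s := by
    rw [hdot, ← Finset.sum_add_distrib]
    push_cast
    refine Finset.sum_congr rfl fun s _ => ?_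
    rw [← mul_add]
    congr 1
    exact congrFun hxdec s
  have hzero : (∑ s, q Q' s * x s : ℤ) = 0 := by
    apply Int.abs_lt_one_iff.1
    have : |((∑ s, q Q' s * x s : ℤ) : ℝ)| < 1 := by
      rw [htot]
      have := abs_add_le (∑ i, lam i * l Q' i) (∑ s, (q Q' s : ℝ) * U s)
      linarith
    exact_mod_cast this
  have hsmall : |∑ i, lam i * l Q' i| ≤ C2 * (R : ℝ) ^ (-((a + K) * η)) := by
    rw [hzero, Int.cast_zero] at htot
    have : ∑ i, lam i * l Q' i = -∑ s, (q Q' s : ℝ) * U s := by linarith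
    rw [this, abs_neg]
    exact hqU
  have hfin : c3 * (R : ℝ) ^ (-((2 * a + K) * κ + K * T)) ≤ 2 * C2 * (R : ℝ) ^ (-((a + K) * η)) := by
    linarith
  have hexp : (R : ℝ) ^ (-((a + K) * η)) ≤
      (R : ℝ)⁻¹ * (R : ℝ) ^ (-((2 * a + K) * κ + K * T)) := by
    rw [← Real.rpow_neg_one, ← Real.rpow_add hR0]
    refine Real.rpow_le_rpow_of_exponent_le (by linarith) ?_
    have h2 : (2 * (a : ℝ) + K) * κ ≤ (2 * a + K) * (η / 4) := by gcongr
    have h3 : 0 ≤ (K : ℝ) * η := by positivity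
    nlinarith
  have hpos : 0 < (R : ℝ) ^ (-((2 * a + K) * κ + K * T)) := by positivity
  have h1 : c3 * (R : ℝ) ^ (-((2 * a + K) * κ + K * T)) ≤
      (2 * C2 * (R : ℝ)⁻¹) * (R : ℝ) ^ (-((2 * a + K) * κ + K * T)) := by
    refine hfin.trans ?_
    rw [mul_assoc (2 * C2)]
    gcongr
  have h2 := le_of_mul_le_mul_right h1 hpos
  rw [← div_eq_mul_inv, le_div_iff₀ hR0] at h2
  rw [div_lt_iff₀ hc30] at hRc3
  linarith

lemma stmt4_int {m : ℕ} (v : Fin m → ℝ) (hv : ∀ i, ∃ a : ℚ, v i = (a : ℝ)) :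
    ∃ (N : ℕ) (z : Fin m → ℤ), N ≠ 0 ∧ ∀ i, (z i : ℝ) = N * v i := by
  choose a ha using hv
  refine ⟨∏ i, (a i).den, fun i => (a i).num * ∏ j ∈ Finset.univ.erase i, ((a j).den : ℤ), ?_, ?_⟩
  · exact Finset.prod_ne_zero_iff.2 (fun i _ => (a i).den_nz)
  · intro i
    rw [ha, ← Finset.mul_prod_erase _ _ (Finset.mem_univ i)]
    push_cast
    have h : ((a i).num : ℝ) = (a i).den * (a i : ℝ) := by
      have := (a i).den_mul_eq_num
      exact_mod_cast this.symm
    rw [h]; ring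

theorem stmt4 (m n : ℕ) (hn : 0 < n) (hmn : n < m)
    (e : Fin n → Fin m → ℝ)
    (τ : Fin n → ℝ) (hτ : ∀ i, 0 < τ i) (hτinj : Function.Injective τ)
    (ε : Fin n → ℕ → ℝ) (hε : ∀ i, Tendsto (ε i) atTop (nhds 0))
    (H : ∀ᶠ Q : ℕ in atTop, ∃ q : Fin m → ℤ, supZ q ≤ Q ∧
      ∀ i, (Q : ℝ) ^ (-(τ i) - ε i Q) ≤ |∑ k, (q k : ℝ) * e i k| ∧
        |∑ k, (q k : ℝ) * e i k| ≤ (Q : ℝ) ^ (-(τ i) + ε i Q))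
    (F : Submodule ℝ (Fin m → ℝ)) (hF : DefinedOverQ F) (heF : ∀ i, e i ∈ F) :
    (n : ℝ) + ∑ i, τ i ≤ Module.finrank ℝ F := by
  obtain ⟨B, hB, hFB⟩ := hF
  obtain ⟨B', hB', hspan, hli⟩ := exists_linearIndependent ℝ B
  have hFB' : F = Submodule.span ℝ B' := by rw [hFB, hspan]
  have hfin : Finite B' := hli.finite
  have : Fintype B' := Fintype.ofFinite _
  set d := Fintype.card B' with hd
  have hfr : Module.finrank ℝ F = d := by
    rw [hFB']
    have := finrank_span_eq_card hli
    rw [Subtype.range_coe] at this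
    exact this
  rw [hfr]
  let σ : Fin d ≃ B' := (Fintype.equivFin B').symm
  have hZ : ∀ s : Fin d, ∃ (N : ℕ) (z : Fin m → ℤ), N ≠ 0 ∧ ∀ i, (z i : ℝ) = N * (σ s : Fin m → ℝ) i :=
    fun s => stmt4_int _ (hB _ (hB' (σ s).2))
  choose N z hN hz using hZ
  have hcoef : ∀ i, ∃ c : Fin d → ℝ, ∀ k, e i k = ∑ s, c s * (z s k : ℝ) := by
    intro i
    have h1 : e i ∈ Submodule.span ℝ (Set.range (fun s : Fin d => (σ s : Fin m → ℝ))) := by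
      have : Set.range (fun s : Fin d => (σ s : Fin m → ℝ)) = B' := by
        have h2 : (fun s : Fin d => (σ s : Fin m → ℝ)) = Subtype.val ∘ σ := rfl
        rw [h2, σ.surjective.range_comp, Subtype.range_coe]
      rw [this, ← hFB']
      exact heF i
    obtain ⟨g, hg⟩ := (Submodule.mem_span_range_iff_exists_fun ℝ).1 h1
    refine ⟨fun s => g s / N s, fun k => ?_⟩
    rw [← hg]
    simp only [Finset.sum_apply, Pi.smul_apply, smul_eq_mul]
    refine Finset.sum_congr rfl fun s _ => ?_
    rw [hz]
    have : (N s : ℝ) ≠ 0 := by exact_mod_cast hN s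
    field_simp
  choose c hc using hcoef
  refine stmt4_core d n hn c τ hτ hτinj (∑ s, ∑ k, |(z s k : ℝ)|) (by positivity) ?_
  intro κ hκ
  have hall : ∀ᶠ Q : ℕ in atTop, ∀ i, |ε i Q| ≤ κ := by
    rw [eventually_all]
    intro i
    have := (hε i).abs
    rw [abs_zero] at this
    exact (this.eventually (eventually_lt_nhds hκ)).mono fun _ h => h.le
  filter_upwards [H, hall, eventually_ge_atTop 1] with Q ⟨q, hq1, hq2⟩ hεQ hQ1
  have hQ : (1 : ℝ) ≤ Q := by exact_mod_cast hQ1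
  refine ⟨fun s => ∑ k, q k * z s k, ?_, ?_⟩
  · intro s
    push_cast
    refine (Finset.abs_sum_le_sum_abs _ _).trans ?_
    calc ∑ k, |(q k : ℝ) * (z s k : ℝ)| ≤ ∑ k, |(z s k : ℝ)| * Q := by
          refine Finset.sum_le_sum fun k _ => ?_
          rw [abs_mul, mul_comm]
          gcongr
          have := norm_le_pi_norm (fun i => (q i : ℝ)) k
          rw [Real.norm_eq_abs] at this
          exact this.trans hq1
      _ = (∑ k, |(z s k : ℝ)|) * Q := by rw [Finset.sum_mul]
      _ ≤ _ := by
          gcongr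
          exact Finset.single_le_sum (f := fun s => ∑ k, |(z s k : ℝ)|) (fun s _ => by positivity) (Finset.mem_univ s)
  · intro i
    have heq : ∑ s, (((∑ k, q k * z s k : ℤ)) : ℝ) * c i s = ∑ k, (q k : ℝ) * e i k := by
      simp only [hc]
      push_cast
      simp only [Finset.sum_mul, Finset.mul_sum]
      rw [Finset.sum_comm]
      refine Finset.sum_congr rfl fun k _ => Finset.sum_congr rfl fun s _ => by ring
    rw [heq]
    have h1 := abs_le.1 (hεQ i)
    exact ⟨(Real.rpow_le_rpow_of_exponent_le hQ (by linarith)).trans (hq2 i).1,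
      (hq2 i).2.trans (Real.rpow_le_rpow_of_exponent_le hQ (by linarith))⟩
end
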